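/- arXiv:2206.01844 — 2 statements merged into one kernel-verified Lean document; each statement's English description precedes it below -/
import Mathlib

section
/- For every k ≥ 3 there exists a positive constant c_1 depending only on k and an n_0 such that for every n ≥ n_0 there exists a partial Steiner (n,k,2)-system S with ϑ(S) ≥ c_1 · n^{k/(k-1)} / (log n)^{1/(k-1)}. -/
open Finset

variable {V : Type*} [DecidableEq V]

/-- `I` is an independent set of the hypergraph `G`: no edge of `G` is contained in `I`. -/
def IsIndep (G : Finset (Finset V)) (I : Finset V) : Prop :=
  ∀ e ∈ G, ¬ e ⊆ I

/-- The degree of a vertex set `S` in the hypergraph `G`: the number of edges containing `S`. -/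
def degS (G : Finset (Finset V)) (S : Finset V) : ℕ :=
  (G.filter fun e => S ⊆ e).card

/-- `ϑ(G)`: the minimum `t` such that there are independent sets `I_1, …, I_t` of `G`
covering every edge of the complement of `G` (i.e. every `k`-set which is not an edge). -/
noncomputable def vartheta (k : ℕ) (G : Finset (Finset V)) : ℕ :=
  sInf {t | ∃ I : Fin t → Finset V,
    (∀ j, IsIndep G (I j)) ∧
    ∀ e : Finset V, e.card = k → e ∉ G → ∃ j, e ⊆ I j}

/-- `G` is a `d`-balanced `k`-graph: `Δ_i(G) ≤ d^{(k-i)/(k-1)}` for all `1 ≤ i ≤ k`. -/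
def IsBalanced (k d : ℕ) (G : Finset (Finset V)) : Prop :=
  ∀ i : ℕ, 1 ≤ i → i ≤ k → ∀ S : Finset V, S.card = i →
    (degS G S : ℝ) ≤ (d : ℝ) ^ (((k : ℝ) - i) / ((k : ℝ) - 1))

/-- `S` is a partial Steiner `(n,k,2)`-system: a `k`-graph in which every pair of distinct
vertices lies in at most one edge. -/
def IsPartialSteiner (k : ℕ) (S : Finset (Finset V)) : Prop :=
  (∀ e ∈ S, e.card = k) ∧ ∀ x y : V, x ≠ y → degS S {x, y} ≤ 1


open scoped Classical in
/-- The elements which can be added to `S` without leaving the family `P`. -/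
noncomputable def extensions {β : Type*} [Fintype β] [DecidableEq β] (P : Finset β → Prop)
    (S : Finset β) : Finset β :=
  univ.filter fun e => e ∉ S ∧ P (insert e S)

/-- If `g` does not decrease on average when a random admissible element is added, and there are
always at least `a` admissible elements, then the total positive part of `g` on members of the
hereditary family `P` of size `j` is at least `a ^ j / j ! * g ∅`. -/
lemma pow_mul_le_factorial_mul_sum {β : Type*} [Fintype β] [DecidableEq β]
    (P : Finset β → Prop) [DecidablePred P] (hP : ∀ S T, S ⊆ T → P T → P S) (h0 : P ∅)
    (g : Finset β → ℝ) (a : ℝ) (ha : 0 ≤ a) (J : ℕ)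
    (hA : ∀ S, P S → #S < J → a ≤ #(extensions P S))
    (hg : ∀ S, P S → #S < J →
      #(extensions P S) * g S ≤ ∑ e ∈ extensions P S, g (insert e S)) :
    ∀ j ≤ J, a ^ j * g ∅ ≤
      j.factorial * ∑ S ∈ univ.filter (fun S => P S ∧ #S = j), max (g S) 0 := by
  intro j
  induction j with
  | zero =>
    intro _
    have : (univ.filter (fun S : Finset β => P S ∧ #S = 0)) = {∅} := by
      ext S
      simp only [mem_filter, mem_univ, true_and, card_eq_zero, mem_singleton]
      exact ⟨fun h => h.2, fun h => ⟨h ▸ h0, h⟩⟩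
    rw [this]
    simp
  | succ j ih =>
    intro hj
    have ih := ih (by omega)
    have key : ∑ S ∈ univ.filter (fun S => P S ∧ #S = j),
        ∑ e ∈ extensions P S, max (g (insert e S)) 0 =
        ∑ T ∈ univ.filter (fun T => P T ∧ #T = j + 1), ∑ e ∈ T, max (g T) 0 := by
      rw [Finset.sum_sigma', Finset.sum_sigma']
      refine Finset.sum_bij' (fun x _ => ⟨insert x.2 x.1, x.2⟩) (fun x _ => ⟨x.1.erase x.2, x.2⟩)
        ?_ ?_ ?_ ?_ ?_
      · rintro ⟨S, e⟩ h
        simp only [extensions, mem_sigma, mem_filter, mem_univ, true_and] at h ⊢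
        refine ⟨⟨h.2.2, ?_⟩, mem_insert_self _ _⟩
        rw [card_insert_of_notMem h.2.1, h.1.2]
      · rintro ⟨T, e⟩ h
        simp only [extensions, mem_sigma, mem_filter, mem_univ, true_and] at h ⊢
        refine ⟨⟨hP _ _ (erase_subset _ _) h.1.1, ?_⟩, notMem_erase _ _, ?_⟩
        · rw [card_erase_of_mem h.2, h.1.2]; rfl
        · rw [insert_erase h.2]; exact h.1.1
      · rintro ⟨S, e⟩ h
        simp only [extensions, mem_sigma, mem_filter, mem_univ, true_and] at h ⊢
        rw [erase_insert h.2.1]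
      · rintro ⟨T, e⟩ h
        simp only [mem_sigma, mem_filter, mem_univ, true_and] at h ⊢
        rw [insert_erase h.2]
      · rintro ⟨S, e⟩ h
        rfl
    have key2 : ∑ T ∈ univ.filter (fun T => P T ∧ #T = j + 1), ∑ e ∈ T, max (g T) 0 =
        (j + 1) * ∑ T ∈ univ.filter (fun T => P T ∧ #T = j + 1), max (g T) 0 := by
      rw [Finset.mul_sum]
      refine Finset.sum_congr rfl fun T hT => ?_
      simp only [mem_filter, mem_univ, true_and] at hT
      rw [sum_const, hT.2, nsmul_eq_mul]
      push_cast
      ring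
    have key3 : a * ∑ S ∈ univ.filter (fun S => P S ∧ #S = j), max (g S) 0 ≤
        ∑ S ∈ univ.filter (fun S => P S ∧ #S = j),
          ∑ e ∈ extensions P S, max (g (insert e S)) 0 := by
      rw [Finset.mul_sum]
      refine Finset.sum_le_sum fun S hS => ?_
      simp only [mem_filter, mem_univ, true_and] at hS
      have hA' := hA S hS.1 (by omega)
      have hg' := hg S hS.1 (by omega)
      have h1 : ∑ e ∈ extensions P S, g (insert e S) ≤
          ∑ e ∈ extensions P S, max (g (insert e S)) 0 :=
        Finset.sum_le_sum fun e _ => le_max_left _ _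
      have h2 : 0 ≤ ∑ e ∈ extensions P S, max (g (insert e S)) 0 :=
        Finset.sum_nonneg fun e _ => le_max_right _ _
      rcases le_total (g S) 0 with h | h
      · rw [max_eq_right h, mul_zero]; exact h2
      · rw [max_eq_left h]
        exact ((mul_le_mul_of_nonneg_right hA' h).trans hg').trans h1
    rw [key, key2] at key3
    calc a ^ (j + 1) * g ∅ = a * (a ^ j * g ∅) := by ring
      _ ≤ a * (j.factorial * ∑ S ∈ univ.filter (fun S => P S ∧ #S = j), max (g S) 0) :=
        mul_le_mul_of_nonneg_left ih ha
      _ = j.factorial * (a * ∑ S ∈ univ.filter (fun S => P S ∧ #S = j), max (g S) 0) := by ring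
      _ ≤ j.factorial *
          ((j + 1) * ∑ T ∈ univ.filter (fun T => P T ∧ #T = j + 1), max (g T) 0) :=
        mul_le_mul_of_nonneg_left key3 (by positivity)
      _ = _ := by rw [Nat.factorial_succ]; push_cast; ring

/-- The number of `k`-subsets of `W` meeting `f` in at least two points. -/
lemma card_filter_two_le_card_inter_le (k : ℕ) (W f : Finset V) (m : ℕ) (hm : #f ≤ m) :
    #((W.powersetCard k).filter fun e => 2 ≤ #(e ∩ f)) ≤
      m.choose 2 * (#W - 2).choose (k - 2) := by
  have hsub : ((W.powersetCard k).filter fun e => 2 ≤ #(e ∩ f)) ⊆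
      ((W ∩ f).powersetCard 2).biUnion fun p => ((W \ p).powersetCard (k - 2)).image (· ∪ p) := by
    intro e he
    simp only [mem_filter, mem_powersetCard] at he
    obtain ⟨p, hp, hpc⟩ := exists_subset_card_eq he.2
    have hpe : p ⊆ e := hp.trans inter_subset_left
    simp only [mem_biUnion, mem_powersetCard, mem_image]
    refine ⟨p, ⟨subset_inter (hpe.trans he.1.1) (hp.trans inter_subset_right), hpc⟩,
      e \ p, ⟨sdiff_subset_sdiff he.1.1 le_rfl, ?_⟩, sdiff_union_of_subset hpe⟩
    rw [card_sdiff_of_subset hpe, he.1.2, hpc]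
  refine (card_le_card hsub).trans ?_
  refine (card_biUnion_le_card_mul _ _ ((#W - 2).choose (k - 2)) ?_).trans ?_
  · intro p hp
    rw [mem_powersetCard] at hp
    refine card_image_le.trans ?_
    rw [card_powersetCard, card_sdiff_of_subset (hp.1.trans inter_subset_left), hp.2]
  · rw [card_powersetCard]
    exact Nat.mul_le_mul_right _
      (Nat.choose_le_choose _ ((card_le_card inter_subset_right).trans hm))

/-- `S` is a linear `k`-graph: distinct edges share at most one vertex. -/
def IsLinearHypergraph (k : ℕ) (S : Finset (Finset V)) : Prop :=
  (∀ e ∈ S, #e = k) ∧ ∀ e ∈ S, ∀ f ∈ S, e ≠ f → #(e ∩ f) ≤ 1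

lemma IsLinearHypergraph.mono {k : ℕ} {S T : Finset (Finset V)} (h : S ⊆ T)
    (hT : IsLinearHypergraph k T) : IsLinearHypergraph k S :=
  ⟨fun e he => hT.1 e (h he), fun e he f hf => hT.2 e (h he) f (h hf)⟩

lemma IsLinearHypergraph.isPartialSteiner {k : ℕ} {S : Finset (Finset V)}
    (hS : IsLinearHypergraph k S) : IsPartialSteiner k S := by
  refine ⟨hS.1, fun x y hxy => ?_⟩
  unfold degS
  rw [card_le_one]
  intro e he f hf
  rw [mem_filter] at he hf
  by_contra hne
  have h1 := hS.2 e he.1 f hf.1 hne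
  have h2 := card_le_card (subset_inter he.2 hf.2)
  rw [card_pair hxy] at h2
  omega

/-- The number of edges of `S` with at least two vertices in `W`. -/
def touching (W : Finset V) (S : Finset (Finset V)) : ℕ :=
  #(S.filter fun f => 2 ≤ #(f ∩ W))

lemma extensions_isLinearHypergraph [Fintype V] {k : ℕ} (hk : 2 ≤ k) {S : Finset (Finset V)}
    (hS : IsLinearHypergraph k S) :
    extensions (IsLinearHypergraph k) S =
      ((univ : Finset V).powersetCard k).filter fun e => ∀ f ∈ S, ¬ 2 ≤ #(e ∩ f) := by
  ext e
  simp only [extensions, mem_filter, mem_univ, true_and, mem_powersetCard, subset_univ]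
  constructor
  · rintro ⟨he, h⟩
    refine ⟨h.1 e (mem_insert_self _ _), fun f hf => ?_⟩
    have := h.2 e (mem_insert_self _ _) f (mem_insert_of_mem hf) (fun h => he (h ▸ hf))
    omega
  · rintro ⟨hc, h⟩
    refine ⟨fun he => ?_, ?_, ?_⟩
    · have := h e he
      rw [inter_self] at this
      omega
    · intro f hf
      rcases mem_insert.1 hf with rfl | hf
      · exact hc
      · exact hS.1 f hf
    · intro f hf f' hf' hne
      rcases mem_insert.1 hf with rfl | hfS <;> rcases mem_insert.1 hf' with rfl | hfS'
      · exact absurd rfl hne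
      · have := h f' hfS'; omega
      · have := h f hfS; rw [inter_comm]; omega
      · exact hS.2 f hfS f' hfS' hne

/-- Lower bound on the number of admissible edges inside `W`. -/
lemma choose_le_card_extensions_add [Fintype V] {k : ℕ} (hk : 2 ≤ k) {S : Finset (Finset V)}
    (hS : IsLinearHypergraph k S) (W : Finset V) :
    (#W).choose k ≤ #((extensions (IsLinearHypergraph k) S).filter (· ⊆ W)) +
      touching W S * (k.choose 2 * (#W - 2).choose (k - 2)) := by
  rw [extensions_isLinearHypergraph hk hS, ← card_powersetCard]
  have hsub : W.powersetCard k ⊆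
      ((((univ : Finset V).powersetCard k).filter
        fun e => ∀ f ∈ S, ¬ 2 ≤ #(e ∩ f)).filter (· ⊆ W)) ∪
      (S.filter fun f => 2 ≤ #(f ∩ W)).biUnion
        fun f => (W.powersetCard k).filter fun e => 2 ≤ #(e ∩ f) := by
    intro e he
    rw [mem_powersetCard] at he
    by_cases h : ∀ f ∈ S, ¬ 2 ≤ #(e ∩ f)
    · refine mem_union_left _ ?_
      simp only [mem_filter, mem_powersetCard, subset_univ, true_and]
      exact ⟨⟨he.2, h⟩, he.1⟩
    · push Not at h
      obtain ⟨f, hf, hef⟩ := h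
      refine mem_union_right _ ?_
      simp only [mem_biUnion, mem_filter, mem_powersetCard]
      refine ⟨f, ⟨hf, hef.trans (card_le_card ?_)⟩, he, hef⟩
      rw [inter_comm]
      exact inter_subset_inter le_rfl he.1
  refine (card_le_card hsub).trans ((card_union_le _ _).trans (Nat.add_le_add_left ?_ _))
  refine card_biUnion_le_card_mul _ _ _ fun f hf => ?_
  exact card_filter_two_le_card_inter_le k W f k (hS.1 f (mem_filter.1 hf).1).le

lemma choose_le_card_extensions_univ_add [Fintype V] {k : ℕ} (hk : 2 ≤ k) {S : Finset (Finset V)}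
    (hS : IsLinearHypergraph k S) :
    (Fintype.card V).choose k ≤ #(extensions (IsLinearHypergraph k) S) +
      #S * (k.choose 2 * (Fintype.card V - 2).choose (k - 2)) := by
  have h := choose_le_card_extensions_add hk hS univ
  rw [card_univ] at h
  refine h.trans (Nat.add_le_add (card_le_card (filter_subset _ _)) (Nat.mul_le_mul_right _ ?_))
  exact card_le_card (filter_subset _ _)

lemma card_extensions_le [Fintype V] {k : ℕ} (hk : 2 ≤ k) {S : Finset (Finset V)}
    (hS : IsLinearHypergraph k S) :
    #(extensions (IsLinearHypergraph k) S) ≤ (Fintype.card V).choose k := by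
  rw [extensions_isLinearHypergraph hk hS]
  refine (card_le_card (filter_subset _ _)).trans ?_
  rw [card_powersetCard, card_univ]

lemma card_extensions_touching_le [Fintype V] {k : ℕ} (hk : 2 ≤ k) {S : Finset (Finset V)}
    (hS : IsLinearHypergraph k S) (W : Finset V) :
    #((extensions (IsLinearHypergraph k) S).filter fun e => 2 ≤ #(e ∩ W)) ≤
      (#W).choose 2 * (Fintype.card V - 2).choose (k - 2) := by
  rw [extensions_isLinearHypergraph hk hS]
  refine (card_le_card (filter_subset_filter _ (filter_subset _ _))).trans ?_
  exact (card_filter_two_le_card_inter_le k univ W _ le_rfl).trans (by rw [card_univ])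

lemma touching_insert (W e : Finset V) {S : Finset (Finset V)} (he : e ∉ S) :
    touching W (insert e S) = touching W S + if 2 ≤ #(e ∩ W) then 1 else 0 := by
  unfold touching
  rw [filter_insert]
  split_ifs with h
  · rw [card_insert_of_notMem (fun h' => he (mem_filter.1 h').1)]
  · rfl

/-- Potential controlling the number of edges touching `W`. -/
noncomputable def touchPotential (J s : ℕ) (r : ℝ) (W : Finset V) (S : Finset (Finset V)) : ℝ :=
  2 ^ touching W S * (1 + r) ^ (J - #S) / 2 ^ s

open scoped Classical in
/-- Potential controlling the event that no edge lies inside `W`, as long as fewer than `s` edges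
touch `W`. -/
noncomputable def indepPotential (J s : ℕ) (q : ℝ) (W : Finset V) (S : Finset (Finset V)) : ℝ :=
  if touching W S < s ∧ IsIndep S W then (1 - q) ^ (J - #S) else 0

lemma touchPotential_nonneg (J s : ℕ) {r : ℝ} (hr : 0 ≤ r) (W : Finset V)
    (S : Finset (Finset V)) : 0 ≤ touchPotential J s r W S := by
  unfold touchPotential
  positivity

lemma indepPotential_nonneg (J s : ℕ) {q : ℝ} (hq : q ≤ 1) (W : Finset V)
    (S : Finset (Finset V)) : 0 ≤ indepPotential J s q W S := by
  unfold indepPotential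
  split_ifs
  · exact pow_nonneg (by linarith) _
  · rfl

lemma sum_touchPotential_insert_le (J s : ℕ) {r : ℝ} (hr : 0 ≤ r) (W : Finset V)
    {S : Finset (Finset V)} (hS : #S < J) (X : Finset (Finset V)) (hX : ∀ e ∈ X, e ∉ S)
    (hXr : (#(X.filter fun e => 2 ≤ #(e ∩ W)) : ℝ) ≤ r * #X) :
    ∑ e ∈ X, touchPotential J s r W (insert e S) ≤ #X * touchPotential J s r W S := by
  have h1 : ∀ e ∈ X, touchPotential J s r W (insert e S) =
      (1 + if 2 ≤ #(e ∩ W) then 1 else 0) *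
        (2 ^ touching W S * (1 + r) ^ (J - (#S + 1)) / 2 ^ s) := by
    intro e he
    unfold touchPotential
    rw [touching_insert W e (hX e he), card_insert_of_notMem (hX e he)]
    split_ifs <;> ring
  rw [sum_congr rfl h1, ← sum_mul, sum_add_distrib, sum_boole, sum_const, nsmul_eq_mul, mul_one]
  have h2 : touchPotential J s r W S =
      (1 + r) * (2 ^ touching W S * (1 + r) ^ (J - (#S + 1)) / 2 ^ s) := by
    unfold touchPotential
    rw [show J - #S = J - (#S + 1) + 1 by omega, pow_succ]
    ring
  rw [h2, ← mul_assoc]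
  exact mul_le_mul_of_nonneg_right (by linarith) (by positivity)

lemma sum_indepPotential_insert_le (J s : ℕ) {q : ℝ} (hq : q ≤ 1) (W : Finset V)
    {S : Finset (Finset V)} (hS : #S < J) (X : Finset (Finset V)) (hX : ∀ e ∈ X, e ∉ S)
    (hXq : touching W S < s → q * #X ≤ (#(X.filter (· ⊆ W)) : ℝ)) :
    ∑ e ∈ X, indepPotential J s q W (insert e S) ≤ #X * indepPotential J s q W S := by
  by_cases h : touching W S < s ∧ IsIndep S W
  · have h1 : ∀ e ∈ X, indepPotential J s q W (insert e S) ≤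
        (1 - if e ⊆ W then 1 else 0) * (1 - q) ^ (J - (#S + 1)) := by
      intro e he
      have hpos : 0 ≤ (1 - q) ^ (J - (#S + 1)) := pow_nonneg (by linarith) _
      unfold indepPotential
      rw [card_insert_of_notMem (hX e he)]
      by_cases heW : e ⊆ W
      · rw [if_neg, if_pos heW]
        · simp
        · exact fun h' => h'.2 e (mem_insert_self _ _) heW
      · rw [if_neg heW]
        split_ifs
        · simp
        · simpa using hpos
    refine (sum_le_sum h1).trans ?_
    rw [← sum_mul, sum_sub_distrib, sum_boole, sum_const, nsmul_eq_mul, mul_one]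
    have h2 : indepPotential J s q W S = (1 - q) * (1 - q) ^ (J - (#S + 1)) := by
      unfold indepPotential
      rw [if_pos h, show J - #S = J - (#S + 1) + 1 by omega, pow_succ]
      ring
    rw [h2, ← mul_assoc]
    exact mul_le_mul_of_nonneg_right (by linarith [hXq h.1]) (pow_nonneg (by linarith) _)
  · have h1 : ∀ e ∈ X, indepPotential J s q W (insert e S) = 0 := by
      intro e he
      unfold indepPotential
      rw [if_neg]
      rintro ⟨h2, h3⟩
      refine h ⟨lt_of_le_of_lt ?_ h2, fun f hf => h3 f (mem_insert_of_mem hf)⟩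
      rw [touching_insert W e (hX e he)]
      exact Nat.le_add_right _ _
    rw [sum_congr rfl h1]
    unfold indepPotential
    rw [if_neg h]
    simp

lemma one_le_potential_of_isIndep {J s : ℕ} {r q : ℝ} (hr : 0 ≤ r) (hq : q ≤ 1) {W : Finset V}
    {S : Finset (Finset V)} (hS : #S = J) (hW : IsIndep S W) :
    1 ≤ touchPotential J s r W S + indepPotential J s q W S := by
  by_cases h : touching W S < s
  · have : indepPotential J s q W S = 1 := by
      unfold indepPotential
      rw [if_pos ⟨h, hW⟩, hS, Nat.sub_self, pow_zero]
    linarith [touchPotential_nonneg J s hr W S]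
  · have : 1 ≤ touchPotential J s r W S := by
      unfold touchPotential
      rw [hS, Nat.sub_self, pow_zero, mul_one, one_le_div (by positivity)]
      exact pow_le_pow_right₀ one_le_two (not_lt.1 h)
    linarith [indepPotential_nonneg J s hq W S]

open scoped Classical in
/-- The linear `k`-graphs with `J` edges and without independent sets of size `w`. -/
noncomputable def linearHypergraphs [Fintype V] (k J w : ℕ) : Finset (Finset (Finset V)) :=
  univ.filter fun S => IsLinearHypergraph k S ∧ #S = J ∧ ∀ W : Finset V, #W = w → ¬ IsIndep S W

lemma pow_div_two_le_factorial_mul_card [Fintype V] {k : ℕ} (hk : 2 ≤ k) (w s J : ℕ)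
    {a r q : ℝ} (ha0 : 0 ≤ a) (hr0 : 0 ≤ r) (hq0 : 0 ≤ q) (hq1 : q ≤ 1)
    (ha : a + J * (k.choose 2 * (Fintype.card V - 2).choose (k - 2)) ≤
      (Fintype.card V).choose k)
    (hr : (w.choose 2 * (Fintype.card V - 2).choose (k - 2) : ℝ) ≤ r * a)
    (hq : q * (Fintype.card V).choose k + s * (k.choose 2 * (w - 2).choose (k - 2)) ≤ w.choose k)
    (hΦ : ((Fintype.card V).choose w : ℝ) * ((1 + r) ^ J / 2 ^ s + (1 - q) ^ J) ≤ 1 / 2) :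
    a ^ J * (1 / 2) ≤ J.factorial * #(linearHypergraphs (V := V) k J w) := by
  classical
  set g : Finset (Finset V) → ℝ := fun S => 1 - ∑ W ∈ (univ : Finset V).powersetCard w,
    (touchPotential J s r W S + indepPotential J s q W S) with hg
  have hcard : ∀ S : Finset (Finset V), IsLinearHypergraph k S → #S < J →
      a ≤ #(extensions (IsLinearHypergraph k) S) := by
    intro S hS hSJ
    have h1 : ((Fintype.card V).choose k : ℝ) ≤ #(extensions (IsLinearHypergraph k) S) +
      #S * (k.choose 2 * (Fintype.card V - 2).choose (k - 2)) := by
      exact_mod_cast choose_le_card_extensions_univ_add hk hS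
    have h2 : (#S : ℝ) * (k.choose 2 * (Fintype.card V - 2).choose (k - 2)) ≤
        J * (k.choose 2 * (Fintype.card V - 2).choose (k - 2)) := by
      have : (#S : ℝ) ≤ J := by exact_mod_cast hSJ.le
      gcongr
    linarith
  have key := pow_mul_le_factorial_mul_sum (IsLinearHypergraph (V := V) k)
    (fun S T h hT => hT.mono h) ⟨by simp, by simp⟩ g a ha0 J hcard ?_ J le_rfl
  · have h0 : 1 / 2 ≤ g ∅ := by
      have h1 : ∀ W ∈ (univ : Finset V).powersetCard w,
          touchPotential J s r W ∅ + indepPotential J s q W ∅ ≤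
            (1 + r) ^ J / 2 ^ s + (1 - q) ^ J := by
        intro W _
        have : indepPotential J s q W ∅ ≤ (1 - q) ^ J := by
          unfold indepPotential
          split_ifs
          · simp
          · exact pow_nonneg (by linarith) _
        have h' : touchPotential J s r W ∅ = (1 + r) ^ J / 2 ^ s := by
          simp [touchPotential, touching]
        linarith
      have h2 := sum_le_card_nsmul _ _ _ h1
      rw [card_powersetCard, card_univ, nsmul_eq_mul] at h2
      simp only [hg]
      linarith
    refine (mul_le_mul_of_nonneg_left h0 (pow_nonneg ha0 J)).trans (key.trans ?_)
    refine mul_le_mul_of_nonneg_left ?_ (by positivity)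
    have h3 : ∀ S ∈ univ.filter (fun S : Finset (Finset V) => IsLinearHypergraph k S ∧ #S = J),
        max (g S) 0 ≤ if ∀ W : Finset V, #W = w → ¬ IsIndep S W then 1 else 0 := by
      intro S hS
      simp only [mem_filter, mem_univ, true_and] at hS
      have hnn : ∀ W ∈ (univ : Finset V).powersetCard w,
          0 ≤ touchPotential J s r W S + indepPotential J s q W S := fun W _ =>
        add_nonneg (touchPotential_nonneg J s hr0 W S) (indepPotential_nonneg J s hq1 W S)
      split_ifs with h
      · have := sum_nonneg hnn
        exact max_le (by simp only [hg]; linarith) zero_le_one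
      · push Not at h
        obtain ⟨W, hW, hWi⟩ := h
        have h4 := single_le_sum hnn (mem_powersetCard.2 ⟨subset_univ W, hW⟩)
        have h5 := one_le_potential_of_isIndep (s := s) hr0 hq1 hS.2 hWi
        exact max_le (by simp only [hg]; linarith) le_rfl
    refine (sum_le_sum h3).trans ?_
    rw [sum_boole, filter_filter]
    unfold linearHypergraphs
    simp only [and_assoc]
    exact le_rfl
  · intro S hS hSJ
    have hX : ∀ e ∈ extensions (IsLinearHypergraph (V := V) k) S, e ∉ S := fun e he =>
      (mem_filter.1 he).2.1
    simp only [hg]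
    rw [sum_sub_distrib, sum_const, nsmul_eq_mul, mul_one, mul_sub, mul_one, sum_comm, mul_sum]
    refine sub_le_sub_left (sum_le_sum fun W hW => ?_) _
    have hWc := (mem_powersetCard.1 hW).2
    rw [sum_add_distrib, mul_add]
    refine add_le_add (sum_touchPotential_insert_le J s hr0 W hSJ _ hX ?_)
      (sum_indepPotential_insert_le J s hq1 W hSJ _ hX ?_)
    · have h1 := card_extensions_touching_le hk hS W
      rw [hWc] at h1
      have h2 : (#((extensions (IsLinearHypergraph k) S).filter fun e => 2 ≤ #(e ∩ W)) : ℝ) ≤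
        w.choose 2 * (Fintype.card V - 2).choose (k - 2) := by exact_mod_cast h1
      exact h2.trans (hr.trans (mul_le_mul_of_nonneg_left (hcard S hS hSJ) hr0))
    · intro ht
      have h1 := choose_le_card_extensions_add hk hS W
      rw [hWc] at h1
      have h2 : (w.choose k : ℝ) ≤ #((extensions (IsLinearHypergraph k) S).filter (· ⊆ W)) +
        touching W S * (k.choose 2 * (w - 2).choose (k - 2)) := by exact_mod_cast h1
      have h3 : (touching W S : ℝ) * (k.choose 2 * (w - 2).choose (k - 2)) ≤
          s * (k.choose 2 * (w - 2).choose (k - 2)) := by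
        have : (touching W S : ℝ) ≤ s := by exact_mod_cast ht.le
        gcongr
      have h4 : (#(extensions (IsLinearHypergraph k) S) : ℝ) ≤ (Fintype.card V).choose k := by
        exact_mod_cast card_extensions_le hk hS
      have h5 := mul_le_mul_of_nonneg_left h4 hq0
      linarith

lemma exists_cover_vartheta [Fintype V] (k : ℕ) {S : Finset (Finset V)} (hS : ∀ e ∈ S, #e = k) :
    ∃ I : Fin (vartheta k S) → Finset V, (∀ j, IsIndep S (I j)) ∧
      ∀ e : Finset V, #e = k → e ∉ S → ∃ j, e ⊆ I j := by
  refine Nat.sInf_mem (s := {t | ∃ I : Fin t → Finset V, (∀ j, IsIndep S (I j)) ∧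
    ∀ e : Finset V, #e = k → e ∉ S → ∃ j, e ⊆ I j}) ?_
  set X : Finset (Finset V) := univ.filter fun e => #e = k ∧ e ∉ S with hX
  refine ⟨#X, fun j => (X.equivFin.symm j : Finset V), fun j e he hej => ?_, fun e he heS => ?_⟩
  · have h1 := (mem_filter.1 (X.equivFin.symm j).2).2
    have h2 := eq_of_subset_of_card_le hej (by rw [h1.1, hS e he])
    exact h1.2 (by rwa [← show e = (X.equivFin.symm j : Finset V) from h2])
  · exact ⟨X.equivFin ⟨e, by simp [hX, he, heS]⟩, by simp⟩

/-- Every set with fewer than `w` elements is the set of values of a partial function on `Fin w`. -/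
lemma exists_eraseNone_image_eq {w : ℕ} {A : Finset V} (hA : #A < w) :
    ∃ f : Fin w → Option V, eraseNone (univ.image f) = A := by
  have hcard : Fintype.card (Option A) ≤ Fintype.card (Fin w) := by
    rw [Fintype.card_option, Fintype.card_coe, Fintype.card_fin]
    exact hA
  obtain ⟨φ⟩ := Function.Embedding.nonempty_of_card_le hcard
  obtain ⟨g, hg⟩ := φ.injective.hasLeftInverse
  refine ⟨fun i => (g i).map Subtype.val, ?_⟩
  ext x
  simp only [mem_eraseNone, mem_image, mem_univ, true_and, Option.map_eq_some_iff]
  constructor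
  · rintro ⟨i, a, -, rfl⟩
    exact a.2
  · intro hx
    exact ⟨φ (some ⟨x, hx⟩), ⟨x, hx⟩, hg _, rfl⟩

/-- A `k`-graph is determined by an optimal cover of its complement, so there are few `k`-graphs
with small independence number and small `ϑ`. -/
lemma card_le_pow_of_vartheta_le [Fintype V] {k w t : ℕ} (hk : 0 < k)
    (𝒢 : Finset (Finset (Finset V))) (hG : ∀ S ∈ 𝒢, ∀ e ∈ S, #e = k)
    (hw : ∀ S ∈ 𝒢, ∀ W : Finset V, #W = w → ¬ IsIndep S W)
    (ht : ∀ S ∈ 𝒢, vartheta k S ≤ t) :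
    #𝒢 ≤ (Fintype.card V + 1) ^ (w * t) := by
  let Ψ : (Fin t → Fin w → Option V) → Finset (Finset V) := fun F =>
    univ.filter fun e => #e = k ∧ ∀ j, ¬ e ⊆ eraseNone (univ.image (F j))
  have hsub : 𝒢 ⊆ univ.image Ψ := by
    intro S hS
    obtain ⟨I, hI, hcov⟩ := exists_cover_vartheta k (hG S hS)
    have hsmall : ∀ j, #(I j) < w := by
      intro j
      by_contra h
      obtain ⟨W, hW, hWc⟩ := exists_subset_card_eq (not_lt.1 h)
      exact hw S hS W hWc fun e he heW => hI j e he (heW.trans hW)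
    have hrep : ∀ i : Fin t, ∃ f : Fin w → Option V, eraseNone (univ.image f) =
        if h : (i : ℕ) < vartheta k S then I ⟨i, h⟩ else ∅ := by
      intro i
      split_ifs with h
      · exact exists_eraseNone_image_eq (hsmall _)
      · refine exists_eraseNone_image_eq (Nat.pos_of_ne_zero fun h0 => ?_)
        refine hw S hS ∅ (by simp [h0]) fun e he hee => ?_
        have := hG S hS e he
        rw [subset_empty.1 hee, card_empty] at this
        omega
    choose F hF using hrep
    refine mem_image.2 ⟨F, mem_univ _, ?_⟩
    ext e
    simp only [Ψ, mem_filter, mem_univ, true_and, hF]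
    constructor
    · rintro ⟨hek, hej⟩
      by_contra heS
      obtain ⟨j, hj⟩ := hcov e hek heS
      have := hej ⟨j, j.2.trans_le (ht S hS)⟩
      rw [dif_pos j.2] at this
      exact this hj
    · intro heS
      refine ⟨hG S hS e heS, fun i hei => ?_⟩
      split_ifs at hei with h
      · exact hI _ e heS hei
      · have := hG S hS e heS
        rw [subset_empty.1 hei, card_empty] at this
        omega
  refine (card_le_card hsub).trans (card_image_le.trans ?_)
  rw [card_univ, Fintype.card_fun, Fintype.card_fun, Fintype.card_option, Fintype.card_fin,
    Fintype.card_fin, pow_mul]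

/-- If there are many linear hypergraphs without independent `w`-sets, one of them has large
`ϑ`. -/
lemma exists_isPartialSteiner_le_mul_vartheta [Fintype V] {k w J : ℕ} (hk : 0 < k) (hw : 0 < w)
    (hV : 0 < Fintype.card V) {a : ℝ} (ha : (J * (Fintype.card V + 1) : ℝ) ≤ a)
    (hcount : a ^ J * (1 / 2) ≤ J.factorial * #(linearHypergraphs (V := V) k J w)) :
    ∃ S : Finset (Finset V), IsPartialSteiner k S ∧ J ≤ w * vartheta k S + 1 := by
  classical
  have hmem : ∀ S ∈ linearHypergraphs (V := V) k J w,
      IsLinearHypergraph k S ∧ #S = J ∧ ∀ W : Finset V, #W = w → ¬ IsIndep S W :=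
    fun S hS => (mem_filter.1 hS).2
  by_contra! hcon
  have hsmall : ∀ S ∈ linearHypergraphs (V := V) k J w, vartheta k S ≤ (J - 2) / w := by
    intro S hS
    have := hcon S (hmem S hS).1.isPartialSteiner
    rw [Nat.le_div_iff_mul_le hw, mul_comm]
    omega
  have hJ : 2 ≤ J := by
    have := hcon ∅ ⟨by simp, by simp [degS]⟩
    omega
  have hle := card_le_pow_of_vartheta_le hk (linearHypergraphs (V := V) k J w)
    (fun S hS => (hmem S hS).1.1) (fun S hS => (hmem S hS).2.2) hsmall
  have hle2 : #(linearHypergraphs (V := V) k J w) ≤ (Fintype.card V + 1) ^ (J - 2) :=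
    hle.trans (Nat.pow_le_pow_right (by omega) (Nat.mul_div_le _ _))
  have hle3 : (#(linearHypergraphs (V := V) k J w) : ℝ) ≤ (Fintype.card V + 1 : ℝ) ^ (J - 2) := by
    exact_mod_cast hle2
  have hJpos : (0 : ℝ) < J := by exact_mod_cast (by omega : 0 < J)
  have hfac : (J.factorial : ℝ) ≤ (J : ℝ) ^ J := by exact_mod_cast Nat.factorial_le_pow J
  set N : ℝ := (Fintype.card V + 1 : ℝ) with hN
  have hN2 : 2 ≤ N := by
    have : (1 : ℝ) ≤ Fintype.card V := by exact_mod_cast hV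
    linarith
  have h1 : (J : ℝ) ^ J * N ^ J * (1 / 2) ≤ J ^ J * N ^ (J - 2) := by
    rw [← mul_pow]
    refine le_trans ?_ (hcount.trans ?_)
    · gcongr
    · gcongr
  have h2 : N ^ J = N ^ (J - 2) * N ^ 2 := by rw [← pow_add, Nat.sub_add_cancel hJ]
  have h3 : 0 < (J : ℝ) ^ J * N ^ (J - 2) := by positivity
  have h4 : (J : ℝ) ^ J * N ^ J * (1 / 2) = (J ^ J * N ^ (J - 2)) * (N ^ 2 / 2) := by
    rw [h2]; ring
  rw [h4, mul_le_iff_le_one_right h3] at h1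
  nlinarith

lemma le_choose_of_pos_of_lt {m j : ℕ} (hj : 0 < j) (hjm : j < m) : m ≤ m.choose j := by
  induction m generalizing j with
  | zero => omega
  | succ m ih =>
    obtain ⟨i, rfl⟩ := Nat.exists_eq_succ_of_ne_zero hj.ne'
    rcases Nat.eq_zero_or_pos i with rfl | hi
    · simp
    · have h1 := ih hi (by omega)
      have h2 : 0 < m.choose (i + 1) := Nat.choose_pos (by omega)
      rw [Nat.succ_eq_add_one, Nat.choose_succ_succ, Nat.succ_eq_add_one]
      omega

lemma half_pow_le_factorial_mul_choose {w k : ℕ} (h : 2 * k ≤ w) :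
    ((w : ℝ) / 2) ^ k ≤ k.factorial * w.choose k := by
  have h1 : (w + 1 - k) ^ k ≤ w.descFactorial k := Nat.pow_sub_le_descFactorial w k
  rw [Nat.descFactorial_eq_factorial_mul_choose] at h1
  have h2 : ((w + 1 - k : ℕ) : ℝ) ^ k ≤ k.factorial * w.choose k := by exact_mod_cast h1
  refine le_trans (pow_le_pow_left₀ (by positivity) ?_ k) h2
  have h3 : w ≤ 2 * (w + 1 - k) := by omega
  have h4 : (w : ℝ) ≤ 2 * (w + 1 - k : ℕ) := by exact_mod_cast h3
  linarith

lemma factorial_mul_choose_le_pow (n k : ℕ) : (k.factorial * n.choose k : ℝ) ≤ (n : ℝ) ^ k := by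
  have h1 : n.descFactorial k ≤ n ^ k := Nat.descFactorial_le_pow n k
  rw [Nat.descFactorial_eq_factorial_mul_choose] at h1
  exact_mod_cast h1

lemma choose_mul_choose_two {n k : ℕ} (hk : 2 ≤ k) :
    (n.choose k * k.choose 2 : ℝ) = n.choose 2 * (n - 2).choose (k - 2) := by
  exact_mod_cast Nat.choose_mul hk

lemma sq_div_four_le_choose_two {n : ℕ} (hn : 2 ≤ n) : (n : ℝ) ^ 2 / 4 ≤ n.choose 2 := by
  rw [Nat.cast_choose_two]
  have : (2 : ℝ) ≤ n := by exact_mod_cast hn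
  nlinarith

lemma exp_neg_two_le : Real.exp (-2) ≤ 1 / 4 := by
  have h := Real.add_one_le_exp (1 : ℝ)
  have h2 : Real.exp 2 = Real.exp 1 * Real.exp 1 := by rw [← Real.exp_add]; norm_num
  rw [Real.exp_neg, inv_eq_one_div, one_div_le_one_div (Real.exp_pos _) (by norm_num)]
  nlinarith

lemma exp_half_le_two : Real.exp (1 / 2) ≤ 2 := by
  have h : (1 / 2 : ℝ) ≤ Real.log 2 := by linarith [Real.log_two_gt_d9]
  calc Real.exp (1 / 2) ≤ Real.exp (Real.log 2) := Real.exp_le_exp.2 h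
    _ = 2 := Real.exp_log (by norm_num)

/-- The quantity controlling the expected number of edges touching a fixed `w`-set too often. -/
lemma exp_mul_pow_div_two_pow_le {w s J : ℕ} {L K r T : ℝ} (hr : 0 ≤ r)
    (hrJ : r * J ≤ T / (8 * K ^ 2)) (hs : T / (2 * K ^ 2) < s + 1)
    (hT : w * L + 3 ≤ T / (8 * K ^ 2)) :
    Real.exp (w * L) * ((1 + r) ^ J / 2 ^ s) ≤ 1 / 4 := by
  have h1 : (1 + r) ^ J ≤ Real.exp (r * J) := by
    rw [mul_comm, Real.exp_nat_mul]
    gcongr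
    linarith [Real.add_one_le_exp r]
  have h2 : Real.exp (s * (1 / 2)) ≤ 2 ^ s := by
    rw [Real.exp_nat_mul]
    exact pow_le_pow_left₀ (Real.exp_pos _).le exp_half_le_two s
  have h3 : T / (2 * K ^ 2) = 4 * (T / (8 * K ^ 2)) := by
    rw [show (8 * K ^ 2) = 4 * (2 * K ^ 2) by ring, ← div_div, div_right_comm]
    ring
  calc Real.exp (w * L) * ((1 + r) ^ J / 2 ^ s)
      ≤ Real.exp (w * L) * (Real.exp (r * J) / Real.exp (s * (1 / 2))) := by gcongr
    _ = Real.exp (w * L + r * J - s * (1 / 2)) := by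
        rw [← Real.exp_sub, ← Real.exp_add]; ring_nf
    _ ≤ Real.exp (-2) := Real.exp_le_exp.2 (by linarith)
    _ ≤ 1 / 4 := exp_neg_two_le

lemma exp_mul_one_sub_pow_le {w J : ℕ} {L q : ℝ} (hq : q ≤ 1) (hqJ : w * L + 2 ≤ q * J) :
    Real.exp (w * L) * (1 - q) ^ J ≤ 1 / 4 := by
  have h1 : (1 - q) ^ J ≤ Real.exp (-(q * J)) := by
    rw [show -(q * J) = J * (-q) by ring, Real.exp_nat_mul]
    exact pow_le_pow_left₀ (by linarith) (by linarith [Real.add_one_le_exp (-q)]) J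
  calc Real.exp (w * L) * (1 - q) ^ J ≤ Real.exp (w * L) * Real.exp (-(q * J)) := by gcongr
    _ = Real.exp (w * L - q * J) := by rw [← Real.exp_add]; ring_nf
    _ ≤ Real.exp (-2) := Real.exp_le_exp.2 (by linarith)
    _ ≤ 1 / 4 := exp_neg_two_le

lemma mul_add_three_le_div {w L K T : ℝ} (hK : 0 < K) (hw : 1 ≤ w) (hL : 3 ≤ L)
    (hA : 64 * K ^ 2 * L ≤ w) (hT : w ^ 2 / 4 ≤ T) : w * L + 3 ≤ T / (8 * K ^ 2) := by
  rw [le_div_iff₀ (by positivity)]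
  have h1 : 64 * K ^ 2 * L * w ≤ w * w := mul_le_mul_of_nonneg_right hA (by linarith)
  have h2 : 3 ≤ w * L := by nlinarith
  have h3 : 8 * K ^ 2 * 3 ≤ 8 * K ^ 2 * (w * L) := mul_le_mul_of_nonneg_left h2 (by positivity)
  linarith

/-- Lower bound for the expected number of edges inside a fixed `w`-set. -/
lemma two_mul_le_choose_div_mul {k n w : ℕ} (hk : 3 ≤ k) (hn : 2 ≤ n) (hkn : k ≤ n)
    (hw : 2 * k ≤ w) {L D J : ℝ} (hD : 0 < D) (hJ : n.choose 2 / (32 * D) ≤ J)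
    (hB : 2 ^ (k + 9) * D * ((n : ℝ) ^ (k - 2) * L) ≤ (w : ℝ) ^ (k - 1)) :
    2 * (w * L) ≤ w.choose k / (2 * n.choose k) * J := by
  have hn0 : (0 : ℝ) < n := by exact_mod_cast (by omega : 0 < n)
  have hnk : (0 : ℝ) < n.choose k := by exact_mod_cast Nat.choose_pos hkn
  have hf : (0 : ℝ) < k.factorial := by exact_mod_cast k.factorial_pos
  have h1 : ((w : ℝ) / 2) ^ k / (2 * n ^ k) ≤ w.choose k / (2 * n.choose k) := by
    rw [div_le_div_iff₀ (by positivity) (by positivity)]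
    have e1 := half_pow_le_factorial_mul_choose hw
    have e2 := factorial_mul_choose_le_pow n k
    have e3 : (0 : ℝ) ≤ w.choose k := by positivity
    calc ((w : ℝ) / 2) ^ k * (2 * n.choose k)
        ≤ (k.factorial * w.choose k) * (2 * n.choose k) := by gcongr
      _ = w.choose k * (2 * (k.factorial * n.choose k)) := by ring
      _ ≤ w.choose k * (2 * n ^ k) := by gcongr
  have h2 : (n : ℝ) ^ 2 / (128 * D) ≤ J := by
    refine le_trans ?_ hJ
    rw [div_le_div_iff₀ (by positivity) (by positivity)]
    nlinarith [mul_le_mul_of_nonneg_right (sq_div_four_le_choose_two hn) hD.le]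
  refine le_trans ?_ (mul_le_mul h1 h2 (by positivity) (by positivity))
  rw [div_pow, div_div, div_mul_div_comm, le_div_iff₀ (by positivity)]
  obtain ⟨m, rfl⟩ : ∃ m, k = m + 2 := ⟨k - 2, by omega⟩
  have h3 : (m + 2 - 1 : ℕ) = m + 1 := rfl
  have h4 : (m + 2 - 2 : ℕ) = m := rfl
  rw [h3, h4] at hB
  have h5 := mul_le_mul_of_nonneg_left hB (by positivity : (0 : ℝ) ≤ w * n ^ 2)
  calc 2 * (w * L) * (2 ^ (m + 2) * (2 * (n : ℝ) ^ (m + 2)) * (128 * D))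
      = w * n ^ 2 * (2 ^ (m + 2 + 9) * D * (n ^ m * L)) := by ring
    _ ≤ w * n ^ 2 * w ^ (m + 1) := h5
    _ = w ^ (m + 2) * n ^ 2 := by ring

lemma exists_isPartialSteiner_choose_two_le {k n w : ℕ} (hk : 3 ≤ k) (hkn : 2 * k ≤ n)
    (hkw : 2 * k ≤ w) (hwn : w ≤ n) (hL : 3 ≤ Real.log n)
    (hN : 64 * (k.choose 2 : ℝ) ^ 3 ≤ n.choose 2)
    (hA : 64 * (k.choose 2 : ℝ) ^ 2 * Real.log n ≤ w)
    (hB : 2 ^ (k + 9) * (k.choose 2 : ℝ) ^ 3 * ((n : ℝ) ^ (k - 2) * Real.log n) ≤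
      (w : ℝ) ^ (k - 1)) :
    ∃ S : Finset (Finset (Fin n)), IsPartialSteiner k S ∧
      (n.choose 2 : ℝ) / (32 * (k.choose 2 : ℝ) ^ 3) ≤ w * vartheta k S := by
  have hK : (3 : ℝ) ≤ k.choose 2 := by
    exact_mod_cast (Nat.choose_le_choose 2 hk : Nat.choose 3 2 ≤ k.choose 2)
  set K := (k.choose 2 : ℝ) with hKdef
  set L := Real.log n with hLdef
  have hK0 : 0 < K := by linarith
  have hnk : (0 : ℝ) < n.choose k := by exact_mod_cast Nat.choose_pos (by omega)
  have hn2 : (0 : ℝ) < n.choose 2 := by exact_mod_cast Nat.choose_pos (by omega)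
  have hw6 : (6 : ℝ) ≤ w := by exact_mod_cast (by omega : 6 ≤ w)
  have hn6 : (6 : ℝ) ≤ n := by exact_mod_cast (by omega : 6 ≤ n)
  have idn : n.choose k * K = n.choose 2 * (n - 2).choose (k - 2) :=
    choose_mul_choose_two (by omega)
  have idw : w.choose k * K = w.choose 2 * (w - 2).choose (k - 2) :=
    choose_mul_choose_two (by omega)
  set J := ⌊(n.choose 2 : ℝ) / (16 * K ^ 3)⌋₊ with hJ
  set s := ⌊(w.choose 2 : ℝ) / (2 * K ^ 2)⌋₊ with hs
  set r : ℝ := 2 * K * w.choose 2 / n.choose 2 with hr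
  set q : ℝ := w.choose k / (2 * n.choose k) with hq
  have hJle : (J : ℝ) ≤ n.choose 2 / (16 * K ^ 3) := Nat.floor_le (by positivity)
  have hJlt : (n.choose 2 : ℝ) / (16 * K ^ 3) < J + 1 := Nat.lt_floor_add_one _
  have hsle : (s : ℝ) ≤ w.choose 2 / (2 * K ^ 2) := Nat.floor_le (by positivity)
  have hslt : (w.choose 2 : ℝ) / (2 * K ^ 2) < s + 1 := Nat.lt_floor_add_one _
  have hN32 : 2 ≤ (n.choose 2 : ℝ) / (32 * K ^ 3) := by
    rw [le_div_iff₀ (by positivity)]; linarith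
  have hN16 : (n.choose 2 : ℝ) / (16 * K ^ 3) = 2 * (n.choose 2 / (32 * K ^ 3)) := by
    field_simp; norm_num
  have hJK : (J : ℝ) * (16 * K ^ 3) ≤ n.choose 2 := (le_div_iff₀ (by positivity)).1 hJle
  have hsK : (s : ℝ) * (2 * K ^ 2) ≤ w.choose 2 := (le_div_iff₀ (by positivity)).1 hsle
  set c := ((n - 2).choose (k - 2) : ℝ) with hc
  set d := ((w - 2).choose (k - 2) : ℝ) with hd
  have hcn : (n : ℝ) - 2 ≤ c := by
    have h1 : n - 2 ≤ (n - 2).choose (k - 2) := le_choose_of_pos_of_lt (by omega) (by omega)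
    have h2 : ((n - 2 : ℕ) : ℝ) ≤ c := Nat.cast_le.2 h1
    rwa [Nat.cast_sub (by omega)] at h2
  have hc0 : 0 < c := by linarith
  have hd0 : 0 ≤ d := Nat.cast_nonneg _
  have hr0 : 0 ≤ r := by positivity
  have hq0 : 0 ≤ q := by positivity
  have hw2 : (w : ℝ) ^ 2 / 4 ≤ w.choose 2 := sq_div_four_le_choose_two (by omega)
  have hqJ : w * L + 2 ≤ q * J := by
    have h1 := two_mul_le_choose_div_mul hk (by omega) (by omega) hkw (D := K ^ 3)
      (by positivity) (J := J) (by linarith) hB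
    have h2 : (6 : ℝ) * 3 ≤ w * L := mul_le_mul hw6 hL (by norm_num) (by linarith)
    linarith
  have hJK' : (J : ℝ) * (K * c) ≤ n.choose k / 16 := by
    have h1 : (J : ℝ) * (16 * K ^ 3) * c ≤ n.choose k * K := by
      rw [idn]; exact mul_le_mul_of_nonneg_right hJK hc0.le
    have h2 : (J : ℝ) * 16 * (K ^ 2 * c) ≤ n.choose k := by
      refine le_of_mul_le_mul_right ?_ hK0
      calc _ = (J : ℝ) * (16 * K ^ 3) * c := by ring
        _ ≤ _ := h1
    have h3 : (J : ℝ) * 16 * (K * c) ≤ J * 16 * (K ^ 2 * c) := by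
      gcongr
      exact le_self_pow₀ (by linarith) two_ne_zero
    linarith
  have hq1 : q ≤ 1 := by
    have : (w.choose k : ℝ) ≤ n.choose k := by exact_mod_cast Nat.choose_le_choose k hwn
    rw [hq, div_le_one (by positivity)]
    linarith
  have hrJ : r * J ≤ w.choose 2 / (8 * K ^ 2) := by
    calc r * J ≤ r * (n.choose 2 / (16 * K ^ 3)) := by gcongr
      _ = w.choose 2 / (8 * K ^ 2) := by rw [hr]; field_simp; ring
  have hT : w * L + 3 ≤ w.choose 2 / (8 * K ^ 2) :=
    mul_add_three_le_div hK0 (by linarith) hL hA hw2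
  have hnw : (n.choose w : ℝ) ≤ Real.exp (w * L) := by
    rw [Real.exp_nat_mul, Real.exp_log (by linarith)]
    exact_mod_cast Nat.choose_le_pow n w
  have hcount := pow_div_two_le_factorial_mul_card (V := Fin n) (k := k) (by omega) w s J
    (a := n.choose k / 2) (r := r) (q := q) (by positivity) hr0 hq0 hq1
    (by rw [Fintype.card_fin]; linarith)
    (by
      rw [Fintype.card_fin]
      have h1 : r * (n.choose k / 2) = w.choose 2 * (n.choose k * K) / n.choose 2 := by
        rw [hr]; field_simp
      rw [h1, idn, mul_div_assoc, mul_div_cancel_left₀ _ hn2.ne'])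
    (by
      rw [Fintype.card_fin]
      have h1 : q * n.choose k = w.choose k / 2 := by rw [hq]; field_simp
      have h2 : (s : ℝ) * (K * d) ≤ w.choose k / 2 := by
        have h3 : (s : ℝ) * (2 * K ^ 2) * d ≤ w.choose k * K := by
          rw [idw]; exact mul_le_mul_of_nonneg_right hsK hd0
        have h4 : (s : ℝ) * (K * d) * 2 ≤ w.choose k := by
          refine le_of_mul_le_mul_right ?_ hK0
          calc _ = (s : ℝ) * (2 * K ^ 2) * d := by ring
            _ ≤ _ := h3
        linarith
      linarith)
    (by
      rw [Fintype.card_fin]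
      have hpos : (0 : ℝ) ≤ (1 + r) ^ J / 2 ^ s + (1 - q) ^ J :=
        add_nonneg (by positivity) (pow_nonneg (by linarith) _)
      refine (mul_le_mul_of_nonneg_right hnw hpos).trans ?_
      rw [mul_add]
      have h1 := exp_mul_pow_div_two_pow_le hr0 hrJ hslt hT
      have h2 := exp_mul_one_sub_pow_le hq1 hqJ
      linarith)
  obtain ⟨S, hS, hle⟩ := exists_isPartialSteiner_le_mul_vartheta (V := Fin n) (k := k) (w := w)
    (J := J) (by omega) (by omega) (by rw [Fintype.card_fin]; omega) (a := n.choose k / 2)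
    (by
      rw [Fintype.card_fin]
      have h0 : 3 * ((n : ℝ) - 2) ≤ K * c := mul_le_mul hK hcn (by linarith) hK0.le
      have h1 : (n : ℝ) + 1 ≤ 8 * (K * c) := by linarith
      have h2 : (J : ℝ) * (n + 1) ≤ J * (8 * (K * c)) := by gcongr
      linarith) hcount
  refine ⟨S, hS, ?_⟩
  have h1 : (J : ℝ) ≤ w * vartheta k S + 1 := by exact_mod_cast hle
  linarith

lemma exists_threshold (A B : ℝ) : ∃ n₀ : ℕ, ∀ n : ℕ, n₀ ≤ n →
    A ≤ Real.log n ∧ A ≤ n ∧ B * Real.log n ≤ n ∧ A ≤ n.choose 2 := by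
  have h1 : ∀ᶠ n : ℕ in Filter.atTop, A ≤ Real.log n :=
    (Real.tendsto_log_atTop.comp tendsto_natCast_atTop_atTop).eventually_ge_atTop A
  have h2 : ∀ᶠ n : ℕ in Filter.atTop, A ≤ (n : ℝ) :=
    tendsto_natCast_atTop_atTop.eventually_ge_atTop A
  have h3 : ∀ᶠ n : ℕ in Filter.atTop, B * Real.log n ≤ n := by
    have h := tendsto_natCast_atTop_atTop.eventually
      ((Real.isLittleO_log_id_atTop).bound (c := 1 / (|B| + 1)) (by positivity))
    filter_upwards [h, Filter.eventually_ge_atTop 1] with n hn hn1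
    have hlog : 0 ≤ Real.log n := Real.log_natCast_nonneg n
    rw [Real.norm_of_nonneg hlog, id, Real.norm_of_nonneg (Nat.cast_nonneg n), div_mul_eq_mul_div,
      one_mul, le_div_iff₀ (by positivity)] at hn
    nlinarith [le_abs_self B]
  have h4 : ∀ᶠ n : ℕ in Filter.atTop, A ≤ (n.choose 2 : ℝ) := by
    filter_upwards [h2, Filter.eventually_ge_atTop 4] with n hn hn4
    have := sq_div_four_le_choose_two (n := n) (by omega)
    have h4' : (4 : ℝ) ≤ n := by exact_mod_cast hn4
    nlinarith
  exact Filter.eventually_atTop.1 (h1.and (h2.and (h3.and h4)))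

/-- For every `k ≥ 3` there are a positive constant `c₁` depending only on `k` and an `n₀` such
that for every `n ≥ n₀` there is a partial Steiner `(n,k,2)`-system `S` with
`ϑ(S) ≥ c₁ n^{k/(k-1)} / (log n)^{1/(k-1)}`. -/
theorem partial_steiner_lower (k : ℕ) (hk : 3 ≤ k) :
    ∃ c₁ : ℝ, 0 < c₁ ∧ ∃ n₀ : ℕ, ∀ n : ℕ, n₀ ≤ n →
      ∃ S : Finset (Finset (Fin n)), IsPartialSteiner k S ∧
        c₁ * (n : ℝ) ^ ((k : ℝ) / ((k : ℝ) - 1)) / (Real.log n) ^ ((1 : ℝ) / ((k : ℝ) - 1))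
          ≤ (vartheta k S : ℝ) := by
  have hK3 : (3 : ℝ) ≤ k.choose 2 := by
    exact_mod_cast (Nat.choose_le_choose 2 hk : Nat.choose 3 2 ≤ k.choose 2)
  set K := (k.choose 2 : ℝ) with hK
  set C : ℝ := 2 ^ (k + 9) * K ^ 3 with hC
  have hC64 : 64 * K ^ 2 ≤ C := by
    have h1 : (2 : ℝ) ^ 6 ≤ 2 ^ (k + 9) := pow_le_pow_right₀ one_le_two (by omega)
    have h2 : K ^ 2 ≤ K ^ 3 := pow_le_pow_right₀ (by linarith) (by norm_num)
    calc 64 * K ^ 2 = 2 ^ 6 * K ^ 2 := by norm_num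
      _ ≤ C := by rw [hC]; gcongr
  have hC1 : 1 ≤ C := by nlinarith
  obtain ⟨n₀, hn₀⟩ := exists_threshold (64 * K ^ 3 + 2 * k) ((2 * C) ^ (k - 1))
  refine ⟨1 / (256 * K ^ 3 * C), by positivity, n₀, fun n hn => ?_⟩
  obtain ⟨hL, hnA, hLn, hn2⟩ := hn₀ n hn
  set L := Real.log n with hLdef
  have hk0 : (0 : ℝ) ≤ k := Nat.cast_nonneg k
  have hK3' : 27 ≤ K ^ 3 := by
    calc (27 : ℝ) = 3 ^ 3 := by norm_num
      _ ≤ K ^ 3 := by gcongr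
  have hL3 : 3 ≤ L := by linarith
  have hn0 : (0 : ℝ) < n := by linarith
  have hLn' : L ≤ n := Real.log_le_self hn0.le
  obtain ⟨m, rfl⟩ : ∃ m, k = m + 2 := ⟨k - 2, by omega⟩
  have hm1 : (m + 2 - 1 : ℕ) = m + 1 := rfl
  have hm2 : (m + 2 - 2 : ℕ) = m := rfl
  set x : ℝ := ((n : ℝ) ^ m * L) ^ (1 / ((m : ℝ) + 1)) with hx
  have hx0 : 0 ≤ x := by positivity
  have hxpow : x ^ (m + 1) = (n : ℝ) ^ m * L := by
    rw [hx, ← Real.rpow_natCast, ← Real.rpow_mul (by positivity)]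
    push_cast
    rw [one_div, inv_mul_cancel₀ (by positivity), Real.rpow_one]
  have hxL : L ≤ x := by
    refine le_of_pow_le_pow_left₀ (n := m + 1) (by omega) hx0 ?_
    rw [hxpow, pow_succ]
    gcongr
  set w := ⌈C * x⌉₊ with hw
  have hwge : C * x ≤ w := Nat.le_ceil _
  have hCx : 1 ≤ C * x := by nlinarith
  have hwle : (w : ℝ) ≤ 2 * C * x := by
    have := Nat.ceil_lt_add_one (show 0 ≤ C * x by positivity)
    linarith
  have hkw : 2 * (m + 2) ≤ w := by
    have : (2 * (m + 2 : ℕ) : ℝ) ≤ w := by nlinarith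
    exact_mod_cast this
  have hkn : 2 * (m + 2) ≤ n := by
    have : (2 * (m + 2 : ℕ) : ℝ) ≤ n := by linarith
    exact_mod_cast this
  have hwn : w ≤ n := by
    have : (w : ℝ) ≤ n := by
      refine hwle.trans (le_of_pow_le_pow_left₀ (n := m + 1) (by omega) hn0.le ?_)
      rw [hm1] at hLn
      rw [mul_pow, hxpow, pow_succ (n : ℝ)]
      calc (2 * C) ^ (m + 1) * ((n : ℝ) ^ m * L) = n ^ m * ((2 * C) ^ (m + 1) * L) := by ring
        _ ≤ n ^ m * n := by gcongr
    exact_mod_cast this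
  obtain ⟨S, hS, hle⟩ := exists_isPartialSteiner_choose_two_le hk hkn hkw hwn hL3
    (by linarith) ((mul_le_mul hC64 hxL (by linarith) (by linarith)).trans hwge)
    (by
      rw [hm1, hm2, ← hxpow]
      calc C * x ^ (m + 1) ≤ C ^ (m + 1) * x ^ (m + 1) := by
            gcongr
            exact le_self_pow₀ hC1 (by omega)
        _ = (C * x) ^ (m + 1) := (mul_pow _ _ _).symm
        _ ≤ _ := by gcongr)
  refine ⟨S, hS, ?_⟩
  have hxpos : 0 < x := by linarith
  have hmain : (n : ℝ) ^ (((m + 2 : ℕ) : ℝ) / (((m + 2 : ℕ) : ℝ) - 1)) /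
      L ^ ((1 : ℝ) / (((m + 2 : ℕ) : ℝ) - 1)) = n ^ 2 / x := by
    have hLpos : 0 < L := by linarith
    have e1 : (((m + 2 : ℕ) : ℝ) - 1) = m + 1 := by push_cast; ring
    have e2 : ((m + 2 : ℕ) : ℝ) / ((m : ℝ) + 1) = 2 - m * (1 / ((m : ℝ) + 1)) := by
      push_cast; field_simp; ring
    have e3 : (n : ℝ) ^ (2 : ℝ) = n ^ 2 := by exact_mod_cast Real.rpow_natCast (n : ℝ) 2
    rw [e1, e2, Real.rpow_sub hn0, Real.rpow_mul hn0.le, Real.rpow_natCast, hx,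
      Real.mul_rpow (by positivity) hLpos.le, div_div, e3]
  rw [mul_div_assoc, hmain]
  have hn4 : (n : ℝ) ^ 2 / 4 ≤ n.choose 2 := sq_div_four_le_choose_two (by omega)
  rw [div_le_iff₀ (by positivity)] at hle
  rw [div_mul_div_comm, one_mul, div_le_iff₀ (by positivity)]
  have hθ : (w : ℝ) * vartheta (m + 2) S * (32 * K ^ 3) ≤
      2 * C * x * vartheta (m + 2) S * (32 * K ^ 3) := by gcongr
  nlinarith
end

section
/- For every k ≥ 3 there exist positive constants c_1, c_2 depending only on k such that for infinitely many n: (i) there exists a full Steiner (n,k,2)-system S with ϑ(S) ≥ c_1 · n^{k/(k-1)} / (log n)^{1/(k-1)}, and (ii) every full Steiner (n,k,2)-system S satisfies ϑ(S) ≤ c_2 · n^{k/(k-1)} · log n. -/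
open Finset

variable {V : Type*} [DecidableEq V]

/-- `S` is a full Steiner `(n,k,2)`-system: a `k`-graph in which every pair of distinct
vertices lies in exactly one edge. -/
def IsFullSteiner (k : ℕ) (S : Finset (Finset V)) : Prop :=
  (∀ e ∈ S, e.card = k) ∧ ∀ x y : V, x ≠ y → degS S {x, y} = 1

theorem isFullSteiner_iff {k : ℕ} {S : Finset (Finset V)} :
    IsFullSteiner k S ↔ (∀ e ∈ S, e.card = k) ∧
      ∀ x y : V, x ≠ y → ∃! e, e ∈ S ∧ x ∈ e ∧ y ∈ e := by
  refine and_congr_right fun _ => forall_congr' fun x => forall_congr' fun y =>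
    imp_congr_right fun _ => ?_
  simp only [degS, Finset.card_eq_one, Finset.eq_singleton_iff_unique_mem, mem_filter,
    insert_subset_iff, singleton_subset_iff, ExistsUnique]

/-- A non-edge of the right size is independent, so that covers exist. -/
theorem exists_indep_cover [Fintype V] {k : ℕ} {S : Finset (Finset V)}
    (hS : ∀ e ∈ S, e.card = k) :
    ∃ t, ∃ I : Fin t → Finset V, (∀ j, IsIndep S (I j)) ∧
      ∀ e : Finset V, e.card = k → e ∉ S → ∃ j, e ⊆ I j := by
  classical
  let T : Finset (Finset V) := univ.filter fun e => e.card = k ∧ e ∉ S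
  refine ⟨T.card, fun j => (T.equivFin.symm j : Finset V), fun j e he hsub => ?_,
    fun e he heS => ⟨T.equivFin ⟨e, by simp [T, he, heS]⟩, by simp⟩⟩
  have hj := (T.equivFin.symm j).2
  simp only [T, mem_filter, mem_univ, true_and] at hj
  have h : e = (T.equivFin.symm j : Finset V) :=
    eq_of_subset_of_card_le hsub (by rw [hj.1, hS e he])
  exact hj.2 (h ▸ he)

theorem vartheta_spec [Fintype V] {k : ℕ} {S : Finset (Finset V)} (hS : ∀ e ∈ S, e.card = k) :
    ∃ I : Fin (vartheta k S) → Finset V, (∀ j, IsIndep S (I j)) ∧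
      ∀ e : Finset V, e.card = k → e ∉ S → ∃ j, e ⊆ I j :=
  Nat.sInf_mem (s := {t | ∃ I : Fin t → Finset V, (∀ j, IsIndep S (I j)) ∧
    ∀ e : Finset V, e.card = k → e ∉ S → ∃ j, e ⊆ I j}) (exists_indep_cover hS)

/-- Greedy covering: if every element is covered by a proportion `q` of the sample points, then
`t` suitable sample points leave at most a proportion `(1 - q) ^ t` uncovered. -/
theorem exists_greedy_cover {Ω E : Type*} [Fintype Ω] [Nonempty Ω] (X : Finset E)
    (cov : Ω → E → Prop) {q : ℝ} (hq : q ≤ 1)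
    (h : ∀ e ∈ X, q * Fintype.card Ω ≤ (Nat.card {ω // cov ω e} : ℝ)) (t : ℕ) :
    ∃ w : Fin t → Ω, ∃ U ⊆ X, (∀ e ∈ X, e ∉ U → ∃ j, cov (w j) e) ∧
      (U.card : ℝ) ≤ (1 - q) ^ t * X.card := by
  classical
  induction t with
  | zero => exact ⟨Fin.elim0, X, subset_rfl, fun e he h => absurd he h, by simp⟩
  | succ t ih =>
    obtain ⟨w, U, hUX, hU, hcard⟩ := ih
    have hsum : ∑ _ω : Ω, q * (U.card : ℝ) ≤ ∑ ω : Ω, ((U.filter (cov ω)).card : ℝ) := by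
      have h1 : ∑ ω : Ω, ((U.filter (cov ω)).card : ℝ)
          = ∑ e ∈ U, (Nat.card {ω // cov ω e} : ℝ) := by
        have := Finset.sum_card_bipartiteAbove_eq_sum_card_bipartiteBelow
          (s := (univ : Finset Ω)) (t := U) cov
        simp only [bipartiteAbove, bipartiteBelow] at this
        simp only [Nat.card_eq_fintype_card, Fintype.card_subtype]
        exact_mod_cast this
      rw [h1, sum_const, card_univ, nsmul_eq_mul]
      calc (Fintype.card Ω : ℝ) * (q * U.card) = ∑ _e ∈ U, q * (Fintype.card Ω : ℝ) := by
            rw [sum_const, nsmul_eq_mul]; ring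
        _ ≤ _ := sum_le_sum fun e he => h e (hUX he)
    obtain ⟨ω, -, hω⟩ := exists_le_of_sum_le (univ_nonempty) hsum
    refine ⟨Fin.snoc w ω, U.filter fun e => ¬ cov ω e, (filter_subset _ _).trans hUX, ?_, ?_⟩
    · intro e he heU
      by_cases hc : cov ω e
      · exact ⟨Fin.last t, by simpa using hc⟩
      · have : e ∉ U := fun h => heU (mem_filter.2 ⟨h, hc⟩)
        obtain ⟨j, hj⟩ := hU e he this
        exact ⟨j.castSucc, by simpa using hj⟩
    · have h2 := card_filter_add_card_filter_not (s := U) (cov ω)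
      have h3 : ((U.filter (cov ω)).card : ℝ) + (U.filter fun e => ¬ cov ω e).card = U.card := by
        exact_mod_cast h2
      have h4 : (1 - q) * (U.card : ℝ) ≤ (1 - q) * ((1 - q) ^ t * X.card) :=
        mul_le_mul_of_nonneg_left hcard (by linarith)
      rw [pow_succ]
      nlinarith

theorem card_fun_eq_on [Fintype V] {m : ℕ} [NeZero m] (A : Finset V) :
    ((univ.filter fun f : V → Fin m => ∀ x ∈ A, f x = 0).card : ℝ)
      = (m : ℝ) ^ Fintype.card V / (m : ℝ) ^ A.card := by
  have hm : (m : ℝ) ≠ 0 := by exact_mod_cast NeZero.ne m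
  have h1 : (univ.filter fun f : V → Fin m => ∀ x ∈ A, f x = 0)
      = Fintype.piFinset fun x => if x ∈ A then {0} else univ := by
    ext f
    simp only [mem_filter, mem_univ, true_and, Fintype.mem_piFinset]
    refine forall_congr' fun x => ?_
    by_cases hx : x ∈ A <;> simp [hx]
  rw [h1, Fintype.card_piFinset, eq_div_iff (pow_ne_zero _ hm)]
  have h2 : ∀ x : V, (if x ∈ A then ({0} : Finset (Fin m)) else univ).card
      = if x ∈ A then 1 else m := by
    intro x; by_cases hx : x ∈ A <;> simp [hx]
  simp only [h2]
  rw [prod_ite, prod_const_one, one_mul, prod_const]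
  have h3 := card_filter_add_card_filter_not (s := (univ : Finset V)) (· ∈ A)
  simp only [filter_univ_mem, card_univ] at h3
  push_cast
  rw [← pow_add, ← h3, add_comm]

/-- In a full Steiner system on `n` points, at most `n - 1` edges contain a given point. -/
theorem card_edges_through_le [Fintype V] {k : ℕ} (hk : 2 ≤ k) {S : Finset (Finset V)}
    (hS : IsFullSteiner k S) (x : V) : (S.filter fun e => x ∈ e).card ≤ Fintype.card V := by
  rw [isFullSteiner_iff] at hS
  have h : ∀ e ∈ S.filter (fun e => x ∈ e), ∃ y, y ∈ e ∧ y ≠ x := by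
    intro e he
    rw [mem_filter] at he
    obtain ⟨y, hy, hyx⟩ := exists_mem_ne (by rw [hS.1 e he.1]; omega : 1 < e.card) x
    exact ⟨y, hy, hyx⟩
  have : Nonempty V := ⟨x⟩
  choose! g hg using h
  rw [← card_univ]
  refine card_le_card_of_injOn g (fun _ _ => mem_univ _) fun e he e' he' heq => ?_
  have h1 := hg e he
  have h2 := hg e' he'
  rw [mem_coe, mem_filter] at he he'
  rw [← heq] at h2
  exact (hS.2 x (g e) h1.2.symm).unique ⟨he.1, he.2, h1.1⟩ ⟨he'.1, he'.2, h2.1⟩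

/-- Two distinct edges of a full Steiner system share at most one point. -/
theorem IsFullSteiner.card_inter_le {k : ℕ} {S : Finset (Finset V)}
    (hS : IsFullSteiner k S) {e f : Finset V} (he : e ∈ S) (hf : f ∈ S) (hne : e ≠ f) :
    (e ∩ f).card ≤ 1 := by
  rw [isFullSteiner_iff] at hS
  by_contra! h
  obtain ⟨x, hx, y, hy, hxy⟩ := one_lt_card.1 h
  rw [mem_inter] at hx hy
  exact hne ((hS.2 x y hxy).unique ⟨he, hx.1, hy.1⟩ ⟨hf, hx.2, hy.2⟩)

/-- At most `k ^ 2` edges meet a `k`-set in at least two points. -/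
theorem card_edges_inter_two_le {k : ℕ} {S : Finset (Finset V)}
    (hS : IsFullSteiner k S) {e : Finset V} (he : e.card = k) :
    (S.filter fun f => 2 ≤ (f ∩ e).card).card ≤ k ^ 2 := by
  rw [isFullSteiner_iff] at hS
  have h : ∀ f ∈ S.filter (fun f => 2 ≤ (f ∩ e).card),
      ∃ p : V × V, p.1 ∈ e ∧ p.2 ∈ e ∧ p.1 ∈ f ∧ p.2 ∈ f ∧ p.1 ≠ p.2 := by
    intro f hf
    rw [mem_filter] at hf
    obtain ⟨x, hx, y, hy, hxy⟩ := one_lt_card.1 hf.2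
    rw [mem_inter] at hx hy
    exact ⟨(x, y), hx.2, hy.2, hx.1, hy.1, hxy⟩
  obtain h0 | ⟨f₀, hf₀⟩ := (S.filter fun f => 2 ≤ (f ∩ e).card).eq_empty_or_nonempty
  · simp [h0]
  have : Nonempty V := ⟨(h f₀ hf₀).choose.1⟩
  choose! g hg using h
  have h2 : (e ×ˢ e).card = k ^ 2 := by rw [card_product, he, sq]
  rw [← h2]
  refine card_le_card_of_injOn g (fun f hf => ?_) fun f hf f' hf' heq => ?_
  · have := hg f hf
    exact mem_coe.2 (mem_product.2 ⟨this.1, this.2.1⟩)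
  · have h1 := hg f hf
    have h2 := hg f' hf'
    rw [mem_coe, mem_filter] at hf hf'
    rw [← heq] at h2
    exact (hS.2 _ _ h1.2.2.2.2).unique ⟨hf.1, h1.2.2.1, h1.2.2.2.1⟩ ⟨hf'.1, h2.2.2.1, h2.2.2.2.1⟩

/-- The points of the zero class of a colouring lying in no edge inside the zero class. -/
def zeroClassPruned [Fintype V] {m : ℕ} [NeZero m] (S : Finset (Finset V)) (f : V → Fin m) :
    Finset V :=
  univ.filter fun x => f x = 0 ∧ ∀ g ∈ S, x ∈ g → ∃ y ∈ g, f y ≠ 0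

theorem isIndep_zeroClassPruned [Fintype V] {m : ℕ} [NeZero m] {S : Finset (Finset V)}
    (hS : ∀ e ∈ S, e.Nonempty) (f : V → Fin m) : IsIndep S (zeroClassPruned S f) := by
  intro e he hsub
  obtain ⟨x, hx⟩ := hS e he
  have h1 := hsub hx
  simp only [zeroClassPruned, mem_filter, mem_univ, true_and] at h1
  obtain ⟨y, hy, hfy⟩ := h1.2 e he hx
  have h2 := hsub hy
  simp only [zeroClassPruned, mem_filter, mem_univ, true_and] at h2
  exact hfy h2.1

/-- A random colouring with `m` colours prunes a fixed non-edge out of its zero class with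
conditional probability at most one half. -/
theorem half_le_card_subset_zeroClassPruned [Fintype V] {k m : ℕ} [NeZero m] (hk : 3 ≤ k)
    {S : Finset (Finset V)} (hS : IsFullSteiner k S) (hm1 : 4 * k ^ 2 ≤ m)
    (hm2 : 4 * k * Fintype.card V ≤ m ^ (k - 1)) {e : Finset V} (he : e.card = k) (heS : e ∉ S) :
    (1 / (2 * (m : ℝ) ^ k)) * (m : ℝ) ^ Fintype.card V ≤
      ((univ.filter fun f : V → Fin m => e ⊆ zeroClassPruned S f).card : ℝ) := by
  classical
  have hm : (0 : ℝ) < m := by exact_mod_cast NeZero.pos m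
  have hm0 : (m : ℝ) ≠ 0 := hm.ne'
  set A : Finset (V → Fin m) := univ.filter fun f => ∀ x ∈ e, f x = 0 with hA
  let B : Finset V → Finset (V → Fin m) := fun g => univ.filter fun f => ∀ x ∈ e ∪ g, f x = 0
  let S1 := S.filter fun g => (g ∩ e).card = 1
  let S2 := S.filter fun g => 2 ≤ (g ∩ e).card
  have hcover : A ⊆ (univ.filter fun f : V → Fin m => e ⊆ zeroClassPruned S f) ∪
      (S1.biUnion B ∪ S2.biUnion B) := by
    intro f hf
    rw [hA, mem_filter] at hf
    by_cases h : e ⊆ zeroClassPruned S f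
    · exact mem_union_left _ (mem_filter.2 ⟨mem_univ _, h⟩)
    · apply mem_union_right
      rw [not_subset] at h
      obtain ⟨x, hx, hx'⟩ := h
      simp only [zeroClassPruned, mem_filter, mem_univ, true_and, not_and, not_forall] at hx'
      obtain ⟨g, hg, hxg, hz⟩ := hx' (hf.2 x hx)
      push Not at hz
      have hB : f ∈ B g := by
        simp only [B, mem_filter, mem_univ, true_and, mem_union]
        rintro y (hy | hy)
        exacts [hf.2 y hy, hz y hy]
      have hpos : 0 < (g ∩ e).card := card_pos.2 ⟨x, mem_inter.2 ⟨hxg, hx⟩⟩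
      rcases (by omega : (g ∩ e).card = 1 ∨ 2 ≤ (g ∩ e).card) with h1 | h2
      · exact mem_union_left _ (mem_biUnion.2 ⟨g, mem_filter.2 ⟨hg, h1⟩, hB⟩)
      · exact mem_union_right _ (mem_biUnion.2 ⟨g, mem_filter.2 ⟨hg, h2⟩, hB⟩)
  have hcard := (card_le_card hcover).trans ((card_union_le _ _).trans
    (add_le_add_right ((card_union_le _ _).trans (add_le_add card_biUnion_le card_biUnion_le)) _))
  have hcardR : (A.card : ℝ) ≤ (univ.filter fun f : V → Fin m => e ⊆ zeroClassPruned S f).card +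
      (∑ g ∈ S1, ((B g).card : ℝ) + ∑ g ∈ S2, ((B g).card : ℝ)) := by exact_mod_cast hcard
  set P : ℝ := (m : ℝ) ^ Fintype.card V with hP
  have hP0 : 0 < P := by positivity
  have hAc : (A.card : ℝ) = P / (m : ℝ) ^ k := by rw [hA, card_fun_eq_on, he]
  have hBc : ∀ g, ((B g).card : ℝ) = P / (m : ℝ) ^ (e ∪ g).card := fun g => card_fun_eq_on _
  have hun : ∀ g ∈ S, (e ∪ g).card + (g ∩ e).card = k + k := by
    intro g hg
    rw [inter_comm, card_union_add_card_inter, he, hS.1 g hg]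
  have hS1c : (S1.card : ℝ) ≤ k * Fintype.card V := by
    have : S1 ⊆ e.biUnion fun x => S.filter fun g => x ∈ g := by
      intro g hg
      simp only [S1, mem_filter] at hg
      obtain ⟨x, hx⟩ := card_pos.1 (by omega : 0 < (g ∩ e).card)
      rw [mem_inter] at hx
      exact mem_biUnion.2 ⟨x, hx.2, mem_filter.2 ⟨hg.1, hx.1⟩⟩
    have h2 := (card_le_card this).trans (card_biUnion_le_card_mul _ _ (Fintype.card V)
      fun x _ => card_edges_through_le (by omega) hS x)
    rw [he] at h2
    exact_mod_cast h2
  have hS2c : (S2.card : ℝ) ≤ k ^ 2 := by exact_mod_cast card_edges_inter_two_le hS he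
  have hsum1 : ∑ g ∈ S1, ((B g).card : ℝ) ≤ P / (m : ℝ) ^ k / 4 := by
    calc ∑ g ∈ S1, ((B g).card : ℝ) = ∑ g ∈ S1, P / (m : ℝ) ^ k / (m : ℝ) ^ (k - 1) := by
          refine sum_congr rfl fun g hg => ?_
          simp only [S1, mem_filter] at hg
          have := hun g hg.1
          rw [hBc, div_div, ← pow_add]
          congr 2; omega
      _ = S1.card * (P / (m : ℝ) ^ k / (m : ℝ) ^ (k - 1)) := by rw [sum_const, nsmul_eq_mul]
      _ ≤ (k * Fintype.card V) * (P / (m : ℝ) ^ k / (m : ℝ) ^ (k - 1)) := by gcongr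
      _ ≤ P / (m : ℝ) ^ k / 4 := by
          rw [← mul_div_assoc, div_le_div_iff₀ (by positivity) (by norm_num)]
          have : 4 * (k : ℝ) * Fintype.card V ≤ (m : ℝ) ^ (k - 1) := by exact_mod_cast hm2
          have h3 : 0 ≤ P / (m : ℝ) ^ k := by positivity
          nlinarith
  have hsum2 : ∑ g ∈ S2, ((B g).card : ℝ) ≤ P / (m : ℝ) ^ k / 4 := by
    calc ∑ g ∈ S2, ((B g).card : ℝ) ≤ ∑ g ∈ S2, P / (m : ℝ) ^ k / (m : ℝ) := by
          refine sum_le_sum fun g hg => ?_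
          simp only [S2, mem_filter] at hg
          have h1 := hun g hg.1
          have h2 : k + 1 ≤ (e ∪ g).card := by
            by_contra! h
            have he' : e = e ∪ g := eq_of_subset_of_card_le subset_union_left (by omega)
            have hg' : g = e ∪ g := eq_of_subset_of_card_le subset_union_right
              (by rw [hS.1 g hg.1]; omega)
            exact heS (by rw [he', ← hg']; exact hg.1)
          rw [hBc, div_div, ← pow_succ]
          have h1m : (1 : ℝ) ≤ m := by exact_mod_cast NeZero.pos m
          gcongr
      _ = S2.card * (P / (m : ℝ) ^ k / (m : ℝ)) := by rw [sum_const, nsmul_eq_mul]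
      _ ≤ k ^ 2 * (P / (m : ℝ) ^ k / (m : ℝ)) := by gcongr
      _ ≤ P / (m : ℝ) ^ k / 4 := by
          rw [← mul_div_assoc, div_le_div_iff₀ (by positivity) (by norm_num)]
          have : 4 * (k : ℝ) ^ 2 ≤ (m : ℝ) := by exact_mod_cast hm1
          have h3 : 0 ≤ P / (m : ℝ) ^ k := by positivity
          nlinarith
  have hfin : (1 / (2 * (m : ℝ) ^ k)) * P = P / (m : ℝ) ^ k / 2 := by field_simp
  rw [hfin]
  linarith

theorem vartheta_le_of_isFullSteiner (k : ℕ) (hk : 3 ≤ k) :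
    ∃ c : ℝ, 0 < c ∧ ∀ n : ℕ, 2 ≤ n → ∀ S : Finset (Finset (Fin n)), IsFullSteiner k S →
      (vartheta k S : ℝ) ≤ c * (n : ℝ) ^ ((k : ℝ) / ((k : ℝ) - 1)) * Real.log n := by
  have hkR : (3 : ℝ) ≤ k := by exact_mod_cast hk
  refine ⟨(2 * k + 2) * (2 * (8 * (k : ℝ) ^ 2) ^ k), by positivity, fun n hn S hS => ?_⟩
  have hnR : (2 : ℝ) ≤ n := by exact_mod_cast hn
  have hn0 : (0 : ℝ) < n := by linarith
  set a : ℝ := (n : ℝ) ^ ((1 : ℝ) / ((k : ℝ) - 1)) with ha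
  have ha1 : 1 ≤ a := Real.one_le_rpow (by linarith) (by apply div_nonneg <;> linarith)
  have hak1 : a ^ (k - 1) = n := by
    rw [ha, ← Real.rpow_natCast, ← Real.rpow_mul hn0.le]
    rw [Nat.cast_sub (by omega), Nat.cast_one, one_div_mul_cancel (by linarith), Real.rpow_one]
  have hak : a ^ k = (n : ℝ) ^ ((k : ℝ) / ((k : ℝ) - 1)) := by
    rw [ha, ← Real.rpow_natCast, ← Real.rpow_mul hn0.le]
    congr 1; ring
  set m : ℕ := ⌈4 * (k : ℝ) ^ 2 * a⌉₊ with hm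
  have hm_ge : 4 * (k : ℝ) ^ 2 * a ≤ m := Nat.le_ceil _
  have hm_le : (m : ℝ) ≤ 8 * (k : ℝ) ^ 2 * a := by
    have := (Nat.ceil_lt_add_one (by positivity : (0 : ℝ) ≤ 4 * (k : ℝ) ^ 2 * a)).le
    rw [← hm] at this
    nlinarith
  have hm4 : 4 * (k : ℝ) ^ 2 ≤ m := by nlinarith
  have hmpos : 0 < m := by
    have : (0 : ℝ) < m := by nlinarith
    exact_mod_cast this
  have : NeZero m := ⟨hmpos.ne'⟩
  have hmR : (1 : ℝ) ≤ m := by exact_mod_cast hmpos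
  have hm1 : 4 * k ^ 2 ≤ m := by exact_mod_cast hm4
  have hm2 : 4 * k * Fintype.card (Fin n) ≤ m ^ (k - 1) := by
    rw [Fintype.card_fin]
    have h1 : (4 * (k : ℝ) ^ 2 * a) ^ (k - 1) ≤ (m : ℝ) ^ (k - 1) := by gcongr
    rw [mul_pow, hak1] at h1
    have h2 : 4 * (k : ℝ) ≤ (4 * (k : ℝ) ^ 2) ^ (k - 1) := by
      calc 4 * (k : ℝ) ≤ (4 * (k : ℝ) ^ 2) ^ 1 := by nlinarith
        _ ≤ _ := by gcongr <;> [nlinarith; omega]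
    have h3 : 4 * (k : ℝ) * n ≤ (m : ℝ) ^ (k - 1) := le_trans (by gcongr) h1
    exact_mod_cast h3
  set q : ℝ := 1 / (2 * (m : ℝ) ^ k) with hq
  have hmk : (1 : ℝ) ≤ (m : ℝ) ^ k := one_le_pow₀ hmR
  have hq0 : 0 < q := by positivity
  have hq1 : q ≤ 1 := by rw [hq, div_le_one (by positivity)]; linarith
  set t : ℕ := ⌊(k * Real.log n) / q⌋₊ + 1 with ht
  obtain ⟨w, U, -, hU, hUc⟩ := exists_greedy_cover (Ω := Fin n → Fin m)
    (univ.filter fun e : Finset (Fin n) => e.card = k ∧ e ∉ S)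
    (fun f e => e ⊆ zeroClassPruned S f) hq1 (fun e he => by
      simp only [mem_filter, mem_univ, true_and] at he
      have := half_le_card_subset_zeroClassPruned hk hS hm1 hm2 he.1 he.2
      rw [Nat.card_eq_fintype_card, Fintype.card_subtype]
      simpa [hq] using this) t
  have hlog : 0 < Real.log n := Real.log_pos (by linarith)
  have hU0 : U = ∅ := by
    rw [← card_eq_zero]
    by_contra h
    have hU1 : (1 : ℝ) ≤ U.card := by exact_mod_cast Nat.one_le_iff_ne_zero.2 h
    have hX : ((univ.filter fun e : Finset (Fin n) => e.card = k ∧ e ∉ S).card : ℝ)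
        ≤ (n : ℝ) ^ k := by
      have h1 : (univ.filter fun e : Finset (Fin n) => e.card = k ∧ e ∉ S).card
          ≤ (powersetCard k (univ : Finset (Fin n))).card := card_le_card fun e he => by
        simp only [mem_filter, mem_univ, true_and] at he
        exact mem_powersetCard.2 ⟨subset_univ _, he.1⟩
      rw [card_powersetCard, card_univ, Fintype.card_fin] at h1
      exact_mod_cast h1.trans (Nat.choose_le_pow _ _)
    have h1 : (1 - q) ^ t ≤ Real.exp (-(q * t)) := by
      have : 1 - q ≤ Real.exp (-q) := by have := Real.add_one_le_exp (-q); linarith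
      calc (1 - q) ^ t ≤ Real.exp (-q) ^ t := pow_le_pow_left₀ (by linarith) this _
        _ = _ := by rw [← Real.exp_nat_mul]; ring_nf
    have h2 : k * Real.log n < q * t := by
      have := Nat.lt_floor_add_one ((k * Real.log n) / q)
      rw [div_lt_iff₀ hq0] at this
      rw [ht]; push_cast; linarith
    have h3 : (n : ℝ) ^ k = Real.exp (k * Real.log n) := by
      rw [Real.exp_nat_mul, Real.exp_log hn0]
    have h4 : (U.card : ℝ) ≤ Real.exp (-(q * t)) * (n : ℝ) ^ k :=
      hUc.trans (by gcongr)
    rw [h3, ← Real.exp_add] at h4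
    have h5 : Real.exp (-(q * t) + k * Real.log n) < 1 := by
      rw [Real.exp_lt_one_iff]; linarith
    linarith
  have hle : vartheta k S ≤ t := Nat.sInf_le ⟨fun j => zeroClassPruned S (w j),
    fun j => isIndep_zeroClassPruned
      (fun e he => card_pos.1 (by rw [hS.1 e he]; omega)) _,
    fun e he heS => hU e (by simp [he, heS]) (by simp [hU0])⟩
  have hlog2 : 1 / 2 ≤ Real.log n := by
    have := Real.log_two_gt_d9
    have := Real.log_le_log (by norm_num) hnR
    linarith
  have ht1 : (t : ℝ) ≤ (k * Real.log n) / q + 1 := by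
    rw [ht]; push_cast
    have := Nat.floor_le (by positivity : 0 ≤ (k * Real.log n) / q)
    linarith
  have hqi : (k * Real.log n) / q = k * Real.log n * (2 * (m : ℝ) ^ k) := by
    rw [hq]; field_simp
  have hmk2 : (m : ℝ) ^ k ≤ (8 * (k : ℝ) ^ 2) ^ k * (n : ℝ) ^ ((k : ℝ) / ((k : ℝ) - 1)) := by
    rw [← hak, ← mul_pow]; gcongr
  calc (vartheta k S : ℝ) ≤ t := by exact_mod_cast hle
    _ ≤ k * Real.log n * (2 * (m : ℝ) ^ k) + 1 := hqi ▸ ht1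
    _ ≤ (2 * k + 2) * Real.log n * (2 * (m : ℝ) ^ k) := by
        have h1 : (1:ℝ) / 2 * 2 ≤ Real.log n * (2 * (m : ℝ) ^ k) := by gcongr; linarith
        have h2 : 0 ≤ k * Real.log n * (2 * (m : ℝ) ^ k) := by positivity
        nlinarith
    _ ≤ (2 * k + 2) * Real.log n *
          (2 * ((8 * (k : ℝ) ^ 2) ^ k * (n : ℝ) ^ ((k : ℝ) / ((k : ℝ) - 1)))) := by gcongr
    _ = _ := by ring

section FieldDesign

variable {F : Type} [Field F]

/-- The field element `x` is a unit lying in the coset `c` of `H`. -/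
def InCoset (H : Subgroup Fˣ) (c : Fˣ ⧸ H) (x : F) : Prop :=
  ∃ u : Fˣ, (u : F) = x ∧ (u : Fˣ ⧸ H) = c

theorem InCoset.ne_zero {H : Subgroup Fˣ} {c : Fˣ ⧸ H} {x : F} (h : InCoset H c x) : x ≠ 0 := by
  obtain ⟨u, rfl, -⟩ := h
  exact u.ne_zero

theorem InCoset.unique {H : Subgroup Fˣ} {c c' : Fˣ ⧸ H} {x : F} (h : InCoset H c x)
    (h' : InCoset H c' x) : c = c' := by
  obtain ⟨u, rfl, rfl⟩ := h
  obtain ⟨v, hv, rfl⟩ := h'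
  rw [Units.ext hv]

variable [Fintype F]

theorem card_same_coset_le (H : Subgroup Fˣ) (y y' : F) (hy : y ≠ y') :
    Nat.card {x : F // ∃ c, InCoset H c (y - x) ∧ InCoset H c (y' - x)} + 1 ≤ Nat.card H := by
  classical
  have hfin : Nat.card {x : F // ∃ c, InCoset H c (y - x) ∧ InCoset H c (y' - x)} ≤
      Nat.card {u : H // u ≠ 1} := by
    have key : ∀ x : {x : F // ∃ c, InCoset H c (y - x) ∧ InCoset H c (y' - x)},
        ∃ u : {u : H // u ≠ 1}, ((u.1 : Fˣ) : F) * (y' - x) = y - x := by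
      rintro ⟨x, c, ⟨u, hu, huc⟩, ⟨v, hv, hvc⟩⟩
      have hmem : u * v⁻¹ ∈ H := by
        rw [mul_comm, ← QuotientGroup.eq, hvc, huc]
      refine ⟨⟨⟨u * v⁻¹, hmem⟩, fun h => hy ?_⟩, ?_⟩
      · have : u = v := mul_inv_eq_one.1 (congrArg Subtype.val h)
        have h2 : y - x = y' - x := by rw [← hu, ← hv, this]
        exact sub_left_inj.1 h2
      · have h2 : (u : F) * ((v⁻¹ : Fˣ) : F) * (y' - x) = y - x := by rw [← hu, ← hv]; simp
        simpa using h2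
    choose g hg using key
    refine Nat.card_le_card_of_injective g fun x x' h => ?_
    have h1 := hg x
    have h2 := hg x'
    rw [← h] at h2
    have h3 : (((g x).1 : Fˣ) : F) ≠ 1 := fun h1 => (g x).2 (by ext; simpa using h1)
    have h4 : ((((g x).1 : Fˣ) : F) - 1) * ((x' : F) - x) = 0 := by linear_combination h1 - h2
    rcases mul_eq_zero.1 h4 with h | h
    · exact absurd (sub_eq_zero.1 h) h3
    · exact Subtype.ext (sub_eq_zero.1 h).symm
  have h1 : Nat.card {u : H // u ≠ 1} + 1 = Nat.card H := by
    rw [Nat.card_eq_fintype_card, Nat.card_eq_fintype_card, Fintype.card_subtype_compl,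
      Fintype.card_subtype_eq]
    have := Fintype.card_pos (α := H)
    omega
  omega

open Classical in
/-- The number of elements of `Y` at a difference from `x` lying in the coset `c`. -/
noncomputable def cosetDegree (H : Subgroup Fˣ) (Y : Finset F) (c : Fˣ ⧸ H) (x : F) : ℕ :=
  (Y.filter fun y => InCoset H c (y - x)).card

theorem sum_cosetDegree_variance_le (H : Subgroup Fˣ) (Y : Finset F) (c : Fˣ ⧸ H) :
    ∑ x : F, ((cosetDegree H Y c x : ℝ) - Nat.card H * Y.card / Fintype.card F) ^ 2 ≤
      Fintype.card F * Y.card := by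
  classical
  set q : ℝ := ((Fintype.card F : ℕ) : ℝ) with hq
  set h : ℝ := ((Nat.card H : ℕ) : ℝ) with hh
  set y : ℝ := ((Y.card : ℕ) : ℝ) with hy
  have hq1 : (1 : ℝ) ≤ q := by rw [hq]; exact_mod_cast Fintype.card_pos (α := F)
  have hh1 : (1 : ℝ) ≤ h := by rw [hh]; exact_mod_cast Nat.card_pos (α := H)
  have hy0 : 0 ≤ y := by positivity
  have hyq : y ≤ q := by rw [hy, hq]; exact_mod_cast card_le_univ Y
  have hunits : (Fintype.card (Fˣ ⧸ H) : ℝ) * h = q - 1 := by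
    have h1 := H.card_eq_card_quotient_mul_card_subgroup
    rw [Nat.card_eq_fintype_card, Fintype.card_units, Nat.card_eq_fintype_card] at h1
    have h2 : ((Fintype.card F - 1 : ℕ) : ℝ) = q - 1 := by
      rw [Nat.cast_sub Fintype.card_pos, Nat.cast_one]
    rw [← h2, h1]; push_cast; rfl
  have hN : ∀ c x, (cosetDegree H Y c x : ℝ) =
      ∑ y ∈ Y, if InCoset H c (y - x) then (1 : ℝ) else 0 := by
    intro c x
    rw [cosetDegree, Finset.sum_boole]
  -- First moment.
  have hfirst : ∑ c : Fˣ ⧸ H, ∑ x : F, (cosetDegree H Y c x : ℝ) = y * (q - 1) := by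
    simp only [hN]
    rw [sum_congr rfl fun c _ => sum_comm, sum_comm]
    have : ∀ z ∈ Y, ∑ c : Fˣ ⧸ H, ∑ x : F, (if InCoset H c (z - x) then (1 : ℝ) else 0)
        = q - 1 := by
      intro z _
      rw [sum_comm]
      have h1 : ∀ x : F, ∑ c : Fˣ ⧸ H, (if InCoset H c (z - x) then (1 : ℝ) else 0)
          = if x = z then 0 else 1 := by
        intro x
        split_ifs with hx
        · exact sum_eq_zero fun c _ => if_neg fun h => h.ne_zero (by simp [hx])
        · have hne : z - x ≠ 0 := sub_ne_zero.2 (Ne.symm hx)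
          have hc : InCoset H ((Units.mk0 _ hne : Fˣ) : Fˣ ⧸ H) (z - x) := ⟨_, rfl, rfl⟩
          rw [sum_eq_single_of_mem _ (mem_univ _) fun c' _ hc' =>
            if_neg fun h => hc' (h.unique hc), if_pos hc]
      simp only [h1]
      rw [sum_ite, sum_const_zero, zero_add, sum_const, nsmul_one, filter_ne', card_erase_of_mem
        (mem_univ _), card_univ, Nat.cast_sub Fintype.card_pos, Nat.cast_one]
    rw [sum_congr rfl this, sum_const, nsmul_eq_mul]
  -- Second moment.
  have hsecond : ∑ c : Fˣ ⧸ H, ∑ x : F, (cosetDegree H Y c x : ℝ) ^ 2 ≤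
      y * (q - 1) + y * (y - 1) * (h - 1) := by
    have h1 : ∀ c x, (cosetDegree H Y c x : ℝ) ^ 2 = ∑ z ∈ Y, ∑ z' ∈ Y,
        if InCoset H c (z - x) ∧ InCoset H c (z' - x) then (1 : ℝ) else 0 := by
      intro c x
      rw [hN, sq, sum_mul_sum]
      refine sum_congr rfl fun z _ => sum_congr rfl fun z' _ => ?_
      by_cases h1 : InCoset H c (z - x) <;> by_cases h2 : InCoset H c (z' - x) <;> simp [h1, h2]
    have h2 : ∑ c : Fˣ ⧸ H, ∑ x : F, (cosetDegree H Y c x : ℝ) ^ 2 = ∑ z ∈ Y, ∑ z' ∈ Y,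
        ∑ x : F, ∑ c : Fˣ ⧸ H,
          if InCoset H c (z - x) ∧ InCoset H c (z' - x) then (1 : ℝ) else 0 := by
      simp only [h1]
      rw [sum_comm, sum_congr rfl fun x _ => sum_comm, sum_comm]
      refine sum_congr rfl fun z _ => ?_
      rw [sum_congr rfl fun x _ => sum_comm, sum_comm]
    have h3 : ∀ z z', ∑ x : F, ∑ c : Fˣ ⧸ H,
        (if InCoset H c (z - x) ∧ InCoset H c (z' - x) then (1 : ℝ) else 0) =
        (Nat.card {x : F // ∃ c, InCoset H c (z - x) ∧ InCoset H c (z' - x)} : ℝ) := by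
      intro z z'
      rw [Nat.card_eq_fintype_card, Fintype.card_subtype, ← Finset.sum_boole]
      refine sum_congr rfl fun x _ => ?_
      split_ifs with hc
      · obtain ⟨c, hc⟩ := hc
        rw [sum_eq_single_of_mem c (mem_univ _) fun c' _ hc' =>
          if_neg fun h => hc' (h.1.unique hc.1), if_pos hc]
      · exact sum_eq_zero fun c _ => if_neg fun h => hc ⟨c, h⟩
    have h4 : ∀ z, (Nat.card {x : F // ∃ c, InCoset H c (z - x) ∧ InCoset H c (z - x)} : ℝ)
        ≤ q - 1 := by
      intro z
      have : Nat.card {x : F // ∃ c, InCoset H c (z - x) ∧ InCoset H c (z - x)} ≤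
          Fintype.card F - 1 := by
        rw [Nat.card_eq_fintype_card, Fintype.card_subtype, ← card_univ,
          ← card_erase_of_mem (mem_univ z)]
        refine card_le_card fun x hx => ?_
        rw [mem_filter] at hx
        obtain ⟨-, c, hc, -⟩ := hx
        exact mem_erase.2 ⟨fun h => hc.ne_zero (by simp [h]), mem_univ _⟩
      have h2 : ((Fintype.card F - 1 : ℕ) : ℝ) = q - 1 := by
        rw [Nat.cast_sub Fintype.card_pos, Nat.cast_one]
      rw [← h2]; exact_mod_cast this
    have h5 : ∀ z z', z ≠ z' →
        (Nat.card {x : F // ∃ c, InCoset H c (z - x) ∧ InCoset H c (z' - x)} : ℝ) ≤ h - 1 := by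
      intro z z' hz
      have := card_same_coset_le H z z' hz
      have h1 : (Nat.card {x : F // ∃ c, InCoset H c (z - x) ∧ InCoset H c (z' - x)} : ℝ) + 1
          ≤ h := by rw [hh]; exact_mod_cast this
      linarith
    rw [h2]
    calc _ ≤ ∑ z ∈ Y, ((q - 1) + (y - 1) * (h - 1)) := by
          refine sum_le_sum fun z hz => ?_
          simp only [h3]
          rw [← add_sum_erase _ _ hz]
          refine add_le_add (h4 z) ?_
          calc _ ≤ ∑ z' ∈ Y.erase z, (h - 1) :=
                sum_le_sum fun z' hz' => h5 z z' (mem_erase.1 hz').1.symm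
            _ = (y - 1) * (h - 1) := by
                rw [sum_const, nsmul_eq_mul, card_erase_of_mem hz,
                  Nat.cast_sub (card_pos.2 ⟨z, hz⟩), Nat.cast_one]
      _ = _ := by rw [sum_const, nsmul_eq_mul]; ring
  have hone : ∑ x : F, ((cosetDegree H Y c x : ℝ) - h * y / q) ^ 2 ≤
      ∑ c : Fˣ ⧸ H, ∑ x : F, ((cosetDegree H Y c x : ℝ) - h * y / q) ^ 2 :=
    single_le_sum (f := fun c => ∑ x : F, ((cosetDegree H Y c x : ℝ) - h * y / q) ^ 2)
      (fun c _ => sum_nonneg fun x _ => sq_nonneg _) (mem_univ c)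
  have hexp : ∑ c : Fˣ ⧸ H, ∑ x : F, ((cosetDegree H Y c x : ℝ) - h * y / q) ^ 2 =
      ∑ c : Fˣ ⧸ H, ∑ x : F, (cosetDegree H Y c x : ℝ) ^ 2
        - 2 * (h * y / q) * ∑ c : Fˣ ⧸ H, ∑ x : F, (cosetDegree H Y c x : ℝ)
        + Fintype.card (Fˣ ⧸ H) * (q * (h * y / q) ^ 2) := by
    have h1 : ∀ c, ∑ x : F, ((cosetDegree H Y c x : ℝ) - h * y / q) ^ 2 =
        ∑ x : F, (cosetDegree H Y c x : ℝ) ^ 2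
        - 2 * (h * y / q) * ∑ x : F, (cosetDegree H Y c x : ℝ) + q * (h * y / q) ^ 2 := by
      intro c
      simp only [sub_sq]
      rw [sum_add_distrib, sum_sub_distrib, sum_const, card_univ, nsmul_eq_mul, mul_sum]
      congr 2
      exact sum_congr rfl fun x _ => by ring
    simp only [h1]
    rw [sum_add_distrib, sum_sub_distrib, sum_const, card_univ, nsmul_eq_mul, mul_sum]
  have h6 : (Fintype.card (Fˣ ⧸ H) : ℝ) * (q * (h * y / q) ^ 2) = (q - 1) * (h * y ^ 2 / q) := by
    rw [← hunits]; field_simp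
  have h7 : h * y / q ≤ h := by
    rw [div_le_iff₀ (by linarith)]; gcongr
  have h8 : h * y / q * q = h * y := by field_simp
  have h9 : h * y ^ 2 / q = h * y / q * y := by ring
  refine hone.trans ?_
  rw [hexp, hfirst, h6, h9]
  generalize h * y / q = μ at *
  nlinarith [mul_le_mul_of_nonneg_right h7 hy0, mul_nonneg hy0 hy0]

open Classical in
/-- Few points have small degree into a given set `Y`. -/
theorem card_small_cosetDegree_mul_le (H : Subgroup Fˣ) {e : ℕ} (he : 1 ≤ e) (hH : H.index ≤ e)
    (Y : Finset F) (c : Fˣ ⧸ H) :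
    ((univ.filter fun x : F => (cosetDegree H Y c x : ℝ) < Y.card / (4 * e)).card : ℝ) * Y.card ≤
      16 * e ^ 2 * Fintype.card F := by
  rcases Y.eq_empty_or_nonempty with rfl | hY
  · simp; positivity
  have hv := sum_cosetDegree_variance_le H Y c
  set q : ℝ := ((Fintype.card F : ℕ) : ℝ) with hq
  set y : ℝ := ((Y.card : ℕ) : ℝ) with hy
  set bad := univ.filter fun x : F => (cosetDegree H Y c x : ℝ) < y / (4 * e) with hbad
  have hy0 : 0 < y := by rw [hy]; exact_mod_cast card_pos.2 hY
  have heR : (1 : ℝ) ≤ e := by exact_mod_cast he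
  have hq2 : (2 : ℝ) ≤ q := by rw [hq]; exact_mod_cast Fintype.one_lt_card (α := F)
  have hmean : y / (2 * e) ≤ Nat.card H * y / q := by
    have h1 := H.index_mul_card
    rw [Nat.card_eq_fintype_card (α := Fˣ), Fintype.card_units] at h1
    have h2 : (H.index : ℝ) * Nat.card H = q - 1 := by
      have h2 : ((Fintype.card F - 1 : ℕ) : ℝ) = q - 1 := by
        rw [Nat.cast_sub Fintype.card_pos, Nat.cast_one]
      rw [← h2, ← h1]; push_cast; rfl
    have h3 : (H.index : ℝ) ≤ e := by exact_mod_cast hH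
    have h4 : (0 : ℝ) ≤ Nat.card H := by positivity
    rw [div_le_div_iff₀ (by positivity) (by positivity)]
    have h5 : q ≤ 2 * (e * Nat.card H) := by nlinarith
    nlinarith
  have h1 : ∑ x ∈ bad, (y / (4 * e)) ^ 2 ≤ q * y := by
    refine le_trans ?_ hv
    refine le_trans (sum_le_sum fun x hx => ?_)
      (sum_le_sum_of_subset_of_nonneg (subset_univ bad) fun _ _ _ => sq_nonneg _)
    rw [hbad, mem_filter] at hx
    have h2 : y / (2 * e) = 2 * (y / (4 * e)) := by field_simp; norm_num
    have h3 : 0 < y / (4 * e) := by positivity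
    rw [← neg_sq ((cosetDegree H Y c x : ℝ) - _)]
    exact pow_le_pow_left₀ h3.le (by linarith [hx.2]) 2
  rw [sum_const, nsmul_eq_mul, div_pow, ← mul_div_assoc, div_le_iff₀ (by positivity)] at h1
  have h2 : (bad.card * y) * y ≤ (16 * e ^ 2 * q) * y := by nlinarith
  exact le_of_mul_le_mul_right h2 hy0

end FieldDesign

/-- In a large finite field, points with prescribed cosets of differences can be chosen from
prescribed dense sets. -/
theorem exists_prescribed_differences (e : ℕ) (he : 1 ≤ e) (j : ℕ) :
    ∀ ε : ℝ, 0 < ε → ∃ q₀ : ℝ, ∀ (F : Type) [Field F] [Fintype F], q₀ ≤ Fintype.card F →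
      ∀ H : Subgroup Fˣ, H.index ≤ e → ∀ Y : ℕ → Finset F,
        (∀ i < j, ε * Fintype.card F ≤ (Y i).card) → ∀ c : ℕ → ℕ → Fˣ ⧸ H,
          ∃ a : ℕ → F, (∀ i < j, a i ∈ Y i) ∧
            ∀ i l, i < l → l < j → InCoset H (c i l) (a l - a i) := by
  classical
  induction j with
  | zero => exact fun ε _ => ⟨0, fun F _ _ _ H _ Y _ c => ⟨fun _ => 0, by simp, by simp⟩⟩
  | succ j ih =>
    intro ε hε
    have heR : (1 : ℝ) ≤ e := by exact_mod_cast he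
    obtain ⟨q₁, hq₁⟩ := ih (ε / (4 * e)) (by positivity)
    refine ⟨max q₁ (j * (16 * e ^ 2 / ε) / ε + 1), fun F _ _ hF H hH Y hY c => ?_⟩
    have hF1 := (le_max_left _ _).trans hF
    have hF2 := (le_max_right _ _).trans hF
    set q : ℝ := ((Fintype.card F : ℕ) : ℝ) with hq
    have hq0 : 0 < q := by rw [hq]; exact_mod_cast Fintype.card_pos (α := F)
    let bad : ℕ → Finset F := fun i => univ.filter fun x : F =>
      (cosetDegree H (Y (i + 1)) (c 0 (i + 1)) x : ℝ) < (Y (i + 1)).card / (4 * e)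
    have hbad : ∀ i < j, ((bad i).card : ℝ) ≤ 16 * e ^ 2 / ε := by
      intro i hi
      have h1 := card_small_cosetDegree_mul_le H he hH (Y (i + 1)) (c 0 (i + 1))
      have h2 := hY (i + 1) (by omega)
      rw [le_div_iff₀ hε]
      have h3 : ((bad i).card : ℝ) * (ε * q) ≤ 16 * e ^ 2 * q :=
        (mul_le_mul_of_nonneg_left h2 (by positivity)).trans h1
      have h4 : ((bad i).card * ε) * q ≤ (16 * e ^ 2) * q := by linarith
      exact le_of_mul_le_mul_right h4 hq0
    have hex : ∃ x ∈ Y 0, x ∉ (range j).biUnion bad := by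
      by_contra! hcon
      have h1 : (Y 0).card ≤ ∑ i ∈ range j, (bad i).card :=
        (card_le_card hcon).trans card_biUnion_le
      have h2 : ((Y 0).card : ℝ) ≤ ∑ i ∈ range j, ((bad i).card : ℝ) := by exact_mod_cast h1
      have h3 : ∑ i ∈ range j, ((bad i).card : ℝ) ≤ j * (16 * e ^ 2 / ε) := by
        refine (sum_le_sum fun i hi => hbad i (mem_range.1 hi)).trans ?_
        rw [sum_const, card_range, nsmul_eq_mul]
      have h4 := hY 0 (by omega)
      have h5 : j * (16 * e ^ 2 / ε) < ε * q := by
        rw [← div_lt_iff₀' hε]; linarith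
      linarith
    obtain ⟨x, hxY, hx⟩ := hex
    obtain ⟨a, haY, ha⟩ := hq₁ F hF1 H hH
      (fun i => (Y (i + 1)).filter fun y => InCoset H (c 0 (i + 1)) (y - x))
      (fun i hi => by
        have h1 : ¬ (cosetDegree H (Y (i + 1)) (c 0 (i + 1)) x : ℝ)
            < (Y (i + 1)).card / (4 * e) := fun h =>
          hx (mem_biUnion.2 ⟨i, mem_range.2 hi, mem_filter.2 ⟨mem_univ _, h⟩⟩)
        rw [not_lt, cosetDegree] at h1
        refine le_trans ?_ h1
        rw [div_mul_eq_mul_div]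
        gcongr
        exact hY (i + 1) (by omega))
      (fun i l => c (i + 1) (l + 1))
    refine ⟨fun i => Nat.casesOn i x a, ?_, ?_⟩
    · rintro (_ | i) hi
      · exact hxY
      · exact (mem_filter.1 (haY i (by omega))).1
    · rintro (_ | i) (_ | l) hil hl
      · omega
      · exact (mem_filter.1 (haY l (by omega))).2
      · omega
      · exact ha i l (by omega) (by omega)

theorem exists_subgroup_index_neg_one_mem {F : Type} [Field F] [Fintype F] {e : ℕ} (he : 1 ≤ e)
    (hdvd : 2 * e ∣ Fintype.card F - 1) :
    ∃ H : Subgroup Fˣ, H.index = e ∧ (-1 : Fˣ) ∈ H := by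
  classical
  obtain ⟨g, hg⟩ := IsCyclic.exists_generator (α := Fˣ)
  have hcard : Nat.card Fˣ = Fintype.card F - 1 := by
    rw [Nat.card_eq_fintype_card, Fintype.card_units]
  have hord : orderOf g = Fintype.card F - 1 := by
    rw [orderOf_eq_card_of_forall_mem_zpowers hg, hcard]
  have hed : e ∣ orderOf g := hord ▸ (Dvd.intro_left 2 rfl).trans hdvd
  refine ⟨Subgroup.zpowers (g ^ e), ?_, ?_⟩
  · have h1 := (Subgroup.zpowers (g ^ e)).index_mul_card
    rw [Nat.card_zpowers, orderOf_pow_of_dvd (by omega) hed, hcard, ← hord] at h1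
    have h2 : 0 < orderOf g := orderOf_pos g
    obtain ⟨c, hc⟩ := hed
    rw [hc, Nat.mul_div_cancel_left _ (by omega)] at h1
    exact Nat.eq_of_mul_eq_mul_right (Nat.pos_of_ne_zero fun h => by simp [hc, h] at h2) h1
  · obtain ⟨n, hn⟩ := Subgroup.mem_zpowers_iff.1 (hg (-1))
    have h1 : g ^ (2 * n) = 1 := by rw [mul_comm, zpow_mul, hn]; simp
    have h2 : ((orderOf g : ℕ) : ℤ) ∣ 2 * n := orderOf_dvd_iff_zpow_eq_one.2 h1
    have h3 : ((2 * e : ℕ) : ℤ) ∣ 2 * n :=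
      (Int.natCast_dvd_natCast.2 (hord ▸ hdvd)).trans h2
    push_cast at h3
    obtain ⟨m, rfl⟩ := (mul_dvd_mul_iff_left (by norm_num : (2 : ℤ) ≠ 0)).1 h3
    exact Subgroup.mem_zpowers_iff.2 ⟨m, by rw [← hn, zpow_mul, zpow_natCast]⟩

/-- A large finite field with `q ≡ 1 [MOD k (k - 1)]` elements carries a full Steiner system. -/
theorem exists_isFullSteiner_field (k : ℕ) (hk : 3 ≤ k) :
    ∃ q₀ : ℕ, ∀ (F : Type) [Field F] [Fintype F] [DecidableEq F], q₀ ≤ Fintype.card F →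
      k * (k - 1) ∣ Fintype.card F - 1 → ∃ S : Finset (Finset F), IsFullSteiner k S := by
  classical
  let D := (range k).sigma fun l => range l
  have hDk : 2 * D.card = k * (k - 1) := by
    have : D.card = ∑ l ∈ range k, l := by simp [D]
    rw [this, mul_comm, sum_range_id_mul_two]
  set e := D.card with he
  have hk6 : 6 ≤ k * (k - 1) := Nat.mul_le_mul hk (by omega : 2 ≤ k - 1)
  have he1 : 1 ≤ e := by omega
  obtain ⟨q₁, hq₁⟩ := exists_prescribed_differences e he1 k 1 one_pos
  refine ⟨⌈q₁⌉₊, fun F _ _ _ hF hdvd => ?_⟩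
  rw [← hDk] at hdvd
  obtain ⟨H, hHi, hH1⟩ := exists_subgroup_index_neg_one_mem he1 hdvd
  have htwo : (1 : F) + 1 ≠ 0 := by
    intro h2
    have hch : ringChar F = 2 := by
      have h3 : ringChar F ∣ 2 := ringChar.dvd (by push_cast; rw [← h2]; norm_num)
      rcases (Nat.dvd_prime Nat.prime_two).1 h3 with h4 | h4
      · exact absurd h4 (CharP.ringChar_ne_one)
      · exact h4
    have heven := FiniteField.even_card_of_char_two hch
    have hpos := Fintype.one_lt_card (α := F)
    obtain ⟨m, hm⟩ := hdvd
    have : (Fintype.card F - 1) % 2 = 0 := by rw [hm, mul_assoc]; omega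
    omega
  have hcardQ : Fintype.card D = Fintype.card (Fˣ ⧸ H) := by
    rw [Fintype.card_coe, ← Nat.card_eq_fintype_card (α := Fˣ ⧸ H)]
    exact hHi.symm
  let φ : D ≃ Fˣ ⧸ H := Fintype.equivOfCardEq hcardQ
  let c : ℕ → ℕ → Fˣ ⧸ H := fun i l => if h : (⟨l, i⟩ : (_ : ℕ) × ℕ) ∈ D then φ ⟨_, h⟩ else 1
  have hmemD : ∀ i l, i < l → l < k → (⟨l, i⟩ : (_ : ℕ) × ℕ) ∈ D := fun i l hil hl => by
    simp [D, hil, hl]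
  have hcinj : ∀ i l i' l', i < l → l < k → i' < l' → l' < k → c i l = c i' l' →
      i = i' ∧ l = l' := by
    intro i l i' l' h1 h2 h3 h4 h5
    simp only [c, dif_pos (hmemD i l h1 h2), dif_pos (hmemD i' l' h3 h4)] at h5
    have h6 := congrArg Subtype.val (φ.injective h5)
    simp only [Sigma.mk.injEq, heq_eq_eq] at h6
    exact ⟨h6.2, h6.1⟩
  have hcsurj : ∀ d, ∃ i l, i < l ∧ l < k ∧ c i l = d := by
    intro d
    obtain ⟨⟨⟨l, i⟩, h⟩, hd⟩ := φ.surjective d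
    have h' := h
    simp only [D, mem_sigma, mem_range] at h'
    exact ⟨i, l, h'.2, h'.1, by simp only [c, dif_pos h, hd]⟩
  obtain ⟨a, -, ha⟩ := hq₁ F ((Nat.le_ceil _).trans (by exact_mod_cast hF)) H hHi.le
    (fun _ => univ) (fun i _ => by simp) c
  have hainj : ∀ i l, i < k → l < k → a i = a l → i = l := by
    intro i l hi hl h
    rcases lt_trichotomy i l with h1 | h1 | h1
    · exact absurd (sub_eq_zero.2 h.symm) (ha i l h1 hl).ne_zero
    · exact h1
    · exact absurd (sub_eq_zero.2 h) (ha l i h1 hi).ne_zero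
  -- Choose one unit out of every pair `h, -h` of elements of `H`.
  let ν : Fˣ → ℕ := fun u => Fintype.equivFin Fˣ u
  have hν : ∀ u : Fˣ, ν u ≠ ν (-u) := by
    intro u h
    have h1 : u = -u := (Fintype.equivFin Fˣ).injective (Fin.ext h)
    have h2 : (u : F) = -u := by
      have := congrArg Units.val h1
      simpa using this
    have h3 : (u : F) * (1 + 1) = 0 := by linear_combination h2
    exact (mul_ne_zero u.ne_zero htwo) h3
  let R : Finset Fˣ := univ.filter fun u => u ∈ H ∧ ν u < ν (-u)
  have hRH : ∀ u ∈ R, u ∈ H := fun u hu => (mem_filter.1 hu).2.1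
  have hnegH : ∀ u : Fˣ, u ∈ H → -u ∈ H := fun u hu => by
    rw [← neg_one_mul]; exact H.mul_mem hH1 hu
  have hR1 : ∀ u ∈ H, u ∈ R ∨ -u ∈ R := by
    intro u hu
    simp only [R, mem_filter, mem_univ, true_and, neg_neg]
    rcases lt_or_gt_of_ne (hν u) with h | h
    · exact Or.inl ⟨hu, h⟩
    · exact Or.inr ⟨hnegH u hu, h⟩
  have hR2 : ∀ u, u ∈ R → -u ∈ R → False := by
    intro u hu hu'
    simp only [R, mem_filter, mem_univ, true_and, neg_neg] at hu hu'
    omega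
  let B : F × Fˣ → Finset F := fun p => (range k).image fun i => p.1 + p.2 * a i
  have hBmem : ∀ p z, z ∈ B p ↔ ∃ i < k, p.1 + p.2 * a i = z := by
    intro p z; simp [B]
  refine ⟨(univ ×ˢ R).image B, isFullSteiner_iff.2 ⟨?_, ?_⟩⟩
  · intro b hb
    obtain ⟨p, -, rfl⟩ := mem_image.1 hb
    rw [card_image_of_injOn, card_range]
    intro i hi l hl h
    have h1 := mul_left_cancel₀ p.2.ne_zero (add_left_cancel h)
    exact hainj i l (mem_range.1 hi) (mem_range.1 hl) h1
  · intro u v huv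
    have hd0 : v - u ≠ 0 := sub_ne_zero.2 huv.symm
    obtain ⟨i, l, hil, hl, hc⟩ := hcsurj ((Units.mk0 _ hd0 : Fˣ) : Fˣ ⧸ H)
    obtain ⟨w, hw, hwc⟩ := ha i l hil hl
    -- The scaling factor.
    obtain ⟨h, hhH, hh⟩ : ∃ h : Fˣ, h ∈ H ∧ (h : F) * (a l - a i) = v - u := by
      refine ⟨w⁻¹ * Units.mk0 _ hd0, QuotientGroup.eq.1 (hwc.trans hc), ?_⟩
      rw [← hw]; simp [mul_comm]
    -- Any two differences in blocks agreeing up to `H` come from the same pair.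
    have huniq : ∀ i' l', i' < l' → l' < k → ∀ h' : Fˣ, h' ∈ H →
        (h' : F) * (a l' - a i') = v - u → i' = i ∧ l' = l ∧ h' = h := by
      intro i' l' hil' hl' h' hh'H hh'
      obtain ⟨w', hw', hwc'⟩ := ha i' l' hil' hl'
      have h1 : h' * w' = h * w := Units.ext (by push_cast; rw [hw, hw', hh, hh'])
      have h2 : c i' l' = c i l := by
        rw [← hwc, ← hwc', QuotientGroup.eq]
        have : w'⁻¹ * w = h' * h⁻¹ := by
          rw [inv_mul_eq_iff_eq_mul, ← mul_assoc, eq_mul_inv_iff_mul_eq, mul_comm w' h', h1,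
            mul_comm]
        rw [this]
        exact H.mul_mem hh'H (H.inv_mem hhH)
      obtain ⟨rfl, rfl⟩ := hcinj _ _ _ _ hil' hl' hil hl h2
      refine ⟨rfl, rfl, ?_⟩
      have h3 : w' = w := Units.ext (hw'.trans hw.symm)
      rw [h3] at h1
      exact mul_right_cancel h1
    have hblocks : ∀ p : F × Fˣ, p.2 ∈ R → u ∈ B p → v ∈ B p →
        (p.2 = h ∧ p.1 = u - h * a i) ∨ (p.2 = -h ∧ p.1 = u + h * a l) := by
      rintro ⟨x, r⟩ hr hu hv
      obtain ⟨s, hs, hsu⟩ := (hBmem _ _).1 hu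
      obtain ⟨t, ht, htv⟩ := (hBmem _ _).1 hv
      simp only at hr hsu htv ⊢
      rcases lt_trichotomy s t with hst | hst | hst
      · left
        obtain ⟨rfl, rfl, rfl⟩ := huniq s t hst ht r (hRH r hr)
          (by rw [← hsu, ← htv]; ring)
        exact ⟨rfl, by rw [← hsu]; ring⟩
      · exact absurd (by rw [← hsu, ← htv, hst]) huv
      · right
        obtain ⟨rfl, rfl, h1⟩ := huniq t s hst hs (-r) (hnegH r (hRH r hr))
          (by rw [← hsu, ← htv]; push_cast; ring)
        refine ⟨by rw [← h1, neg_neg], by rw [← h1, ← hsu]; push_cast; ring⟩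
    rcases hR1 h hhH with hhR | hhR
    · refine ⟨B (u - h * a i, h), ⟨mem_image.2 ⟨_, by simp [hhR], rfl⟩, (hBmem _ _).2
        ⟨i, by omega, by ring⟩, (hBmem _ _).2 ⟨l, hl, by linear_combination hh⟩⟩, ?_⟩
      rintro b ⟨hb, hub, hvb⟩
      obtain ⟨p, hp, rfl⟩ := mem_image.1 hb
      have hpR := (mem_product.1 hp).2
      rcases hblocks p hpR hub hvb with ⟨h1, h2⟩ | ⟨h1, h2⟩
      · congr 1; exact Prod.ext h2 h1
      · exact (hR2 h hhR (h1 ▸ hpR)).elim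
    · refine ⟨B (u + h * a l, -h), ⟨mem_image.2 ⟨_, by simp [hhR], rfl⟩, (hBmem _ _).2
        ⟨l, hl, by push_cast; ring⟩, (hBmem _ _).2
        ⟨i, by omega, by push_cast; linear_combination hh⟩⟩, ?_⟩
      rintro b ⟨hb, hub, hvb⟩
      obtain ⟨p, hp, rfl⟩ := mem_image.1 hb
      have hpR := (mem_product.1 hp).2
      rcases hblocks p hpR hub hvb with ⟨h1, h2⟩ | ⟨h1, h2⟩
      · exact (hR2 h (h1 ▸ hpR) hhR).elim
      · congr 1; exact Prod.ext h2 h1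

theorem exists_perm_map_eq [Fintype V] {A A' : Finset V} (h : A'.card = A.card) :
    ∃ τ : Equiv.Perm V, A'.map τ.toEmbedding = A := by
  let e : {x // x ∈ A'} ≃ {x // x ∈ A} := Finset.equivOfCardEq h
  refine ⟨e.extendSubtype, eq_of_subset_of_card_le ?_ (by rw [card_map, h])⟩
  intro y hy
  obtain ⟨x, hx, rfl⟩ := mem_map.1 hy
  exact e.extendSubtype_mem x hx

/-- The number of permutations moving `A` into `X`. -/
theorem card_perm_map_subset_mul_choose [Fintype V] (A X : Finset V) :
    (univ.filter fun σ : Equiv.Perm V => A.map σ.toEmbedding ⊆ X).card *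
        (Fintype.card V).choose A.card =
      (Fintype.card V).factorial * X.card.choose A.card := by
  have hsymm : ∀ A' ∈ powersetCard A.card (univ : Finset V),
      (univ.filter fun σ : Equiv.Perm V => A'.map σ.toEmbedding ⊆ X).card =
        (univ.filter fun σ : Equiv.Perm V => A.map σ.toEmbedding ⊆ X).card := by
    intro A' hA'
    obtain ⟨τ, hτ⟩ := exists_perm_map_eq (mem_powersetCard.1 hA').2
    refine (card_equiv (Equiv.mulRight τ) fun σ => ?_).symm
    simp only [mem_filter, mem_univ, true_and, Equiv.coe_mulRight]
    rw [← hτ, map_map]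
    rfl
  have hdouble := sum_card_bipartiteAbove_eq_sum_card_bipartiteBelow
    (s := (univ : Finset (Equiv.Perm V))) (t := powersetCard A.card (univ : Finset V))
    (fun σ A' => A'.map σ.toEmbedding ⊆ X)
  simp only [bipartiteAbove, bipartiteBelow] at hdouble
  rw [sum_congr rfl hsymm, sum_const, card_powersetCard, card_univ, smul_eq_mul] at hdouble
  rw [mul_comm, ← hdouble, ← Fintype.card_perm, ← card_univ, ← smul_eq_mul, ← sum_const]
  refine sum_congr rfl fun σ _ => ?_
  rw [← card_powersetCard]
  refine (card_bij (fun A' _ => A'.map σ.toEmbedding) ?_ ?_ ?_)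
  · intro A' hA'
    simp only [mem_filter, mem_powersetCard, subset_univ, true_and, card_map] at hA' ⊢
    exact ⟨hA'.2, hA'.1⟩
  · intro _ _ _ _ h
    exact map_injective _ h
  · intro Y hY
    rw [mem_powersetCard] at hY
    have hmap : (Y.map σ.symm.toEmbedding).map σ.toEmbedding = Y := by
      rw [map_map]
      ext y
      simp
    refine ⟨Y.map σ.symm.toEmbedding, ?_, hmap⟩
    simp only [mem_filter, mem_powersetCard, subset_univ, true_and, card_map]
    exact ⟨hY.2, by rw [hmap]; exact hY.1⟩

theorem card_perm_map_subset_le [Fintype V] (A X : Finset V) (hA : 2 * A.card ≤ Fintype.card V)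
    (hV : 0 < Fintype.card V) :
    ((univ.filter fun σ : Equiv.Perm V => A.map σ.toEmbedding ⊆ X).card : ℝ) ≤
      (Fintype.card V).factorial * (2 * X.card / Fintype.card V) ^ A.card := by
  have h := card_perm_map_subset_mul_choose A X
  have h1 : (univ.filter fun σ : Equiv.Perm V => A.map σ.toEmbedding ⊆ X).card *
        (Fintype.card V).descFactorial A.card =
      (Fintype.card V).factorial * X.card.descFactorial A.card := by
    rw [Nat.descFactorial_eq_factorial_mul_choose, Nat.descFactorial_eq_factorial_mul_choose,
      mul_left_comm, h, mul_left_comm]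
  have h2 : X.card.descFactorial A.card ≤ X.card ^ A.card := Nat.descFactorial_le_pow _ _
  have h3 : (Fintype.card V / 2 : ℝ) ^ A.card ≤ (Fintype.card V).descFactorial A.card := by
    refine le_trans ?_ (Nat.cast_le.2 (Nat.pow_sub_le_descFactorial _ _))
    push_cast
    gcongr
    rw [Nat.cast_sub (by omega)]
    have : (2 * A.card : ℝ) ≤ Fintype.card V := by exact_mod_cast hA
    push_cast
    linarith
  have hV' : (0 : ℝ) < Fintype.card V := by exact_mod_cast hV
  have h1' : ((univ.filter fun σ : Equiv.Perm V => A.map σ.toEmbedding ⊆ X).card : ℝ) *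
        (Fintype.card V).descFactorial A.card =
      (Fintype.card V).factorial * X.card.descFactorial A.card := by exact_mod_cast h1
  have h2' : (X.card.descFactorial A.card : ℝ) ≤ (X.card : ℝ) ^ A.card := by exact_mod_cast h2
  have hpos : (0 : ℝ) < (Fintype.card V / 2 : ℝ) ^ A.card := by positivity
  have h4 : ((univ.filter fun σ : Equiv.Perm V => A.map σ.toEmbedding ⊆ X).card : ℝ) *
      (Fintype.card V / 2 : ℝ) ^ A.card ≤ (Fintype.card V).factorial * (X.card : ℝ) ^ A.card := by
    calc _ ≤ ((univ.filter fun σ : Equiv.Perm V => A.map σ.toEmbedding ⊆ X).card : ℝ) *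
          (Fintype.card V).descFactorial A.card := by gcongr
      _ = _ := h1'
      _ ≤ _ := by gcongr
  calc _ ≤ (Fintype.card V).factorial * (X.card : ℝ) ^ A.card /
        (Fintype.card V / 2 : ℝ) ^ A.card := by rwa [le_div_iff₀ hpos]
    _ = _ := by
      rw [mul_div_assoc, ← div_pow]
      congr 2
      field_simp

theorem le_card_perm_map_subset [Fintype V] (A X : Finset V) (hA : 2 * A.card ≤ X.card)
    (hV : 0 < Fintype.card V) :
    (Fintype.card V).factorial * ((X.card : ℝ) / (2 * Fintype.card V)) ^ A.card ≤
      ((univ.filter fun σ : Equiv.Perm V => A.map σ.toEmbedding ⊆ X).card : ℝ) := by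
  have h := card_perm_map_subset_mul_choose A X
  have h1 : (univ.filter fun σ : Equiv.Perm V => A.map σ.toEmbedding ⊆ X).card *
        (Fintype.card V).descFactorial A.card =
      (Fintype.card V).factorial * X.card.descFactorial A.card := by
    rw [Nat.descFactorial_eq_factorial_mul_choose, Nat.descFactorial_eq_factorial_mul_choose,
      mul_left_comm, h, mul_left_comm]
  have h2 : (Fintype.card V).descFactorial A.card ≤ Fintype.card V ^ A.card :=
    Nat.descFactorial_le_pow _ _
  have h3 : (X.card / 2 : ℝ) ^ A.card ≤ X.card.descFactorial A.card := by
    refine le_trans ?_ (Nat.cast_le.2 (Nat.pow_sub_le_descFactorial _ _))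
    push_cast
    gcongr
    rw [Nat.cast_sub (by omega)]
    have : (2 * A.card : ℝ) ≤ X.card := by exact_mod_cast hA
    push_cast
    linarith
  have hV' : (0 : ℝ) < Fintype.card V := by exact_mod_cast hV
  have h1' : ((univ.filter fun σ : Equiv.Perm V => A.map σ.toEmbedding ⊆ X).card : ℝ) *
        (Fintype.card V).descFactorial A.card =
      (Fintype.card V).factorial * X.card.descFactorial A.card := by exact_mod_cast h1
  have h2' : ((Fintype.card V).descFactorial A.card : ℝ) ≤ (Fintype.card V : ℝ) ^ A.card := by
    exact_mod_cast h2
  have hpos : (0 : ℝ) < (Fintype.card V : ℝ) ^ A.card := by positivity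
  have h4 : (Fintype.card V).factorial * (X.card / 2 : ℝ) ^ A.card ≤
      ((univ.filter fun σ : Equiv.Perm V => A.map σ.toEmbedding ⊆ X).card : ℝ) *
        (Fintype.card V : ℝ) ^ A.card := by
    calc _ ≤ ((Fintype.card V).factorial : ℝ) * X.card.descFactorial A.card := by gcongr
      _ = _ := h1'.symm
      _ ≤ _ := by gcongr
  calc _ = (Fintype.card V).factorial * (X.card / 2 : ℝ) ^ A.card /
        (Fintype.card V : ℝ) ^ A.card := by
        rw [mul_div_assoc, ← div_pow]
        congr 2
        field_simp
    _ ≤ _ := by rwa [div_le_iff₀ hpos]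

theorem IsFullSteiner.card_mul [Fintype V] {k : ℕ} {S : Finset (Finset V)}
    (hS : IsFullSteiner k S) :
    S.card * (k * (k - 1)) = Fintype.card V * (Fintype.card V - 1) := by
  rw [isFullSteiner_iff] at hS
  have h : S.card * (k * (k - 1)) = ∑ e ∈ S, e.offDiag.card := by
    rw [card_eq_sum_ones, sum_mul]
    refine sum_congr rfl fun e he => ?_
    rw [offDiag_card, hS.1 e he, one_mul, Nat.mul_sub_one]
  rw [h, ← card_biUnion]
  · have h2 : S.biUnion (fun e => e.offDiag) = univ.offDiag := by
      ext ⟨x, y⟩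
      simp only [mem_biUnion, mem_offDiag, mem_univ, true_and]
      refine ⟨fun ⟨e, _, h⟩ => h.2.2, fun hxy => ?_⟩
      obtain ⟨e, he, -⟩ := hS.2 x y hxy
      exact ⟨e, he.1, he.2.1, he.2.2, hxy⟩
    rw [h2, offDiag_card, card_univ, Nat.mul_sub_one]
  · intro e he f hf hne
    rw [Function.onFun, disjoint_left]
    rintro ⟨x, y⟩ h1 h2
    rw [mem_offDiag] at h1 h2
    exact hne ((hS.2 x y h1.2.2).unique ⟨he, h1.1, h1.2.1⟩ ⟨hf, h2.1, h2.2.1⟩)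

theorem sum_card_perm_map_union_le [Fintype V] {k : ℕ} (hk : 3 ≤ k) {S : Finset (Finset V)}
    (hS : IsFullSteiner k S) (X : Finset V) (hV : 4 * k ≤ Fintype.card V) :
    (∑ p ∈ S.offDiag, ((univ.filter fun σ : Equiv.Perm V =>
        (p.1 ∪ p.2).map σ.toEmbedding ⊆ X).card : ℝ)) ≤
      (Fintype.card V).factorial * S.card *
        (S.card * (2 * X.card / Fintype.card V : ℝ) ^ (2 * k) +
          k * Fintype.card V * (2 * X.card / Fintype.card V : ℝ) ^ (2 * k - 1)) := by
  set y : ℝ := 2 * X.card / Fintype.card V with hy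
  have hy0 : 0 ≤ y := by positivity
  have hinter : ∀ p ∈ S.offDiag, (p.1 ∪ p.2).card =
      if Disjoint p.1 p.2 then 2 * k else 2 * k - 1 := by
    rintro ⟨e, f⟩ hp
    obtain ⟨he, hf, hne⟩ := mem_offDiag.1 hp
    have h1 : (e ∩ f).card ≤ 1 := hS.card_inter_le he hf hne
    have h2 := card_union_add_card_inter e f
    rw [hS.1 e he, hS.1 f hf] at h2
    split_ifs with hd
    · rw [disjoint_iff_inter_eq_empty] at hd
      simp only at hd ⊢
      rw [hd, card_empty] at h2
      omega
    · have h3 : (e ∩ f).Nonempty := not_disjoint_iff_nonempty_inter.1 hd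
      have h4 : 0 < (e ∩ f).card := card_pos.2 h3
      simp only
      omega
  have hbound : ∀ p ∈ S.offDiag, ((univ.filter fun σ : Equiv.Perm V =>
        (p.1 ∪ p.2).map σ.toEmbedding ⊆ X).card : ℝ) ≤
      (Fintype.card V).factorial * y ^ (2 * k) +
        if Disjoint p.1 p.2 then 0 else (Fintype.card V).factorial * y ^ (2 * k - 1) := by
    intro p hp
    have hc := hinter p hp
    have h1 := card_perm_map_subset_le (p.1 ∪ p.2) X
      (by rw [hc]; split_ifs <;> omega) (by omega)
    rw [hc, ← hy] at h1
    refine h1.trans ?_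
    split_ifs
    · simp
    · have : 0 ≤ (Fintype.card V).factorial * y ^ (2 * k) := by positivity
      linarith
  have hnd : ((S.offDiag.filter fun p => ¬ Disjoint p.1 p.2).card : ℝ) ≤
      S.card * (k * Fintype.card V) := by
    have h1 : (S.offDiag.filter fun p => ¬ Disjoint p.1 p.2) ⊆
        S.biUnion fun e => e.biUnion fun v => (S.filter fun f => v ∈ f).image fun f => (e, f) := by
      rintro ⟨e, f⟩ hp
      rw [mem_filter, mem_offDiag] at hp
      obtain ⟨v, hve, hvf⟩ := not_disjoint_iff.1 hp.2
      simp only [mem_biUnion, mem_image, mem_filter]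
      exact ⟨e, hp.1.1, v, hve, f, ⟨hp.1.2.1, hvf⟩, rfl⟩
    have h2 : (S.offDiag.filter fun p => ¬ Disjoint p.1 p.2).card ≤
        S.card * (k * Fintype.card V) := by
      refine (card_le_card h1).trans (card_biUnion_le_card_mul _ _ _ fun e he => ?_)
      rw [← hS.1 e he]
      refine card_biUnion_le_card_mul _ _ _ fun v _ => card_image_le.trans ?_
      exact card_edges_through_le (by omega) hS v
    exact_mod_cast h2
  have hoff : (S.offDiag.card : ℝ) ≤ S.card * S.card := by
    have : S.offDiag.card ≤ S.card * S.card := by rw [offDiag_card]; omega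
    exact_mod_cast this
  refine (sum_le_sum hbound).trans ?_
  rw [sum_add_distrib, sum_const, nsmul_eq_mul, sum_ite, sum_const_zero, zero_add, sum_const,
    nsmul_eq_mul]
  calc _ ≤ (S.card * S.card : ℝ) * ((Fintype.card V).factorial * y ^ (2 * k)) +
        S.card * (k * Fintype.card V) * ((Fintype.card V).factorial * y ^ (2 * k - 1)) := by
        gcongr
    _ = _ := by ring

/-- A random copy of a Steiner system is unlikely to have a given large set independent. -/
theorem card_perm_avoid_le [Fintype V] {k : ℕ} (hk : 3 ≤ k) {S : Finset (Finset V)}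
    (hS : IsFullSteiner k S) {x : ℕ} (hx : 2 * k ≤ x) (hV : 4 * k ≤ Fintype.card V)
    (hcond : 2 * (k + 1) * 8 ^ k * (x : ℝ) ^ k ≤ (Fintype.card V : ℝ) ^ (k - 2))
    (X : Finset V) (hX : x ≤ X.card) :
    ((univ.filter fun σ : Equiv.Perm V => ∀ e ∈ S, ¬ e.map σ.toEmbedding ⊆ X).card : ℝ) ≤
      (Fintype.card V).factorial *
        (1 - (x : ℝ) ^ k / (4 * k ^ 2 * 2 ^ k * (Fintype.card V : ℝ) ^ (k - 2))) := by
  obtain ⟨X', hX'X, hX'⟩ := exists_subset_card_eq hX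
  refine le_trans (Nat.cast_le.2 (card_le_card (t := univ.filter fun σ : Equiv.Perm V =>
    ∀ e ∈ S, ¬ e.map σ.toEmbedding ⊆ X') fun σ hσ => ?_)) ?_
  · simp only [mem_filter, mem_univ, true_and] at hσ ⊢
    exact fun e he h => hσ e he (h.trans hX'X)
  clear hX hX'X X
  set q : ℝ := ((Fintype.card V : ℕ) : ℝ) with hq
  have hkR : (3 : ℝ) ≤ k := by exact_mod_cast hk
  have hqk : 4 * (k : ℝ) ≤ q := by rw [hq]; exact_mod_cast hV
  have hq0 : 0 < q := by linarith
  have hx0 : (0 : ℝ) < x := by exact_mod_cast (by omega : 0 < x)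
  have hx1 : (1 : ℝ) ≤ x := by exact_mod_cast (by omega : 1 ≤ x)
  set f : ℝ := ((Fintype.card V).factorial : ℝ) with hf
  have hf0 : 0 < f := by rw [hf]; exact_mod_cast Nat.factorial_pos _
  set y : ℝ := 2 * x / q with hy
  have hy0 : 0 < y := by positivity
  have hunion := sum_card_perm_map_union_le hk hS X' hV
  rw [← hq, ← hf, hX', ← hy] at hunion
  let E : Equiv.Perm V → Finset (Finset V) := fun σ => S.filter fun e => e.map σ.toEmbedding ⊆ X'
  have hE : ∑ σ, (E σ).card =
      ∑ e ∈ S, (univ.filter fun σ : Equiv.Perm V => e.map σ.toEmbedding ⊆ X').card := by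
    have := sum_card_bipartiteAbove_eq_sum_card_bipartiteBelow
      (s := (univ : Finset (Equiv.Perm V))) (t := S) (fun σ e => e.map σ.toEmbedding ⊆ X')
    simpa only [bipartiteAbove, bipartiteBelow] using this
  have hE2 : ∑ σ, (E σ).offDiag.card = ∑ p ∈ S.offDiag,
      (univ.filter fun σ : Equiv.Perm V => (p.1 ∪ p.2).map σ.toEmbedding ⊆ X').card := by
    have := sum_card_bipartiteAbove_eq_sum_card_bipartiteBelow
      (s := (univ : Finset (Equiv.Perm V))) (t := S.offDiag)
      (fun σ p => (p.1 ∪ p.2).map σ.toEmbedding ⊆ X')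
    simp only [bipartiteAbove, bipartiteBelow] at this
    rw [← this]
    refine sum_congr rfl fun σ _ => congrArg card ?_
    ext ⟨e, e'⟩
    simp only [E, mem_offDiag, mem_filter, map_union, union_subset_iff]
    tauto
  have hpoint : ∀ σ, (E σ).card ≤ (if (E σ).Nonempty then 1 else 0) + (E σ).offDiag.card := by
    intro σ
    rw [offDiag_card]
    split_ifs with h
    · obtain ⟨n, hn⟩ := Nat.exists_eq_succ_of_ne_zero (card_pos.2 h).ne'
      rw [hn, Nat.succ_eq_add_one]
      have : (n + 1) * (n + 1) = n * n + n + (n + 1) := by ring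
      rw [this, Nat.add_sub_cancel]
      have : 0 ≤ n * n := Nat.zero_le _
      omega
    · rw [not_nonempty_iff_eq_empty] at h
      simp [h]
  have hgood := sum_le_sum fun σ (_ : σ ∈ (univ : Finset (Equiv.Perm V))) => hpoint σ
  rw [sum_add_distrib, ← card_filter, hE, hE2] at hgood
  have hgoodR : (∑ e ∈ S, ((univ.filter fun σ : Equiv.Perm V =>
        e.map σ.toEmbedding ⊆ X').card : ℝ)) ≤
      ((univ.filter fun σ => (E σ).Nonempty).card : ℝ) + ∑ p ∈ S.offDiag,
        ((univ.filter fun σ : Equiv.Perm V =>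
          (p.1 ∪ p.2).map σ.toEmbedding ⊆ X').card : ℝ) := by exact_mod_cast hgood
  have hlow : (S.card : ℝ) * (f * (y / 4) ^ k) ≤ ∑ e ∈ S, ((univ.filter fun σ : Equiv.Perm V =>
        e.map σ.toEmbedding ⊆ X').card : ℝ) := by
    rw [← nsmul_eq_mul, ← sum_const]
    refine sum_le_sum fun e he => ?_
    have := le_card_perm_map_subset e X' (by rw [hS.1 e he, hX']; exact hx) (by omega)
    rw [hS.1 e he, hX', ← hq, ← hf] at this
    have hy4 : y / 4 = x / (2 * q) := by rw [hy]; field_simp; norm_num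
    rwa [hy4]
  have hcompl : ((univ.filter fun σ : Equiv.Perm V =>
      ∀ e ∈ S, ¬ e.map σ.toEmbedding ⊆ X').card : ℝ) +
      ((univ.filter fun σ => (E σ).Nonempty).card : ℝ) = f := by
    have h1 := card_filter_add_card_filter_not (s := (univ : Finset (Equiv.Perm V)))
      fun σ => (E σ).Nonempty
    have h2 : (univ.filter fun σ => ¬ (E σ).Nonempty) = (univ.filter fun σ : Equiv.Perm V =>
        ∀ e ∈ S, ¬ e.map σ.toEmbedding ⊆ X') := by
      ext σ
      simp [E, filter_eq_empty_iff]
    rw [h2, card_univ, Fintype.card_perm, add_comm] at h1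
    rw [hf]
    exact_mod_cast h1
  have hb := hS.card_mul
  have hbR : (S.card : ℝ) * (k * (k - 1)) = q * (q - 1) := by
    have h1 : ((k - 1 : ℕ) : ℝ) = k - 1 := by rw [Nat.cast_sub (by omega)]; simp
    have h2 : ((Fintype.card V - 1 : ℕ) : ℝ) = q - 1 := by
      rw [Nat.cast_sub (by omega)]; simp [hq]
    rw [← h1, ← h2, hq]
    exact_mod_cast hb
  have hS0 : (0 : ℝ) ≤ S.card := Nat.cast_nonneg _
  have hSle : (S.card : ℝ) ≤ q ^ 2 := by
    have : (1 : ℝ) ≤ k * (k - 1) := by nlinarith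
    nlinarith
  have hSge : q ^ 2 ≤ S.card * (2 * (k : ℝ) ^ 2) := by
    have h1 : q ^ 2 ≤ 2 * (q * (q - 1)) := by nlinarith
    rw [← hbR] at h1
    have h2 : (S.card : ℝ) * k ≥ 0 := by positivity
    nlinarith
  obtain ⟨j, rfl⟩ : ∃ j, k = j + 2 := ⟨k - 2, by omega⟩
  rw [Nat.add_sub_cancel] at hcond ⊢
  have hqj : 0 < q ^ j := by positivity
  have hsmall : (S.card : ℝ) * y ^ (j + 2) + (j + 2 : ℕ) * q * y ^ (j + 1) ≤
      (1 / 4) ^ (j + 2) / 2 := by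
    have e1 : (S.card : ℝ) * y ^ (j + 2) ≤ 2 ^ (j + 2) * (x : ℝ) ^ (j + 2) / q ^ j := by
      calc (S.card : ℝ) * y ^ (j + 2) ≤ q ^ 2 * y ^ (j + 2) := by gcongr
        _ = _ := by rw [hy, div_pow, mul_pow]; field_simp; ring
    have e2 : (j + 2 : ℕ) * q * y ^ (j + 1) ≤
        (j + 2 : ℕ) * (2 ^ (j + 2) * (x : ℝ) ^ (j + 2) / q ^ j) := by
      have e3 : q * y ^ (j + 1) = 2 ^ (j + 1) * (x : ℝ) ^ (j + 1) / q ^ j := by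
        rw [hy, div_pow, mul_pow]; field_simp; ring
      rw [mul_assoc, e3]
      gcongr <;> norm_num
    have e4 : 2 ^ (j + 2) * (x : ℝ) ^ (j + 2) / q ^ j * (((j + 2 : ℕ) : ℝ) + 1) ≤
        (1 / 4) ^ (j + 2) / 2 := by
      rw [div_mul_eq_mul_div, div_le_iff₀ hqj]
      have e5 : (8 : ℝ) ^ (j + 2) = 4 ^ (j + 2) * 2 ^ (j + 2) := by
        rw [← mul_pow]; norm_num
      rw [e5] at hcond
      have e6 : (1 / 4 : ℝ) ^ (j + 2) * 4 ^ (j + 2) = 1 := by rw [← mul_pow]; norm_num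
      have e7 := mul_le_mul_of_nonneg_left hcond
        (by positivity : (0 : ℝ) ≤ (1 / 4) ^ (j + 2) / 2)
      calc _ = ((1 / 4 : ℝ) ^ (j + 2) * 4 ^ (j + 2)) *
            (2 ^ (j + 2) * (x : ℝ) ^ (j + 2) * (((j + 2 : ℕ) : ℝ) + 1)) := by rw [e6, one_mul]
        _ = _ := by ring
        _ ≤ _ := e7
    nlinarith
  have hfinal : f * (S.card * (y / 4) ^ (j + 2)) / 2 ≤
      ((univ.filter fun σ => (E σ).Nonempty).card : ℝ) := by
    have h1 : (S.card : ℝ) * y ^ (2 * (j + 2)) + (j + 2 : ℕ) * q * y ^ (2 * (j + 2) - 1) =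
        y ^ (j + 2) * (S.card * y ^ (j + 2) + (j + 2 : ℕ) * q * y ^ (j + 1)) := by
      rw [show 2 * (j + 2) - 1 = (j + 2) + (j + 1) by omega,
        show 2 * (j + 2) = (j + 2) + (j + 2) by omega, pow_add, pow_add]
      ring
    have h2 : f * S.card * (y ^ (j + 2) *
        (S.card * y ^ (j + 2) + (j + 2 : ℕ) * q * y ^ (j + 1))) ≤
        f * S.card * (y ^ (j + 2) * ((1 / 4) ^ (j + 2) / 2)) := by gcongr
    rw [h1] at hunion
    have h3 : (y / 4) ^ (j + 2) = y ^ (j + 2) * (1 / 4) ^ (j + 2) := by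
      rw [← mul_pow]; ring
    rw [h3] at hlow ⊢
    linarith
  have hdelta : f * ((x : ℝ) ^ (j + 2) / (4 * ((j + 2 : ℕ) : ℝ) ^ 2 * 2 ^ (j + 2) * q ^ j)) ≤
      f * (S.card * (y / 4) ^ (j + 2)) / 2 := by
    have h1 : (y / 4) ^ (j + 2) = (x : ℝ) ^ (j + 2) / (2 ^ (j + 2) * q ^ (j + 2)) := by
      rw [hy, ← mul_pow, ← div_pow]; congr 1; field_simp; norm_num
    rw [mul_div_assoc]
    refine mul_le_mul_of_nonneg_left ?_ hf0.le
    rw [h1]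
    have h2 : (x : ℝ) ^ (j + 2) / (4 * ((j + 2 : ℕ) : ℝ) ^ 2 * 2 ^ (j + 2) * q ^ j) =
        q ^ 2 / (2 * ((j + 2 : ℕ) : ℝ) ^ 2) * ((x : ℝ) ^ (j + 2) /
          (2 ^ (j + 2) * q ^ (j + 2))) / 2 := by
      field_simp
      ring
    rw [h2]
    have h3 : q ^ 2 / (2 * ((j + 2 : ℕ) : ℝ) ^ 2) ≤ S.card := by
      rw [div_le_iff₀ (by positivity)]; exact hSge
    gcongr
  rw [mul_sub, mul_one]
  linarith

theorem IsFullSteiner.existsUnique_mem_image {U : Type*} [DecidableEq U] {k : ℕ}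
    {S : Finset (Finset U)} (hS : IsFullSteiner k S) (φ : U ↪ V) {x y : V}
    (hx : x ∈ Set.range φ) (hy : y ∈ Set.range φ) (hxy : x ≠ y) :
    ∃! e, e ∈ S.image (Finset.map φ) ∧ x ∈ e ∧ y ∈ e := by
  obtain ⟨u, rfl⟩ := hx
  obtain ⟨v, rfl⟩ := hy
  rw [isFullSteiner_iff] at hS
  obtain ⟨e, he, huniq⟩ := hS.2 u v (fun h => hxy (congrArg φ h))
  refine ⟨e.map φ, ⟨mem_image_of_mem _ he.1, (mem_map' φ).2 he.2.1, (mem_map' φ).2 he.2.2⟩, ?_⟩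
  rintro f ⟨hf, hu, hv⟩
  obtain ⟨g, hg, rfl⟩ := mem_image.1 hf
  rw [huniq g ⟨hg, (mem_map' φ).1 hu, (mem_map' φ).1 hv⟩]

/-- Gluing Steiner systems along the blocks of a linear space. -/
theorem isFullSteiner_biUnion {Λ : Type*} [Fintype Λ] {k : ℕ} (Z : Λ → Set V)
    (T : Λ → Finset (Finset V)) (hT : ∀ l, ∀ e ∈ T l, e.card = k ∧ ∀ x ∈ e, x ∈ Z l)
    (hTZ : ∀ l, ∀ x ∈ Z l, ∀ y ∈ Z l, x ≠ y → ∃! e, e ∈ T l ∧ x ∈ e ∧ y ∈ e)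
    (hZ : ∀ x y, x ≠ y → ∃! l, x ∈ Z l ∧ y ∈ Z l) :
    IsFullSteiner k (univ.biUnion T) := by
  rw [isFullSteiner_iff]
  refine ⟨fun e he => ?_, fun x y hxy => ?_⟩
  · obtain ⟨l, -, hl⟩ := mem_biUnion.1 he
    exact (hT l e hl).1
  · obtain ⟨l, hl, hlu⟩ := hZ x y hxy
    obtain ⟨e, he, heu⟩ := hTZ l x hl.1 y hl.2 hxy
    refine ⟨e, ⟨mem_biUnion.2 ⟨l, mem_univ _, he.1⟩, he.2⟩, ?_⟩
    rintro f ⟨hf, hx, hy⟩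
    obtain ⟨l', -, hl'⟩ := mem_biUnion.1 hf
    obtain rfl := hlu l' ⟨(hT l' f hl').2 x hx, (hT l' f hl').2 y hy⟩
    exact heu f ⟨hl', hx, hy⟩

section Plane

variable {F : Type*} [Field F]

/-- Parametrisations of the lines of the affine plane, the non-vertical ones twisted by the
permutations `π`. -/
def lineEmb (π : F × F → Equiv.Perm F) : (F × F) ⊕ F → F ↪ F × F
  | .inl ab => (π ab).toEmbedding.trans
      ⟨fun t => (t, ab.1 * t + ab.2), fun _ _ h => (Prod.ext_iff.1 h).1⟩
  | .inr c => ⟨fun t => (c, t), fun _ _ h => (Prod.ext_iff.1 h).2⟩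

theorem mem_range_lineEmb_inl (π : F × F → Equiv.Perm F) (ab : F × F) (p : F × F) :
    p ∈ Set.range (lineEmb π (.inl ab)) ↔ p.2 = ab.1 * p.1 + ab.2 := by
  constructor
  · rintro ⟨t, rfl⟩
    rfl
  · intro h
    refine ⟨(π ab).symm p.1, ?_⟩
    simp only [lineEmb, Function.Embedding.trans_apply, Equiv.apply_symm_apply,
      Function.Embedding.coeFn_mk]
    exact Prod.ext rfl h.symm

theorem mem_range_lineEmb_inr (π : F × F → Equiv.Perm F) (c : F) (p : F × F) :
    p ∈ Set.range (lineEmb π (.inr c)) ↔ p.1 = c := by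
  constructor
  · rintro ⟨t, rfl⟩
    rfl
  · rintro rfl
    exact ⟨p.2, rfl⟩

theorem line_through_unique {p p' : F × F} (hne : p ≠ p') {ab ab' : F × F}
    (h1 : p.2 = ab.1 * p.1 + ab.2) (h2 : p'.2 = ab.1 * p'.1 + ab.2)
    (h3 : p.2 = ab'.1 * p.1 + ab'.2) (h4 : p'.2 = ab'.1 * p'.1 + ab'.2) : ab = ab' := by
  have hx : p.1 - p'.1 ≠ 0 := by
    intro h
    rw [sub_eq_zero] at h
    exact hne (Prod.ext h (by rw [h1, h2, h]))
  have ha : ab.1 = ab'.1 := by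
    apply mul_right_cancel₀ hx
    linear_combination h2 - h1 + h3 - h4
  exact Prod.ext ha (by rw [ha] at h1; linear_combination h3 - h1)

theorem existsUnique_lineEmb (π : F × F → Equiv.Perm F) (p p' : F × F) (hne : p ≠ p') :
    ∃! l, p ∈ Set.range (lineEmb π l) ∧ p' ∈ Set.range (lineEmb π l) := by
  by_cases hx : p.1 = p'.1
  · refine ⟨.inr p.1, ⟨(mem_range_lineEmb_inr ..).2 rfl, (mem_range_lineEmb_inr ..).2 hx.symm⟩, ?_⟩
    rintro (ab | c) ⟨h1, h2⟩
    · rw [mem_range_lineEmb_inl] at h1 h2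
      exact absurd (Prod.ext hx (by rw [h1, h2, hx])) hne
    · rw [mem_range_lineEmb_inr] at h1
      rw [h1]
  · have hx0 : p'.1 - p.1 ≠ 0 := sub_ne_zero.2 (Ne.symm hx)
    have h1 : p.2 = (p'.2 - p.2) / (p'.1 - p.1) * p.1 +
        (p.2 - (p'.2 - p.2) / (p'.1 - p.1) * p.1) := by ring
    have h2 : p'.2 = (p'.2 - p.2) / (p'.1 - p.1) * p'.1 +
        (p.2 - (p'.2 - p.2) / (p'.1 - p.1) * p.1) := by
      have := div_mul_cancel₀ (p'.2 - p.2) hx0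
      linear_combination -this
    refine ⟨.inl ((p'.2 - p.2) / (p'.1 - p.1), p.2 - (p'.2 - p.2) / (p'.1 - p.1) * p.1),
      ⟨(mem_range_lineEmb_inl ..).2 h1, (mem_range_lineEmb_inl ..).2 h2⟩, ?_⟩
    rintro (ab | c) ⟨h3, h4⟩
    · rw [mem_range_lineEmb_inl] at h3 h4
      rw [line_through_unique hne h3 h4 (ab' := (_, _)) h1 h2]
    · rw [mem_range_lineEmb_inr] at h3 h4
      exact absurd (h3.trans h4.symm) hx

variable [Fintype F] [DecidableEq F]

/-- The union of copies of `S` on all lines of the affine plane. -/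
def planeSystem (π : F × F → Equiv.Perm F) (S : Finset (Finset F)) : Finset (Finset (F × F)) :=
  univ.biUnion fun l => S.image (Finset.map (lineEmb π l))

theorem isFullSteiner_planeSystem {k : ℕ} {S : Finset (Finset F)} (hS : IsFullSteiner k S)
    (π : F × F → Equiv.Perm F) : IsFullSteiner k (planeSystem π S) := by
  refine isFullSteiner_biUnion (fun l => Set.range (lineEmb π l)) _ (fun l e he => ?_)
    (fun l x hx y hy hxy => hS.existsUnique_mem_image _ hx hy hxy) (existsUnique_lineEmb π)
  obtain ⟨g, hg, rfl⟩ := mem_image.1 he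
  refine ⟨by rw [card_map, hS.1 g hg], fun x hx => ?_⟩
  obtain ⟨t, -, rfl⟩ := mem_map.1 hx
  exact ⟨t, rfl⟩

/-- The trace of `I` on a non-vertical line, parametrised by the first coordinate. -/
def lineTrace (I : Finset (F × F)) (ab : F × F) : Finset F :=
  univ.filter fun t => (t, ab.1 * t + ab.2) ∈ I

theorem IsIndep.not_map_subset_lineTrace {π : F × F → Equiv.Perm F} {S : Finset (Finset F)}
    {I : Finset (F × F)} (hI : IsIndep (planeSystem π S) I) (ab : F × F) (e : Finset F)
    (he : e ∈ S) : ¬ e.map (π ab).toEmbedding ⊆ lineTrace I ab := by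
  intro h
  refine hI (e.map (lineEmb π (.inl ab)))
    (mem_biUnion.2 ⟨.inl ab, mem_univ _, mem_image_of_mem _ he⟩) fun p hp => ?_
  obtain ⟨t, ht, rfl⟩ := mem_map.1 hp
  exact (mem_filter.1 (h (mem_map_of_mem (π ab).toEmbedding ht))).2

theorem card_lineTrace (I : Finset (F × F)) (ab : F × F) :
    (lineTrace I ab).card = (I.filter fun p => p.2 = ab.1 * p.1 + ab.2).card := by
  refine card_bij (fun t _ => (t, ab.1 * t + ab.2)) ?_ ?_ ?_
  · intro t ht
    simpa [lineTrace] using ht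
  · intro t _ t' _ h
    exact (Prod.ext_iff.1 h).1
  · rintro ⟨t, y⟩ hp
    obtain ⟨h1, h2⟩ := mem_filter.1 hp
    simp only at h2
    subst h2
    exact ⟨t, by simpa [lineTrace] using h1, rfl⟩

theorem card_lines_through (p : F × F) :
    (univ.filter fun ab : F × F => p.2 = ab.1 * p.1 + ab.2).card = Fintype.card F := by
  rw [← card_univ]
  symm
  refine card_bij (fun a _ => (a, p.2 - a * p.1)) ?_ ?_ ?_
  · intro a _
    simp
  · intro t _ t' _ h
    exact (Prod.ext_iff.1 h).1
  · rintro ⟨a, b⟩ hp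
    have h := (mem_filter.1 hp).2
    exact ⟨a, mem_univ _, Prod.ext rfl (by simp only at h ⊢; rw [h]; ring)⟩

theorem sum_card_lineTrace (I : Finset (F × F)) :
    ∑ ab : F × F, (lineTrace I ab).card = I.card * Fintype.card F := by
  simp only [card_lineTrace]
  have := sum_card_bipartiteAbove_eq_sum_card_bipartiteBelow
    (s := (univ : Finset (F × F))) (t := I) (fun ab p => p.2 = ab.1 * p.1 + ab.2)
  simp only [bipartiteAbove, bipartiteBelow] at this
  rw [this, sum_congr rfl fun p _ => card_lines_through p, sum_const, smul_eq_mul]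

theorem sum_card_lineTrace_sq_le (I : Finset (F × F)) :
    ∑ ab : F × F, (lineTrace I ab).card ^ 2 ≤ I.card * Fintype.card F + I.card ^ 2 := by
  simp only [card_lineTrace]
  have := sum_card_bipartiteAbove_eq_sum_card_bipartiteBelow
    (s := (univ : Finset (F × F))) (t := I ×ˢ I)
    (fun ab p => p.1.2 = ab.1 * p.1.1 + ab.2 ∧ p.2.2 = ab.1 * p.2.1 + ab.2)
  simp only [bipartiteAbove, bipartiteBelow] at this
  have h1 : ∀ ab : F × F, (I.filter fun p => p.2 = ab.1 * p.1 + ab.2).card ^ 2 =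
      ((I ×ˢ I).filter fun p => p.1.2 = ab.1 * p.1.1 + ab.2 ∧
        p.2.2 = ab.1 * p.2.1 + ab.2).card := by
    intro ab
    rw [sq, ← card_product]
    congr 1
    ext ⟨p, p'⟩
    simp only [mem_product, mem_filter]
    tauto
  rw [sum_congr rfl fun ab _ => h1 ab, this]
  have h2 : ∀ pp ∈ I ×ˢ I, (univ.filter fun ab : F × F => pp.1.2 = ab.1 * pp.1.1 + ab.2 ∧
      pp.2.2 = ab.1 * pp.2.1 + ab.2).card ≤ (if pp.1 = pp.2 then Fintype.card F else 0) + 1 := by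
    rintro ⟨p, p'⟩ -
    split_ifs with h
    · refine le_trans (card_le_card fun ab hab => ?_) ((card_lines_through p).le.trans
        (Nat.le_succ _))
      simp only [mem_filter, mem_univ, true_and] at hab ⊢
      exact hab.1
    · rw [zero_add, card_le_one]
      intro ab hab ab' hab'
      simp only [mem_filter, mem_univ, true_and] at hab hab'
      exact line_through_unique h hab.1 hab.2 hab'.1 hab'.2
  refine (sum_le_sum h2).trans ?_
  rw [sum_add_distrib, sum_const, card_product, smul_eq_mul, mul_one, sum_product]
  simp only [sum_ite_eq, sum_ite_mem, inter_self, sum_const, smul_eq_mul]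
  rw [sq]

theorem card_poor_lines_le (I : Finset (F × F)) {x : ℕ} (hx : 4 ≤ x)
    (hI : I.card = 2 * x * Fintype.card F) :
    2 * ((univ.filter fun ab : F × F => (lineTrace I ab).card < x).card : ℝ) ≤
      (Fintype.card F : ℝ) ^ 2 := by
  have h1 := sum_card_lineTrace I
  have h2 := sum_card_lineTrace_sq_le I
  set q : ℝ := ((Fintype.card F : ℕ) : ℝ) with hq
  have h1R : ∑ ab : F × F, ((lineTrace I ab).card : ℝ) = 2 * x * q * q := by
    rw [hI] at h1; rw [hq]; exact_mod_cast h1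
  have h2R : ∑ ab : F × F, ((lineTrace I ab).card : ℝ) ^ 2 ≤ 2 * x * q * q + (2 * x * q) ^ 2 := by
    rw [hI] at h2; rw [hq]; exact_mod_cast h2
  have hvar : ∑ ab : F × F, ((lineTrace I ab).card - 2 * x : ℝ) ^ 2 ≤ 2 * x * q ^ 2 := by
    have : ∀ ab : F × F, ((lineTrace I ab).card - 2 * x : ℝ) ^ 2 =
        ((lineTrace I ab).card : ℝ) ^ 2 - 4 * x * (lineTrace I ab).card + 4 * x ^ 2 := by
      intro ab; ring
    simp only [this]
    rw [sum_add_distrib, sum_sub_distrib, ← mul_sum, h1R, sum_const, card_univ,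
      Fintype.card_prod, nsmul_eq_mul]
    push_cast
    rw [← hq]
    nlinarith
  have hpoor : ((univ.filter fun ab : F × F => (lineTrace I ab).card < x).card : ℝ) * x ^ 2 ≤
      2 * x * q ^ 2 := by
    refine le_trans ?_ hvar
    rw [← nsmul_eq_mul, ← sum_const]
    refine le_trans (sum_le_sum fun ab hab => ?_)
      (sum_le_sum_of_subset_of_nonneg (filter_subset _ _) fun _ _ _ => sq_nonneg _)
    have h3 : ((lineTrace I ab).card : ℝ) ≤ x := by exact_mod_cast (mem_filter.1 hab).2.le
    have h4 : (0 : ℝ) ≤ x := Nat.cast_nonneg _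
    nlinarith
  have hxR : (4 : ℝ) ≤ x := by exact_mod_cast hx
  set P : ℝ := ((univ.filter fun ab : F × F => (lineTrace I ab).card < x).card : ℝ)
  have h5 : P * x ≤ 2 * q ^ 2 := by
    have : x * (P * x) ≤ x * (2 * q ^ 2) := by linarith
    exact le_of_mul_le_mul_left this (by linarith)
  have h6 : P * 4 ≤ P * x := mul_le_mul_of_nonneg_left hxR (Nat.cast_nonneg _)
  linarith

/-- Some choice of copies of `S` on the lines of the plane has no large independent set. -/
theorem exists_planeSystem_indep_lt {k : ℕ} (hk : 3 ≤ k) {S : Finset (Finset F)}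
    (hS : IsFullSteiner k S) {x : ℕ} (hx : 2 * k ≤ x) (hV : 4 * k ≤ Fintype.card F)
    (hcond : 2 * (k + 1) * 8 ^ k * (x : ℝ) ^ k ≤ (Fintype.card F : ℝ) ^ (k - 2))
    (hcond2 : 32 * k ^ 2 * 2 ^ k * (Fintype.card F : ℝ) ^ (k - 3) * Real.log (Fintype.card F) <
      (x : ℝ) ^ (k - 1)) :
    ∃ π, ∀ I, IsIndep (planeSystem π S) I → I.card < 2 * x * Fintype.card F := by
  set q : ℝ := ((Fintype.card F : ℕ) : ℝ) with hq
  set f : ℝ := ((Fintype.card F).factorial : ℝ) with hf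
  set s : ℕ := 2 * x * Fintype.card F with hs
  have hkR : (3 : ℝ) ≤ k := by exact_mod_cast hk
  have hqk : 4 * (k : ℝ) ≤ q := by rw [hq]; exact_mod_cast hV
  have hq0 : 0 < q := by linarith
  have hx0 : (0 : ℝ) < x := by exact_mod_cast (by omega : 0 < x)
  have hf0 : 0 < f := by rw [hf]; exact_mod_cast Nat.factorial_pos _
  set δ : ℝ := (x : ℝ) ^ k / (4 * k ^ 2 * 2 ^ k * q ^ (k - 2)) with hδ
  have hδ0 : 0 ≤ δ := by positivity
  have hδ1 : δ ≤ 1 := by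
    rw [hδ, div_le_one (by positivity)]
    have h1 : (x : ℝ) ^ k * 1 ≤ (x : ℝ) ^ k * (2 * (k + 1) * 8 ^ k) := by
      gcongr
      have : (1 : ℝ) ≤ 8 ^ k := one_le_pow₀ (by norm_num)
      nlinarith
    have h2 : q ^ (k - 2) * 1 ≤ q ^ (k - 2) * (4 * k ^ 2 * 2 ^ k) := by
      gcongr
      have : (1 : ℝ) ≤ 2 ^ k := one_le_pow₀ (by norm_num)
      nlinarith
    linarith
  let bad : Finset (F × F) → Finset (F × F → Equiv.Perm F) := fun I =>
    Fintype.piFinset fun ab => univ.filter fun σ : Equiv.Perm F =>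
      ∀ e ∈ S, ¬ e.map σ.toEmbedding ⊆ lineTrace I ab
  have hbad : ∀ I ∈ powersetCard s (univ : Finset (F × F)),
      ((bad I).card : ℝ) ≤ f ^ (Fintype.card F ^ 2) * Real.exp (-(δ * q ^ 2 / 2)) := by
    intro I hI
    rw [mem_powersetCard] at hI
    have hpoor := card_poor_lines_le I (by omega : 4 ≤ x) hI.2
    rw [← hq] at hpoor
    rw [Fintype.card_piFinset]
    push_cast
    have h1 : ∀ ab : F × F, ((univ.filter fun σ : Equiv.Perm F =>
        ∀ e ∈ S, ¬ e.map σ.toEmbedding ⊆ lineTrace I ab).card : ℝ) ≤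
        f * (if (lineTrace I ab).card < x then 1 else Real.exp (-δ)) := by
      intro ab
      split_ifs with h
      · rw [mul_one, hf, ← Fintype.card_perm]
        exact_mod_cast card_le_univ _
      · refine (card_perm_avoid_le hk hS hx hV hcond _ (not_lt.1 h)).trans ?_
        rw [← hq, ← hf, ← hδ]
        gcongr
        linarith [Real.add_one_le_exp (-δ)]
    refine (prod_le_prod (fun _ _ => Nat.cast_nonneg _) fun ab _ => h1 ab).trans ?_
    rw [prod_mul_distrib, prod_const, card_univ, Fintype.card_prod, ← sq, prod_ite, prod_const_one,
      one_mul, prod_const, ← Real.exp_nat_mul]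
    gcongr
    have h2 := card_filter_add_card_filter_not (s := (univ : Finset (F × F)))
      fun ab => (lineTrace I ab).card < x
    rw [card_univ, Fintype.card_prod] at h2
    have h3 : ((univ.filter fun ab : F × F => (lineTrace I ab).card < x).card : ℝ) +
        ((univ.filter fun ab : F × F => ¬ (lineTrace I ab).card < x).card : ℝ) = q * q := by
      rw [hq]; exact_mod_cast h2
    nlinarith
  have hcount : ((powersetCard s (univ : Finset (F × F))).card : ℝ) ≤
      Real.exp (2 * s * Real.log q) := by
    rw [card_powersetCard, card_univ, Fintype.card_prod]
    refine le_trans (Nat.cast_le.2 (Nat.choose_le_pow _ _)) ?_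
    push_cast
    rw [← hq, show 2 * (s : ℝ) * Real.log q = s * (Real.log q + Real.log q) by ring,
      Real.exp_nat_mul, Real.exp_add, Real.exp_log hq0]
  have hlt : Real.exp (2 * s * Real.log q) * Real.exp (-(δ * q ^ 2 / 2)) < 1 := by
    rw [← Real.exp_add, Real.exp_lt_one_iff]
    have hsq : (s : ℝ) = 2 * x * q := by rw [hs, hq]; push_cast; ring
    have h1 : δ * q ^ 2 / 2 = x * q / (8 * k ^ 2 * 2 ^ k * q ^ (k - 3)) * x ^ (k - 1) := by
      obtain ⟨j, rfl⟩ : ∃ j, k = j + 3 := ⟨k - 3, by omega⟩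
      rw [hδ, show j + 3 - 2 = j + 1 by omega, show j + 3 - 1 = j + 2 by omega,
        show j + 3 - 3 = j by omega]
      field_simp
      ring
    have h2 : 4 * x * q * Real.log q < x * q / (8 * k ^ 2 * 2 ^ k * q ^ (k - 3)) * x ^ (k - 1) := by
      calc 4 * x * q * Real.log q = x * q / (8 * k ^ 2 * 2 ^ k * q ^ (k - 3)) *
            (32 * k ^ 2 * 2 ^ k * q ^ (k - 3) * Real.log q) := by
            field_simp; ring
        _ < _ := by gcongr
    rw [h1, hsq]
    linarith
  have hU : (((powersetCard s (univ : Finset (F × F))).biUnion bad).card : ℝ) <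
      (Fintype.card (F × F → Equiv.Perm F) : ℝ) := by
    calc (((powersetCard s (univ : Finset (F × F))).biUnion bad).card : ℝ)
        ≤ ∑ I ∈ powersetCard s (univ : Finset (F × F)), ((bad I).card : ℝ) := by
          exact_mod_cast card_biUnion_le
      _ ≤ ∑ I ∈ powersetCard s (univ : Finset (F × F)),
          f ^ (Fintype.card F ^ 2) * Real.exp (-(δ * q ^ 2 / 2)) := sum_le_sum hbad
      _ = ((powersetCard s (univ : Finset (F × F))).card : ℝ) *
          (f ^ (Fintype.card F ^ 2) * Real.exp (-(δ * q ^ 2 / 2))) := by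
          rw [sum_const, nsmul_eq_mul]
      _ ≤ Real.exp (2 * s * Real.log q) *
          (f ^ (Fintype.card F ^ 2) * Real.exp (-(δ * q ^ 2 / 2))) := by gcongr
      _ = f ^ (Fintype.card F ^ 2) *
          (Real.exp (2 * s * Real.log q) * Real.exp (-(δ * q ^ 2 / 2))) := by ring
      _ < f ^ (Fintype.card F ^ 2) * 1 := by gcongr
      _ = _ := by
          rw [mul_one, Fintype.card_fun, Fintype.card_prod, Fintype.card_perm, sq]
          push_cast
          rfl
  have hU' : ((powersetCard s (univ : Finset (F × F))).biUnion bad).card <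
      (univ : Finset (F × F → Equiv.Perm F)).card := by
    rw [card_univ]; exact_mod_cast hU
  obtain ⟨π, -, hπ⟩ := exists_mem_notMem_of_card_lt_card hU'
  refine ⟨π, fun I hI => ?_⟩
  by_contra! hcard
  obtain ⟨J, hJI, hJ⟩ := exists_subset_card_eq hcard
  refine hπ (mem_biUnion.2 ⟨J, mem_powersetCard.2 ⟨subset_univ _, hJ⟩, ?_⟩)
  rw [Fintype.mem_piFinset]
  intro ab
  rw [mem_filter]
  have hJ' : IsIndep (planeSystem π S) J := fun e he h => hI e he (h.trans hJI)
  exact ⟨mem_univ _, fun e he => hJ'.not_map_subset_lineTrace ab e he⟩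

end Plane

theorem exists_mul_log_pow_le (D : ℝ) (j : ℕ) : ∃ N : ℕ, ∀ n : ℕ, N ≤ n →
    D * Real.log n ^ j ≤ n := by
  have h := (Real.isLittleO_pow_log_id_atTop (n := j)).bound
    (show (0 : ℝ) < 1 / (|D| + 1) by positivity)
  have h2 := tendsto_natCast_atTop_atTop (R := ℝ) |>.eventually h
  obtain ⟨N, hN⟩ := Filter.eventually_atTop.1 h2
  refine ⟨N, fun n hn => ?_⟩
  have h3 := hN n hn
  rw [Real.norm_eq_abs, id, Real.norm_eq_abs, Nat.abs_cast, div_mul_eq_mul_div, one_mul,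
    le_div_iff₀ (by positivity)] at h3
  have h4 : Real.log n ^ j ≤ |Real.log n ^ j| := le_abs_self _
  calc D * Real.log n ^ j ≤ |D * Real.log n ^ j| := le_abs_self _
    _ = |D| * |Real.log n ^ j| := abs_mul _ _
    _ ≤ n := by nlinarith [abs_nonneg (Real.log n ^ j)]

/-- Over a large finite field whose order is `1` modulo `k (k - 1)`, the plane carries a Steiner
system without large independent sets. -/
theorem exists_isFullSteiner_plane_indep_le (k : ℕ) (hk : 3 ≤ k) :
    ∃ C : ℝ, 0 < C ∧ ∃ q₀ : ℕ, ∀ (F : Type) [Field F] [Fintype F] [DecidableEq F],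
      q₀ ≤ Fintype.card F → k * (k - 1) ∣ Fintype.card F - 1 →
      ∃ T : Finset (Finset (F × F)), IsFullSteiner k T ∧ ∀ I, IsIndep T I →
        (I.card : ℝ) ^ (k - 1) ≤
          C * (Fintype.card F : ℝ) ^ (2 * (k - 2)) * Real.log (Fintype.card F) := by
  have hkR : (3 : ℝ) ≤ k := by exact_mod_cast hk
  set A : ℝ := 32 * k ^ 2 * 2 ^ k with hA
  have hA1 : 1 ≤ A := by
    have : (1 : ℝ) ≤ 2 ^ k := one_le_pow₀ (by norm_num)
    have : (1 : ℝ) ≤ 32 * k ^ 2 := by nlinarith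
    nlinarith
  set B : ℝ := (2 * k + 2) ^ (k - 1) * A with hB
  have hB0 : 0 < B := by positivity
  set G : ℝ := 2 * (k + 1) * 8 ^ k with hG
  have hG0 : 0 < G := by positivity
  obtain ⟨q₁, hq₁⟩ := exists_isFullSteiner_field k hk
  obtain ⟨q₂, hq₂⟩ := exists_mul_log_pow_le ((G * B) ^ (k - 1) * B) k
  refine ⟨2 ^ (k - 1) * B, by positivity, max q₁ (max q₂ (4 * k)), fun F _ _ _ hF hdvd => ?_⟩
  obtain ⟨S, hS⟩ := hq₁ F ((le_max_left _ _).trans hF) hdvd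
  have hF2 := hq₂ _ ((le_max_left _ _).trans ((le_max_right _ _).trans hF))
  have hF3 : 4 * k ≤ Fintype.card F := (le_max_right _ _).trans ((le_max_right _ _).trans hF)
  set q : ℝ := ((Fintype.card F : ℕ) : ℝ) with hq
  have hq12 : (12 : ℝ) ≤ q := by
    rw [hq]; exact_mod_cast (by omega : 12 ≤ Fintype.card F)
  have hq0 : 0 < q := by linarith
  have hlog : 1 ≤ Real.log q := by
    rw [Real.le_log_iff_exp_le hq0]
    linarith [Real.exp_one_lt_d9]
  obtain ⟨j, rfl⟩ : ∃ j, k = j + 3 := ⟨k - 3, by omega⟩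
  rw [show j + 3 - 1 = j + 2 by omega] at *
  rw [show j + 3 - 2 = j + 1 by omega]
  set L : ℝ := A * q ^ j * Real.log q with hL
  have hL1 : 1 ≤ L := by
    have h1 : 1 ≤ q ^ j := one_le_pow₀ (by linarith)
    have h2 : 1 ≤ A * q ^ j := by nlinarith
    nlinarith
  set r : ℝ := L ^ (((j + 2 : ℕ) : ℝ)⁻¹) with hr
  have hr1 : 1 ≤ r := Real.one_le_rpow hL1 (by positivity)
  have hrL : r ^ (j + 2) = L := Real.rpow_inv_natCast_pow (by linarith) (by omega)
  set x : ℕ := ⌈r⌉₊ + 2 * (j + 3) with hx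
  have hxr : r < x := by
    have h1 := Nat.le_ceil r
    rw [hx]; push_cast
    have : (0 : ℝ) ≤ j := Nat.cast_nonneg j
    linarith
  have hxr2 : (x : ℝ) ≤ (2 * ((j + 3 : ℕ) : ℝ) + 2) * r := by
    have h1 := (Nat.ceil_lt_add_one (by linarith : 0 ≤ r)).le
    rw [hx]; push_cast
    have : (0 : ℝ) ≤ j := Nat.cast_nonneg j
    nlinarith
  have hxL : L < (x : ℝ) ^ (j + 2) := by
    rw [← hrL]
    exact pow_lt_pow_left₀ hxr (by linarith) (by omega)
  have hxB : (x : ℝ) ^ (j + 2) ≤ B * q ^ j * Real.log q := by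
    calc (x : ℝ) ^ (j + 2) ≤ ((2 * ((j + 3 : ℕ) : ℝ) + 2) * r) ^ (j + 2) := by gcongr
      _ = B * q ^ j * Real.log q := by rw [mul_pow, hrL, hL, hB]; simp only [mul_assoc]
  have hxq : G * B * x * Real.log q ≤ q := by
    refine le_of_pow_le_pow_left₀ (n := j + 2) (by omega) hq0.le ?_
    calc (G * B * x * Real.log q) ^ (j + 2)
        = (G * B) ^ (j + 2) * Real.log q ^ (j + 2) * (x : ℝ) ^ (j + 2) := by
          rw [mul_right_comm, mul_pow, mul_pow (G * B)]
      _ ≤ (G * B) ^ (j + 2) * Real.log q ^ (j + 2) * (B * q ^ j * Real.log q) := by gcongr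
      _ = (G * B) ^ (j + 2) * B * Real.log q ^ (j + 3) * q ^ j := by ring
      _ ≤ q * q ^ j := by gcongr
      _ ≤ q * q ^ j * q := le_mul_of_one_le_right (by positivity) (by linarith)
      _ = q ^ (j + 2) := by ring
  have hcond : G * (x : ℝ) ^ (j + 3) ≤ q ^ (j + 1) := by
    calc G * (x : ℝ) ^ (j + 3) = G * x * (x : ℝ) ^ (j + 2) := by ring
      _ ≤ G * x * (B * q ^ j * Real.log q) := by gcongr
      _ = G * B * x * Real.log q * q ^ j := by ring
      _ ≤ q * q ^ j := by gcongr
      _ = _ := by ring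
  obtain ⟨π, hπ⟩ := exists_planeSystem_indep_lt hk hS (x := x) (by omega) hF3 hcond hxL
  refine ⟨planeSystem π S, isFullSteiner_planeSystem hS π, fun I hI => ?_⟩
  have hI' : (I.card : ℝ) ≤ 2 * x * q := by
    rw [hq]; exact_mod_cast (hπ I hI).le
  calc (I.card : ℝ) ^ (j + 2) ≤ (2 * x * q) ^ (j + 2) := by gcongr
    _ = 2 ^ (j + 2) * q ^ (j + 2) * (x : ℝ) ^ (j + 2) := by ring
    _ ≤ 2 ^ (j + 2) * q ^ (j + 2) * (B * q ^ j * Real.log q) := by gcongr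
    _ = _ := by ring

section Transversal

variable {U : Type*}

/-- The block of a transversal design with coordinates `g i b`. -/
def transversalBlock {B : Type*} {k : ℕ} (g : Fin k → B → U) (b : B) : Finset (Fin k × U) :=
  univ.map ⟨fun i => (i, g i b), fun _ _ h => (Prod.ext_iff.1 h).1⟩

theorem mem_transversalBlock {B : Type*} {k : ℕ} {g : Fin k → B → U} {b : B} {p : Fin k × U} :
    p ∈ transversalBlock g b ↔ p.2 = g p.1 b := by
  simp only [transversalBlock, mem_map, mem_univ, true_and]
  constructor
  · rintro ⟨i, rfl⟩
    rfl
  · intro h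
    exact ⟨p.1, Prod.ext rfl h.symm⟩

/-- The inclusion of the `i`-th group. -/
def groupEmb (k : ℕ) (U : Type*) (i : Fin k) : U ↪ Fin k × U :=
  ⟨fun u => (i, u), fun _ _ h => (Prod.ext_iff.1 h).2⟩

variable [DecidableEq U]

/-- The pieces of a transversal design whose groups are filled with copies of `T`. -/
def filledPieces {B : Type*} {k : ℕ} (T : Finset (Finset U)) (g : Fin k → B → U) :
    Fin k ⊕ B → Finset (Finset (Fin k × U))
  | .inl i => T.image (Finset.map (groupEmb k U i))
  | .inr b => {transversalBlock g b}

/-- A transversal design together with a copy of `T` on each group. -/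
def filledSystem {B : Type*} [Fintype B] {k : ℕ} (T : Finset (Finset U)) (g : Fin k → B → U) :
    Finset (Finset (Fin k × U)) :=
  univ.biUnion (filledPieces T g)

theorem isFullSteiner_filledSystem {B : Type*} [Fintype B] {k : ℕ} {T : Finset (Finset U)}
    (hT : IsFullSteiner k T) {g : Fin k → B → U}
    (hg : ∀ i j, i ≠ j → Function.Bijective fun b => (g i b, g j b)) :
    IsFullSteiner k (filledSystem T g) := by
  let Z : Fin k ⊕ B → Set (Fin k × U) := Sum.elim (fun i => {p | p.1 = i})
    (fun b => {p | p.2 = g p.1 b})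
  have hrange : ∀ (i : Fin k) (p : Fin k × U), p.1 = i → p ∈ Set.range (groupEmb k U i) := by
    rintro i p rfl
    exact ⟨p.2, rfl⟩
  refine isFullSteiner_biUnion Z _ ?_ ?_ ?_
  · rintro (i | b) e he
    · obtain ⟨f, hf, rfl⟩ := mem_image.1 he
      refine ⟨by rw [card_map, hT.1 f hf], fun p hp => ?_⟩
      obtain ⟨u, -, rfl⟩ := mem_map.1 hp
      rfl
    · obtain rfl := mem_singleton.1 he
      exact ⟨by simp [transversalBlock], fun p hp => mem_transversalBlock.1 hp⟩
  · rintro (i | b) p hp p' hp' hne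
    · exact hT.existsUnique_mem_image _ (hrange i p hp) (hrange i p' hp') hne
    · refine ⟨transversalBlock g b, ⟨mem_singleton_self _, mem_transversalBlock.2 hp,
        mem_transversalBlock.2 hp'⟩, fun e he => mem_singleton.1 he.1⟩
  · intro p p' hne
    by_cases hi : p.1 = p'.1
    · refine ⟨.inl p.1, ⟨rfl, hi.symm⟩, ?_⟩
      rintro (i | b) ⟨h1, h2⟩
      · rw [show p.1 = i from h1]
      · have h3 : p.2 = g p.1 b := h1
        have h4 : p'.2 = g p'.1 b := h2
        exact absurd (Prod.ext hi (by rw [h3, h4, hi])) hne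
    · obtain ⟨b, hb⟩ := (hg p.1 p'.1 hi).2 (p.2, p'.2)
      have hb' := Prod.ext_iff.1 hb
      refine ⟨.inr b, ⟨hb'.1.symm, hb'.2.symm⟩, ?_⟩
      rintro (i | b') ⟨h1, h2⟩
      · exact absurd ((show p.1 = i from h1).trans (show p'.1 = i from h2).symm) hi
      · have h3 : p.2 = g p.1 b' := h1
        have h4 : p'.2 = g p'.1 b' := h2
        rw [(hg p.1 p'.1 hi).1 (a₁ := b') (a₂ := b) (by simp only; rw [← h3, ← h4]; exact hb.symm)]

theorem transversalBlock_mem_filledSystem {B : Type*} [Fintype B] {k : ℕ} (T : Finset (Finset U))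
    (g : Fin k → B → U) (b : B) : transversalBlock g b ∈ filledSystem T g :=
  mem_biUnion.2 ⟨.inr b, mem_univ _, mem_singleton_self _⟩

theorem card_le_of_isIndep_filledSystem [Fintype U] {B : Type*} [Fintype B] {k s : ℕ}
    {T : Finset (Finset U)} (hs : ∀ I, IsIndep T I → I.card ≤ s) (g : Fin k → B → U) {I : Finset (Fin k × U)}
    (hI : IsIndep (filledSystem T g) I) : I.card ≤ k * s := by
  have h := card_eq_sum_card_fiberwise (s := I) (t := univ) (f := Prod.fst) fun _ _ => mem_univ _
  have hi : ∀ i ∈ (univ : Finset (Fin k)), (I.filter fun p => p.1 = i).card ≤ s := by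
    intro i _
    have h1 : (I.filter fun p => p.1 = i) =
        (univ.filter fun u => (i, u) ∈ I).map (groupEmb k U i) := by
      ext ⟨j, u⟩
      simp only [mem_filter, mem_map, mem_univ, true_and]
      constructor
      · rintro ⟨h, rfl⟩
        exact ⟨u, h, rfl⟩
      · rintro ⟨v, h, heq⟩
        cases heq
        exact ⟨h, rfl⟩
    rw [h1, card_map]
    refine hs _ fun e he hsub => hI (e.map (groupEmb k U i))
      (mem_biUnion.2 ⟨.inl i, mem_univ _, mem_image_of_mem _ he⟩) fun p hp => ?_
    obtain ⟨u, hu, rfl⟩ := mem_map.1 hp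
    exact (mem_filter.1 (hsub hu)).2
  rw [h]
  refine (sum_le_sum hi).trans ?_
  simp

/-- The first group of a transversal design is determined by the filled system and by the
other groups. -/
theorem eq_of_filledSystem_eq {B : Type*} [Fintype B] {k : ℕ} {T : Finset (Finset U)}
    (hT : IsFullSteiner k T) {g g' : Fin k → B → U}
    (hg : ∀ i j, i ≠ j → Function.Bijective fun b => (g i b, g j b))
    (h : filledSystem T g' = filledSystem T g) {i j : Fin k} (hij : i ≠ j)
    (hi : g' i = g i) (hj : g' j = g j) : g' = g := by
  have hS := isFullSteiner_iff.1 (isFullSteiner_filledSystem hT hg)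
  funext l b
  have h1 := transversalBlock_mem_filledSystem T g b
  have h2 := transversalBlock_mem_filledSystem T g' b
  rw [h] at h2
  have h3 := (hS.2 (i, g i b) (j, g j b) (by simp [hij])).unique
    ⟨h1, mem_transversalBlock.2 rfl, mem_transversalBlock.2 rfl⟩
    ⟨h2, mem_transversalBlock.2 (by rw [hi]), mem_transversalBlock.2 (by rw [hj])⟩
  have h4 : (l, g' l b) ∈ transversalBlock g b := by
    rw [h3]; exact mem_transversalBlock.2 rfl
  exact mem_transversalBlock.1 h4

end Transversal

section Switching

variable {p : ℕ} {W : Type*} [AddCommGroup W] [Module (ZMod p) W]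

/-- The index of the cell of direction `w` containing `(X, Y)`. -/
def cellIndex (X Y : ZMod p × W) (w : W) : W × W × W :=
  (X.2 - X.1 • w, Y.2 - Y.1 • w, w)

theorem cellIndex_add_smul (X Y : ZMod p × W) (w : W) (a b : ZMod p) :
    cellIndex (X + a • ((1, w) : ZMod p × W)) (Y + b • ((1, w) : ZMod p × W)) w =
      cellIndex X Y w := by
  simp only [cellIndex, Prod.fst_add, Prod.snd_add, Prod.smul_fst, Prod.smul_snd, smul_eq_mul,
    mul_one, add_smul, add_sub_add_right_eq_sub]

/-- Two cells meet. -/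
def CellsMeet (p : ℕ) [Module (ZMod p) W] (c d : W × W × W) : Prop :=
  ∃ X Y : ZMod p × W, cellIndex X Y c.2.2 = c ∧ cellIndex X Y d.2.2 = d

/-- A family of pairwise disjoint cells. -/
def IsCellPacking (p : ℕ) [Module (ZMod p) W] (A : Finset (W × W × W)) : Prop :=
  ∀ c ∈ A, ∀ d ∈ A, CellsMeet p c d → c = d

open Classical in
/-- The shift attached to a family of cells: `(1, w)` on the cells of direction `w`. -/
noncomputable def cellShift (A : Finset (W × W × W)) (X Y : ZMod p × W) : ZMod p × W :=
  if h : ∃ w, cellIndex X Y w ∈ A then (1, h.choose) else 0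

theorem cellShift_of_mem {A : Finset (W × W × W)} (hA : IsCellPacking p A) {X Y : ZMod p × W}
    {w : W} (h : cellIndex X Y w ∈ A) : cellShift A X Y = (1, w) := by
  have hex : ∃ w, cellIndex X Y w ∈ A := ⟨w, h⟩
  rw [cellShift, dif_pos hex]
  have := hA _ hex.choose_spec _ h ⟨X, Y, rfl, rfl⟩
  exact Prod.ext rfl (congrArg (fun c => c.2.2) this)

theorem cellShift_of_forall_notMem {A : Finset (W × W × W)} {X Y : ZMod p × W}
    (h : ∀ w, cellIndex X Y w ∉ A) : cellShift A X Y = 0 :=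
  dif_neg (by push Not; exact h)

theorem cellShift_shifted {A : Finset (W × W × W)} (hA : IsCellPacking p A) (X Y : ZMod p × W)
    (a b : ZMod p) :
    cellShift A (X + a • cellShift A X Y) (Y + b • cellShift A X Y) = cellShift A X Y := by
  by_cases h : ∃ w, cellIndex X Y w ∈ A
  · obtain ⟨w, hw⟩ := h
    rw [cellShift_of_mem hA hw]
    apply cellShift_of_mem hA
    rwa [cellIndex_add_smul]
  · push Not at h
    rw [cellShift_of_forall_notMem h, smul_zero, smul_zero, add_zero, add_zero,
      cellShift_of_forall_notMem h]

/-- The coordinates of the switched transversal design. -/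
noncomputable def switchedCoord (k : ℕ) (A : Finset (W × W × W)) (i : Fin k)
    (b : (ZMod p × W) × (ZMod p × W)) : ZMod p × W :=
  if (i : ℕ) = 0 then b.1 + cellShift A b.1 b.2 else b.1 + ((i : ℕ) : ZMod p) • b.2

theorem injective_shift_prod [Fact p.Prime] {A : Finset (W × W × W)} (hA : IsCellPacking p A)
    {l : ZMod p} (hl : l ≠ 0) {b b' : (ZMod p × W) × (ZMod p × W)}
    (h1 : b.1 + cellShift A b.1 b.2 = b'.1 + cellShift A b'.1 b'.2)
    (h2 : b.1 + l • b.2 = b'.1 + l • b'.2) : b = b' := by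
  have e1 := cellShift_shifted hA b.1 b.2 1 (-l⁻¹)
  have e2 := cellShift_shifted hA b'.1 b'.2 1 (-l⁻¹)
  have h3 : b.2 + (-l⁻¹) • cellShift A b.1 b.2 = b'.2 + (-l⁻¹) • cellShift A b'.1 b'.2 := by
    have h4 := congrArg (fun v => l⁻¹ • v) h2
    have h5 := congrArg (fun v => l⁻¹ • v) h1
    simp only [smul_add, inv_smul_smul₀ hl] at h4 h5
    rw [neg_smul, neg_smul, ← sub_eq_add_neg, ← sub_eq_add_neg]
    have h6 := congrArg₂ (· - ·) h4 h5
    simpa only [add_sub_add_left_eq_sub] using h6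
  rw [one_smul] at e1 e2
  rw [h1, h3, e2] at e1
  rw [e1] at h1 h3
  exact Prod.ext (add_right_cancel h1) (add_right_cancel h3)

theorem bijective_switchedCoord [Fact p.Prime] [Finite W] {k : ℕ} (hkp : k ≤ p)
    {A : Finset (W × W × W)} (hA : IsCellPacking p A) (i j : Fin k) (hij : i ≠ j) :
    Function.Bijective fun b : (ZMod p × W) × (ZMod p × W) =>
      (switchedCoord k A i b, switchedCoord k A j b) := by
  have hcast : ∀ i : Fin k, (i : ℕ) ≠ 0 → ((i : ℕ) : ZMod p) ≠ 0 := by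
    intro i hi h
    rw [ZMod.natCast_eq_zero_iff] at h
    have := Nat.le_of_dvd (Nat.pos_of_ne_zero hi) h
    omega
  have : NeZero p := ⟨(Fact.out : p.Prime).ne_zero⟩
  rw [← Finite.injective_iff_bijective]
  intro b b' h
  obtain ⟨h1, h2⟩ := Prod.ext_iff.1 h
  simp only [switchedCoord] at h1 h2
  split_ifs at h1 h2 with hi hj hj
  · exact absurd (Fin.ext (hi.trans hj.symm)) hij
  · exact injective_shift_prod hA (hcast j hj) h1 h2
  · exact injective_shift_prod hA (hcast i hi) h2 h1
  · have hne : ((i : ℕ) : ZMod p) - ((j : ℕ) : ZMod p) ≠ 0 := by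
      rw [sub_ne_zero]
      intro h
      rw [ZMod.natCast_eq_natCast_iff'] at h
      rw [Nat.mod_eq_of_lt (i.2.trans_le hkp), Nat.mod_eq_of_lt (j.2.trans_le hkp)] at h
      exact hij (Fin.ext h)
    have h3 : (((i : ℕ) : ZMod p) - ((j : ℕ) : ZMod p)) • b.2 =
        (((i : ℕ) : ZMod p) - ((j : ℕ) : ZMod p)) • b'.2 := by
      rw [sub_smul, sub_smul]
      have h6 := congrArg₂ (· - ·) h1 h2
      simpa only [add_sub_add_left_eq_sub] using h6
    have h4 : b.2 = b'.2 := smul_right_injective _ hne h3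
    rw [h4] at h1
    exact Prod.ext (add_right_cancel h1) h4

theorem eq_of_cellShift_eq [Fact p.Prime] {A A' : Finset (W × W × W)} (hA : IsCellPacking p A)
    (hA' : IsCellPacking p A')
    (h : (cellShift A : ZMod p × W → ZMod p × W → ZMod p × W) = cellShift A') : A = A' := by
  have key : ∀ B : Finset (W × W × W), IsCellPacking p B → ∀ c : W × W × W,
      c ∈ B ↔ cellShift B ((0, c.1) : ZMod p × W) (0, c.2.1) = (1, c.2.2) := by
    intro B hB c
    have hc : ∀ w, cellIndex ((0, c.1) : ZMod p × W) (0, c.2.1) w = (c.1, c.2.1, w) := by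
      intro w
      simp [cellIndex]
    constructor
    · intro h
      exact cellShift_of_mem hB (by rw [hc]; exact h)
    · intro h
      by_cases hex : ∃ w, cellIndex ((0, c.1) : ZMod p × W) (0, c.2.1) w ∈ B
      · obtain ⟨w, hw⟩ := hex
        rw [cellShift_of_mem hB hw] at h
        have h2 : w = c.2.2 := (Prod.ext_iff.1 h).2
        rw [hc, h2] at hw
        exact hw
      · push Not at hex
        rw [cellShift_of_forall_notMem hex] at h
        exact absurd (Prod.ext_iff.1 h).1 zero_ne_one
  ext c
  rw [key A hA, key A' hA', h]

theorem card_cellsMeet_le [NeZero p] [Fintype W] [DecidableEq W] (c : W × W × W)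
    [DecidablePred (CellsMeet p c)] :
    (univ.filter fun d => CellsMeet p c d).card ≤ p ^ 2 * Fintype.card W := by
  have h : (univ.filter fun d => CellsMeet p c d) ⊆
      (univ : Finset (ZMod p × ZMod p × W)).image fun a =>
        (c.1 + a.1 • c.2.2 - a.1 • a.2.2, c.2.1 + a.2.1 • c.2.2 - a.2.1 • a.2.2, a.2.2) := by
    intro d hd
    obtain ⟨X, Y, h1, h2⟩ := (mem_filter.1 hd).2
    rw [mem_image]
    refine ⟨(X.1, Y.1, d.2.2), mem_univ _, ?_⟩
    simp only [cellIndex, Prod.ext_iff] at h1 h2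
    refine Prod.ext ?_ (Prod.ext ?_ rfl)
    · simp only
      rw [← h1.1, ← h2.1, sub_add_cancel]
    · simp only
      rw [← h1.2.1, ← h2.2.1, sub_add_cancel]
  refine (card_le_card h).trans (card_image_le.trans ?_)
  rw [card_univ, Fintype.card_prod, Fintype.card_prod, ZMod.card, sq, mul_assoc]

end Switching

/-- Counting the independent sets of a sparse symmetric relation. -/
theorem pow_le_card_independent {α : Type*} [Fintype α] [DecidableEq α] (R : α → α → Prop)
    [DecidableRel R] (hrefl : ∀ a, R a a) (hsymm : ∀ a b, R a b → R b a) {D M w : ℕ}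
    (hD : ∀ a, (univ.filter fun b => R a b).card ≤ D)
    (h1 : 2 * M * D ≤ Fintype.card α) (h2 : 2 * M * w ≤ Fintype.card α) (j : ℕ) (hj : j ≤ M) :
    w ^ j ≤ ((powersetCard j (univ : Finset α)).filter fun A =>
      ∀ a ∈ A, ∀ b ∈ A, R a b → a = b).card := by
  induction j with
  | zero => simp [filter_singleton]
  | succ j ih =>
    specialize ih (by omega)
    set N : Finset (Finset α) := (powersetCard j (univ : Finset α)).filter fun A =>
      ∀ a ∈ A, ∀ b ∈ A, R a b → a = b with hN
    set N' : Finset (Finset α) := (powersetCard (j + 1) (univ : Finset α)).filter fun A =>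
      ∀ a ∈ A, ∀ b ∈ A, R a b → a = b with hN'
    let free : Finset α → Finset α := fun A => univ.filter fun b => ∀ a ∈ A, ¬ R a b
    have hcard : ∀ A ∈ N, A.card = j := fun A hA => (mem_powersetCard.1 (mem_filter.1 hA).1).2
    have hfree : ∀ A ∈ N, M * w ≤ (free A).card := by
      intro A hA
      have hcov : (univ : Finset α) ⊆ free A ∪ A.biUnion fun a => univ.filter fun b => R a b := by
        intro b _
        by_cases hb : ∃ a ∈ A, R a b
        · obtain ⟨a, ha, hab⟩ := hb
          exact mem_union_right _ (mem_biUnion.2 ⟨a, ha, mem_filter.2 ⟨mem_univ _, hab⟩⟩)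
        · push Not at hb
          exact mem_union_left _ (mem_filter.2 ⟨mem_univ _, hb⟩)
      have h3 := (card_le_card hcov).trans (card_union_le _ _)
      have h4 : (A.biUnion fun a => univ.filter fun b => R a b).card ≤ A.card * D :=
        card_biUnion_le_card_mul _ _ _ fun a _ => hD a
      rw [card_univ] at h3
      have h5 : A.card * D ≤ M * D := Nat.mul_le_mul_right _ (by rw [hcard A hA]; omega)
      nlinarith
    have hnotMem : ∀ A b, b ∈ free A → b ∉ A := fun A b hb hbA =>
      (mem_filter.1 hb).2 b hbA (hrefl b)
    let P : Finset (Σ _ : Finset α, α) := N.sigma free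
    have hP : M * w * N.card ≤ P.card := by
      rw [card_sigma, mul_comm, ← smul_eq_mul]
      exact card_nsmul_le_sum _ _ _ hfree
    have hmap : ∀ x ∈ P, insert x.2 x.1 ∈ N' := by
      rintro ⟨A, b⟩ hx
      obtain ⟨hA, hb⟩ := mem_sigma.1 hx
      refine mem_filter.2 ⟨mem_powersetCard.2 ⟨subset_univ _, ?_⟩, ?_⟩
      · rw [card_insert_of_notMem (hnotMem A b hb), hcard A hA]
      · have hb' := (mem_filter.1 hb).2
        intro a ha c hc hac
        rcases mem_insert.1 ha with rfl | ha <;> rcases mem_insert.1 hc with rfl | hc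
        · rfl
        · exact absurd (hsymm _ _ hac) (hb' c hc)
        · exact absurd hac (hb' a ha)
        · exact (mem_filter.1 hA).2 a ha c hc hac
    have hfib : ∀ B ∈ N', (P.filter fun x => insert x.2 x.1 = B).card ≤ M := by
      intro B hB
      have hBc : B.card = j + 1 := (mem_powersetCard.1 (mem_filter.1 hB).1).2
      rw [← hBc] at hj
      refine le_trans (card_le_card_of_injOn (fun x => x.2) ?_ ?_) hj
      · intro x hx
        rw [← (mem_filter.1 hx).2]
        exact mem_insert_self _ _
      · rintro ⟨A, b⟩ hx ⟨A', b'⟩ hx' (rfl : b = b')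
        obtain ⟨hx1, hx2⟩ := mem_filter.1 hx
        obtain ⟨hx1', hx2'⟩ := mem_filter.1 hx'
        have h3 := hnotMem A b (mem_sigma.1 hx1).2
        have h4 := hnotMem A' b (mem_sigma.1 hx1').2
        have h5 : A = A' := by
          rw [← erase_insert h3, ← erase_insert h4]
          exact congrArg (fun B => B.erase b) (hx2.trans hx2'.symm)
        rw [h5]
    have h3 : P.card ≤ M * N'.card := by
      have h4 := card_eq_sum_card_fiberwise (s := P) (t := N')
        (f := fun x : (Σ _ : Finset α, α) => insert x.2 x.1) hmap
      rw [h4, mul_comm, ← smul_eq_mul]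
      exact sum_le_card_nsmul _ _ _ hfib
    have h4 : w * N.card ≤ N'.card :=
      Nat.le_of_mul_le_mul_left (by rw [← mul_assoc]; exact hP.trans h3) (by omega : 0 < M)
    rw [pow_succ, mul_comm]
    exact (Nat.mul_le_mul_left _ ih).trans h4

/-- The set of values of a partial sequence. -/
def partialRange [Fintype V] {a : ℕ} (g : Fin a → Option V) : Finset V :=
  univ.filter fun v => ∃ i, g i = some v

theorem exists_partialRange_eq [Fintype V] {a : ℕ} {I : Finset V} (hI : I.card ≤ a) :
    ∃ g : Fin a → Option V, partialRange g = I := by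
  refine ⟨fun i => I.toList[(i : ℕ)]?, ?_⟩
  ext v
  simp only [partialRange, mem_filter, mem_univ, true_and]
  rw [← mem_toList, List.mem_iff_getElem?]
  constructor
  · rintro ⟨i, hi⟩
    exact ⟨i, hi⟩
  · rintro ⟨i, hi⟩
    obtain ⟨hlt, -⟩ := List.getElem?_eq_some_iff.1 hi
    rw [length_toList] at hlt
    exact ⟨⟨i, hlt.trans_le hI⟩, hi⟩

/-- A large family of hypergraphs with small independence number contains one with large `ϑ`. -/
theorem exists_card_le_pow_vartheta [Fintype V] {k a : ℕ} (hk : 0 < k)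
    {𝒟 : Finset (Finset (Finset V))} (hne : 𝒟.Nonempty) (hcard : ∀ S ∈ 𝒟, ∀ e ∈ S, e.card = k)
    (hind : ∀ S ∈ 𝒟, ∀ I, IsIndep S I → I.card ≤ a) :
    ∃ S ∈ 𝒟, 𝒟.card ≤ (Fintype.card V + 1) ^ (a * vartheta k S) := by
  obtain ⟨S, hS, hmax⟩ := exists_max_image 𝒟 (vartheta k) hne
  refine ⟨S, hS, ?_⟩
  let decode : (Fin (vartheta k S) → Fin a → Option V) → Finset (Finset V) := fun f =>
    univ.filter fun e => e.card = k ∧ ∀ j, ¬ e ⊆ partialRange (f j)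
  have hsub : 𝒟 ⊆ univ.image decode := by
    intro S' hS'
    obtain ⟨I, hI, hcov⟩ := vartheta_spec (hcard S' hS')
    have hle := hmax S' hS'
    have hg : ∀ j, ∃ g : Fin a → Option V, partialRange g = I j := fun j =>
      exists_partialRange_eq (hind S' hS' _ (hI j))
    choose g hg using hg
    refine mem_image.2 ⟨fun j => if h : (j : ℕ) < vartheta k S' then g ⟨j, h⟩ else fun _ => none,
      mem_univ _, ?_⟩
    ext e
    simp only [decode, mem_filter, mem_univ, true_and]
    constructor
    · rintro ⟨he, hnot⟩
      by_contra heS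
      obtain ⟨j, hj⟩ := hcov e he heS
      refine hnot ⟨j, j.2.trans_le hle⟩ ?_
      rw [dif_pos j.2, hg]
      exact hj
    · intro he
      refine ⟨hcard S' hS' e he, fun j hj => ?_⟩
      split_ifs at hj with h
      · rw [hg] at hj
        exact hI _ e he hj
      · have h0 : e = ∅ := by
          rw [← subset_empty]
          refine hj.trans fun v hv => ?_
          simp [partialRange] at hv
        have := hcard S' hS' e he
        rw [h0, card_empty] at this
        omega
  refine (card_le_card hsub).trans (card_image_le.trans ?_)
  rw [card_univ, Fintype.card_fun, Fintype.card_fun, Fintype.card_option, Fintype.card_fin,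
    Fintype.card_fin, pow_mul]

section Transport

variable {U : Type*} (φ : U ≃ V)

theorem IsIndep.map_symm {S : Finset (Finset U)} {I : Finset V}
    (hI : IsIndep (S.image (Finset.map φ.toEmbedding)) I) :
    IsIndep S (I.map φ.symm.toEmbedding) := by
  intro e he hsub
  refine hI _ (mem_image_of_mem _ he) fun v hv => ?_
  obtain ⟨u, hu, rfl⟩ := mem_map.1 hv
  obtain ⟨w, hw, rfl⟩ := mem_map.1 (hsub hu)
  simpa using hw

variable [DecidableEq U]

theorem IsFullSteiner.image_equiv {k : ℕ} {S : Finset (Finset U)} (hS : IsFullSteiner k S) :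
    IsFullSteiner k (S.image (Finset.map φ.toEmbedding)) := by
  refine isFullSteiner_iff.2 ⟨fun e he => ?_, fun x y hxy =>
    hS.existsUnique_mem_image _ (φ.surjective x) (φ.surjective y) hxy⟩
  obtain ⟨f, hf, rfl⟩ := mem_image.1 he
  rw [card_map, hS.1 f hf]

theorem vartheta_le_image_equiv [Fintype V] {k : ℕ} {S : Finset (Finset U)}
    (hS : IsFullSteiner k S) :
    vartheta k S ≤ vartheta k (S.image (Finset.map φ.toEmbedding)) := by
  obtain ⟨I, hI, hcov⟩ := vartheta_spec (hS.image_equiv φ).1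
  refine Nat.sInf_le ⟨fun j => (I j).map φ.symm.toEmbedding, fun j => (hI j).map_symm φ,
    fun e he heS => ?_⟩
  obtain ⟨j, hj⟩ := hcov (e.map φ.toEmbedding) (by rw [card_map, he]) fun h => by
    obtain ⟨f, hf, hfe⟩ := mem_image.1 h
    rw [Finset.map_injective _ hfe] at hf
    exact heS hf
  refine ⟨j, fun u hu => mem_map.2 ⟨φ u, hj (mem_map_of_mem _ hu), by simp⟩⟩

end Transport

/-- Switching a transversal design in many ways gives a Steiner system with large `ϑ`. -/
theorem exists_isFullSteiner_card_pow_le {k p : ℕ} (hk : 3 ≤ k) [Fact p.Prime] (hkp : k ≤ p)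
    {W : Type*} [AddCommGroup W] [Module (ZMod p) W] [Fintype W] [DecidableEq W]
    {T : Finset (Finset (ZMod p × W))} (hT : IsFullSteiner k T) {s : ℕ}
    (hs : ∀ I, IsIndep T I → I.card ≤ s) {M : ℕ} (hM : 2 * M * p ^ 2 ≤ Fintype.card W ^ 2) :
    ∃ S : Finset (Finset (Fin k × (ZMod p × W))), IsFullSteiner k S ∧
      Fintype.card W ^ M ≤ (k * (p * Fintype.card W) + 1) ^ (k * s * vartheta k S) := by
  classical
  have hp0 : 0 < p := (Fact.out : p.Prime).pos
  have : NeZero p := ⟨hp0.ne'⟩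
  have hW : Fintype.card (W × W × W) = Fintype.card W ^ 2 * Fintype.card W := by
    rw [Fintype.card_prod, Fintype.card_prod]
    ring
  have hpack := pow_le_card_independent (CellsMeet (W := W) p)
    (fun c => ⟨(0, c.1), (0, c.2.1), by simp [cellIndex], by simp [cellIndex]⟩)
    (fun c d ⟨X, Y, h1, h2⟩ => ⟨X, Y, h2, h1⟩) (M := M) (w := Fintype.card W)
    (fun c => card_cellsMeet_le c)
    (by rw [hW, ← mul_assoc]; exact Nat.mul_le_mul_right _ hM)
    (by
      rw [hW]
      refine Nat.mul_le_mul_right _ (le_trans ?_ hM)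
      exact Nat.le_mul_of_pos_right _ (pow_pos hp0 2)) M le_rfl
  set N : Finset (Finset (W × W × W)) := (powersetCard M univ).filter fun A =>
    ∀ c ∈ A, ∀ d ∈ A, CellsMeet p c d → c = d with hN
  have hNA : ∀ A ∈ N, IsCellPacking p A := fun A hA => (mem_filter.1 hA).2
  let sys : Finset (W × W × W) → Finset (Finset (Fin k × (ZMod p × W))) := fun A =>
    filledSystem T (switchedCoord k A)
  have hinj : Set.InjOn sys N := by
    intro A hA A' hA' h
    have hbij := bijective_switchedCoord (k := k) hkp (hNA A' hA')
    have h1 := eq_of_filledSystem_eq hT hbij h (i := ⟨1, by omega⟩) (j := ⟨2, by omega⟩)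
      (by simp) rfl rfl
    refine eq_of_cellShift_eq (hNA A hA) (hNA A' hA') ?_
    funext X Y
    have h2 := congrFun (congrFun h1 ⟨0, by omega⟩) (X, Y)
    simpa [switchedCoord] using h2
  have hpos : 0 < Fintype.card W := Fintype.card_pos_iff.2 ⟨0⟩
  have hfull : ∀ S ∈ N.image sys, IsFullSteiner k S := by
    intro S hS
    obtain ⟨A, hA, rfl⟩ := mem_image.1 hS
    exact isFullSteiner_filledSystem hT (bijective_switchedCoord hkp (hNA A hA))
  obtain ⟨S, hS, hle⟩ := exists_card_le_pow_vartheta (k := k) (a := k * s) (by omega)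
    (𝒟 := N.image sys) (Nonempty.image (card_pos.1 ((pow_pos hpos M).trans_le hpack)) _)
    (fun S hS => (hfull S hS).1) (by
      intro S hS I hI
      obtain ⟨A, hA, rfl⟩ := mem_image.1 hS
      exact card_le_of_isIndep_filledSystem hs _ hI)
  refine ⟨S, hfull S hS, ?_⟩
  rw [card_image_of_injOn hinj, Fintype.card_prod, Fintype.card_prod, Fintype.card_fin,
    ZMod.card] at hle
  exact hpack.trans hle

theorem sq_le_of_pow_le_pow {k p x s v : ℕ} (hp : 0 < p) (hx2 : 2 ≤ x) (hpx : 2 * p ≤ x)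
    (hkx : k * p ≤ x)
    (h : x ^ (x ^ 2 / (2 * p ^ 2)) ≤ (k * (p * x) + 1) ^ (k * s * v)) :
    (p * x) ^ 2 ≤ 12 * p ^ 4 * k * s * v := by
  have h1 : k * (p * x) + 1 ≤ x ^ 3 := by
    have : k * p * x ≤ x * x := Nat.mul_le_mul_right _ hkx
    nlinarith
  have h2 := h.trans (Nat.pow_le_pow_left h1 _)
  rw [← pow_mul] at h2
  have h3 : x ^ 2 / (2 * p ^ 2) ≤ 3 * (k * s * v) := (Nat.pow_le_pow_iff_right hx2).1 h2
  have h4 : 2 * p ^ 2 ≤ x ^ 2 := by nlinarith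
  have hp2 : 0 < 2 * p ^ 2 := by positivity
  have h5 : 1 ≤ x ^ 2 / (2 * p ^ 2) := (Nat.one_le_div_iff hp2).2 h4
  have h6 := Nat.lt_mul_div_succ (x ^ 2) hp2
  have h7 : x ^ 2 ≤ 2 * p ^ 2 * (6 * (k * s * v)) := by
    refine h6.le.trans (Nat.mul_le_mul_left _ ?_)
    omega
  calc (p * x) ^ 2 = p ^ 2 * x ^ 2 := by ring
    _ ≤ p ^ 2 * (2 * p ^ 2 * (6 * (k * s * v))) := Nat.mul_le_mul_left _ h7
    _ = 12 * p ^ 4 * k * s * v := by ring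

/-- Steiner systems with large `ϑ` on arbitrarily many points. -/
theorem exists_isFullSteiner_pow_le (k : ℕ) (hk : 3 ≤ k) :
    ∃ K : ℝ, 0 < K ∧ ∀ N : ℕ, ∃ n : ℕ, N ≤ n ∧ 2 ≤ n ∧ ∃ S : Finset (Finset (Fin n)),
      IsFullSteiner k S ∧ (n : ℝ) ^ k ≤ K * Real.log n * (vartheta k S : ℝ) ^ (k - 1) := by
  obtain ⟨C, hC, q₀, hplane⟩ := exists_isFullSteiner_plane_indep_le k hk
  have hkk : k * (k - 1) ≠ 0 := Nat.mul_ne_zero (by omega) (by omega)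
  obtain ⟨p, hp, hkp, hmod⟩ := Nat.exists_prime_gt_modEq_one k hkk
  have : Fact p.Prime := ⟨hp⟩
  have hp0 := hp.pos
  refine ⟨(k : ℝ) ^ k * (12 * p ^ 4 * k) ^ (k - 1) * C, by positivity, fun N => ?_⟩
  set r : ℕ := N + q₀ + k * p + 2 * p with hr
  let F := GaloisField p (r + 1)
  let W := Fin (2 * r + 1) → ZMod p
  let _ : Fintype F := Fintype.ofFinite F
  let _ : DecidableEq F := Classical.decEq F
  have hF : Fintype.card F = p ^ (r + 1) := by
    rw [← Nat.card_eq_fintype_card]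
    exact GaloisField.card p _ (by omega)
  have hW : Fintype.card W = p ^ (2 * r + 1) := by
    rw [Fintype.card_fun, ZMod.card, Fintype.card_fin]
  have hrF : r ≤ Fintype.card F := by
    rw [hF]
    exact (Nat.lt_pow_self hp.one_lt).le.trans (Nat.pow_le_pow_right hp0 (by omega))
  have hrW : r ≤ Fintype.card W := by
    rw [hW]
    exact (Nat.lt_pow_self hp.one_lt).le.trans (Nat.pow_le_pow_right hp0 (by omega))
  have hdvd : k * (k - 1) ∣ Fintype.card F - 1 := by
    rw [hF, ← Nat.modEq_iff_dvd' (Nat.one_le_pow _ _ hp0)]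
    simpa using (hmod.pow (r + 1)).symm
  obtain ⟨T₀, hT₀, hind⟩ := hplane F (by omega) hdvd
  have hm : Fintype.card (F × F) = p * Fintype.card W := by
    rw [Fintype.card_prod, hF, hW]
    ring
  let φ : F × F ≃ ZMod p × W := Fintype.equivOfCardEq (by
    rw [hm, Fintype.card_prod, ZMod.card])
  have hT := hT₀.image_equiv φ
  classical
  obtain ⟨J, hJ, hmax⟩ := exists_max_image (univ.filter fun I => IsIndep T₀ I) Finset.card
    ⟨∅, mem_filter.2 ⟨mem_univ _, fun e he h => by
      have := hT₀.1 e he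
      rw [subset_empty.1 h, card_empty] at this
      omega⟩⟩
  obtain ⟨S, hS, hpow⟩ := exists_isFullSteiner_card_pow_le hk hkp.le hT (s := J.card)
    (M := Fintype.card W ^ 2 / (2 * p ^ 2))
    (fun I hI => by
      have := hmax _ (mem_filter.2 ⟨mem_univ _, hI.map_symm φ⟩)
      rwa [card_map] at this)
    (by
      rw [mul_comm 2, mul_assoc]
      exact Nat.div_mul_le_self _ _)
  set m := p * Fintype.card W with hmdef
  let ψ : Fin k × (ZMod p × W) ≃ Fin (k * m) := Fintype.equivFinOfCardEq (by
    rw [Fintype.card_prod, Fintype.card_fin, Fintype.card_prod, ZMod.card])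
  have hp2 := hp.two_le
  have hWm : Fintype.card W ≤ m := Nat.le_mul_of_pos_left _ hp0
  have hmn : m ≤ k * m := Nat.le_mul_of_pos_left _ (by omega)
  refine ⟨k * m, by omega, by omega, _, hS.image_equiv ψ, ?_⟩
  have hsq := sq_le_of_pow_le_pow hp0 (by omega) (by omega) (by omega) hpow
  rw [← hmdef] at hsq
  set v := vartheta k S with hv
  have hvle : v ≤ vartheta k (S.image (Finset.map ψ.toEmbedding)) := vartheta_le_image_equiv ψ hS
  set q : ℝ := ((Fintype.card F : ℕ) : ℝ) with hq
  have hqm : q ^ 2 = m := by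
    rw [hq, ← hm, Fintype.card_prod]
    push_cast
    ring
  have hq1 : 1 ≤ q := by
    rw [hq]
    exact_mod_cast (by omega : 1 ≤ Fintype.card F)
  have hm0 : (0 : ℝ) < m := by rw [← hqm]; positivity
  have hJC : (J.card : ℝ) ^ (k - 1) ≤ C * (m : ℝ) ^ (k - 2) * Real.log q := by
    have := hind J (mem_filter.1 hJ).2
    rwa [pow_mul, hqm] at this
  have hlog : Real.log q ≤ Real.log (k * m : ℕ) := by
    refine Real.log_le_log (by positivity) ?_
    have h1 : (m : ℝ) ≤ (k * m : ℕ) := by exact_mod_cast hmn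
    rw [← hqm] at h1
    nlinarith
  have hlog0 : 0 ≤ Real.log q := Real.log_nonneg hq1
  have hsqR : (m : ℝ) ^ 2 ≤ 12 * p ^ 4 * k * J.card * v := by exact_mod_cast hsq
  have h1 : (m : ℝ) ^ (k - 2) * (m : ℝ) ^ k ≤
      (m : ℝ) ^ (k - 2) * ((12 * p ^ 4 * k) ^ (k - 1) * C * Real.log q * (v : ℝ) ^ (k - 1)) := by
    calc (m : ℝ) ^ (k - 2) * (m : ℝ) ^ k = ((m : ℝ) ^ 2) ^ (k - 1) := by
          rw [← pow_add, ← pow_mul]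
          congr 1
          omega
      _ ≤ (12 * p ^ 4 * k * J.card * v) ^ (k - 1) := pow_le_pow_left₀ (by positivity) hsqR _
      _ = (12 * p ^ 4 * k) ^ (k - 1) * (J.card : ℝ) ^ (k - 1) * (v : ℝ) ^ (k - 1) := by
          rw [mul_pow, mul_pow]
      _ ≤ (12 * p ^ 4 * k) ^ (k - 1) * (C * (m : ℝ) ^ (k - 2) * Real.log q) *
          (v : ℝ) ^ (k - 1) := by gcongr
      _ = _ := by ring
  have h2 := le_of_mul_le_mul_left h1 (by positivity)
  have hvR : (v : ℝ) ≤ vartheta k (S.image (Finset.map ψ.toEmbedding)) := by exact_mod_cast hvle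
  calc ((k * m : ℕ) : ℝ) ^ k = (k : ℝ) ^ k * (m : ℝ) ^ k := by rw [Nat.cast_mul, mul_pow]
    _ ≤ (k : ℝ) ^ k * ((12 * p ^ 4 * k) ^ (k - 1) * C * Real.log (k * m : ℕ) *
        (vartheta k (S.image (Finset.map ψ.toEmbedding)) : ℝ) ^ (k - 1)) := by
        have := hlog0.trans hlog
        refine mul_le_mul_of_nonneg_left (h2.trans ?_) (by positivity)
        gcongr
    _ = _ := by ring

/-- For every `k ≥ 3` there are positive constants `c₁, c₂` depending only on `k` such that for
infinitely many `n` the following holds: some full Steiner `(n,k,2)`-system `S` has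
`ϑ(S) ≥ c₁ n^{k/(k-1)} / (log n)^{1/(k-1)}`, and every full Steiner `(n,k,2)`-system `S`
has `ϑ(S) ≤ c₂ n^{k/(k-1)} log n`. -/
theorem full_steiner_bounds (k : ℕ) (hk : 3 ≤ k) :
    ∃ c₁ c₂ : ℝ, 0 < c₁ ∧ 0 < c₂ ∧
      ∀ N : ℕ, ∃ n : ℕ, N ≤ n ∧
        (∃ S : Finset (Finset (Fin n)), IsFullSteiner k S ∧
          c₁ * (n : ℝ) ^ ((k : ℝ) / ((k : ℝ) - 1)) / (Real.log n) ^ ((1 : ℝ) / ((k : ℝ) - 1))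
            ≤ (vartheta k S : ℝ)) ∧
        (∀ S : Finset (Finset (Fin n)), IsFullSteiner k S →
          (vartheta k S : ℝ) ≤ c₂ * (n : ℝ) ^ ((k : ℝ) / ((k : ℝ) - 1)) * Real.log n) := by
  obtain ⟨c₂, hc₂, hupper⟩ := vartheta_le_of_isFullSteiner k hk
  obtain ⟨K, hK, hlower⟩ := exists_isFullSteiner_pow_le k hk
  refine ⟨(K ^ ((1 : ℝ) / ((k : ℝ) - 1)))⁻¹, c₂, by positivity, hc₂, fun N => ?_⟩
  obtain ⟨n, hNn, hn2, S, hS, hpow⟩ := hlower N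
  refine ⟨n, hNn, ⟨S, hS, ?_⟩, hupper n hn2⟩
  have hlog : 0 < Real.log n := Real.log_pos (by exact_mod_cast hn2)
  have hk1 : ((k - 1 : ℕ) : ℝ) = (k : ℝ) - 1 := by
    rw [Nat.cast_sub (by omega), Nat.cast_one]
  have hroot := Real.rpow_le_rpow (by positivity) hpow
    (show 0 ≤ (1 : ℝ) / ((k : ℝ) - 1) by rw [← hk1]; positivity)
  have hv : ((vartheta k S : ℝ) ^ (k - 1)) ^ ((1 : ℝ) / ((k : ℝ) - 1)) = vartheta k S := by
    rw [← hk1, one_div]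
    exact Real.pow_rpow_inv_natCast (Nat.cast_nonneg _) (by omega)
  rw [Real.mul_rpow (by positivity) (by positivity), hv, Real.mul_rpow hK.le hlog.le,
    ← Real.rpow_natCast_mul (by positivity), mul_one_div] at hroot
  rw [div_le_iff₀ (by positivity), inv_mul_le_iff₀ (by positivity)]
  calc _ ≤ _ := hroot
    _ = _ := by ring
end
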